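/- Assume the existence of a strongly inaccessible cardinal is consistent with ZFC. Then it is consistent with ZFC + CH + 2^{ω₁} > ω₂ that there are no Kurepa trees, yet there exist ω₁-many Jech–Kunen trees T^α (α < ω₁) such that α ≠ α' implies |B(T^α)| ≠ |B(T^{α'})|. -/

import Mathlib

open FirstOrder FirstOrder.Language

/-! ### The first-order language and theory of ZFC -/

/-- The language of set theory: one binary relation `∈`. -/
def memLang : FirstOrder.Language where
  Functions := fun _ => Empty
  Relations := fun n => match n with | 2 => PUnit | _ => Empty

/-- The membership relation symbol. -/
abbrev memSym : memLang.Relations 2 := PUnit.unit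

/-- `xᵢ ∈ xⱼ` as a bounded formula. -/
def mem' {n : ℕ} (i j : Fin n) : memLang.BoundedFormula Empty n :=
  memSym.boundedFormula₂ (Term.var (Sum.inr i)) (Term.var (Sum.inr j))

/-- `xᵢ = xⱼ` as a bounded formula. -/
def eq' {n : ℕ} (i j : Fin n) : memLang.BoundedFormula Empty n :=
  Term.bdEqual (Term.var (Sum.inr i)) (Term.var (Sum.inr j))

def extAx : memLang.Sentence :=
  ∀' ∀' ((∀' (mem' 2 0 ⇔ mem' 2 1)) ⟹ eq' 0 1)

def pairAx : memLang.Sentence :=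
  ∀' ∀' ∃' ∀' (mem' 3 2 ⇔ (eq' 3 0 ⊔ eq' 3 1))

def unionAx : memLang.Sentence :=
  ∀' ∃' ∀' (mem' 2 1 ⇔ ∃' (mem' 3 0 ⊓ mem' 2 3))

def powerAx : memLang.Sentence :=
  ∀' ∃' ∀' (mem' 2 1 ⇔ ∀' (mem' 3 2 ⟹ mem' 3 0))

def infAx : memLang.Sentence :=
  ∃' ((∃' (mem' 1 0 ⊓ ∀' ∼(mem' 2 1))) ⊓
    ∀' (mem' 1 0 ⟹ ∃' (mem' 2 0 ⊓ ∀' (mem' 3 2 ⇔ (mem' 3 1 ⊔ eq' 3 1)))))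

def foundAx : memLang.Sentence :=
  ∀' ((∃' (mem' 1 0)) ⟹ ∃' (mem' 1 0 ⊓ ∀' (mem' 2 1 ⟹ ∼(mem' 2 0))))

def choiceAx : memLang.Sentence :=
  ∀' (((∀' (mem' 1 0 ⟹ ∃' (mem' 2 1))) ⊓
        (∀' ∀' (((mem' 1 0 ⊓ mem' 2 0) ⊓ ∃' (mem' 3 1 ⊓ mem' 3 2)) ⟹ eq' 1 2))) ⟹
    ∃' ∀' (mem' 2 0 ⟹ ∃' ((mem' 3 2 ⊓ mem' 3 1) ⊓ ∀' ((mem' 4 2 ⊓ mem' 4 1) ⟹ eq' 4 3))))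

/-- The separation schema: for each formula `φ(p₁,…,pₙ,z)`,
`∀ p⃗ ∀ a ∃ b ∀ z (z ∈ b ↔ z ∈ a ∧ φ(p⃗, z))`. -/
def sepAx (n : ℕ) (φ : memLang.BoundedFormula Empty (n + 1)) : memLang.Sentence :=
  (∀' ∃' ∀' (mem' ⟨n + 2, by omega⟩ ⟨n + 1, by omega⟩ ⇔
      (mem' ⟨n + 2, by omega⟩ ⟨n, by omega⟩ ⊓ φ.liftAt 2 n))).alls

/-- The collection (replacement) schema: for each formula `φ(p₁,…,pₙ,x,y)`,
`∀ p⃗ ∀ a ∃ b ∀ x ∈ a ((∃ y φ) → ∃ y ∈ b φ)`. -/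
def collAx (n : ℕ) (φ : memLang.BoundedFormula Empty (n + 2)) : memLang.Sentence :=
  (∀' ∃' ∀' (mem' ⟨n + 2, by omega⟩ ⟨n, by omega⟩ ⟹
      ((∃' (φ.liftAt 2 n)) ⟹
        ∃' (mem' ⟨n + 3, by omega⟩ ⟨n + 1, by omega⟩ ⊓ φ.liftAt 2 n)))).alls

/-- The first-order theory ZFC (with the collection form of replacement). -/
def ZFCTheory : memLang.Theory :=
  {extAx, pairAx, unionAx, powerAx, infAx, foundAx, choiceAx} ∪
    (⋃ n : ℕ, Set.range (sepAx n)) ∪ (⋃ n : ℕ, Set.range (collAx n))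

/-- The membership relation of a `memLang`-structure. -/
def memE (V : Type) (str : memLang.Structure V) : V → V → Prop :=
  fun x y => str.RelMap memSym ![x, y]
/-! ### Set-theoretic notions, interpreted in a model `(V, E)` of ZFC.
All of the following are first-order expressible, so for a model of (first-order)
ZFC they are exactly the relativized notions. -/

section Semantics

variable {V : Type} (E : V → V → Prop)

/-- `x ⊆ y` in `V`. -/
def SubV (x y : V) : Prop := ∀ z, E z x → E z y

def IsEmptyV (e : V) : Prop := ∀ z, ¬ E z e

def IsSingletonOf (s a : V) : Prop := ∀ z, E z s ↔ z = a

def IsUPairOf (u a b : V) : Prop := ∀ z, E z u ↔ (z = a ∨ z = b)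

/-- `p` is the Kuratowski ordered pair `⟨a, b⟩`. -/
def IsOPairOf (p a b : V) : Prop :=
  ∃ s u, IsSingletonOf E s a ∧ IsUPairOf E u a b ∧ IsUPairOf E p s u

/-- `f(x) = y`, for `f` a set of ordered pairs. -/
def FunVal (f x y : V) : Prop := ∃ p, E p f ∧ IsOPairOf E p x y

/-- `f` is a function with domain `a` (a set of ordered pairs in `V`). -/
def IsFuncOn (f a : V) : Prop :=
  (∀ p, E p f → ∃ x y, IsOPairOf E p x y) ∧
  (∀ x y y', FunVal E f x y → FunVal E f x y' → y = y') ∧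
  (∀ x, (∃ y, FunVal E f x y) ↔ E x a)

/-- `f : a → b` in `V`. -/
def IsFuncInto (f a b : V) : Prop := IsFuncOn E f a ∧ ∀ x y, FunVal E f x y → E y b

def InjFun (f : V) : Prop := ∀ x x' y, FunVal E f x y → FunVal E f x' y → x = x'

/-- `|a| ≤ |b|` in `V`: an injection of `a` into `b` exists in `V`. -/
def InjInto (a b : V) : Prop := ∃ f, IsFuncInto E f a b ∧ InjFun E f

/-- `|a| = |b|` in `V`: a bijection exists in `V`. -/
def EquinumV (a b : V) : Prop :=
  ∃ f, IsFuncInto E f a b ∧ InjFun E f ∧ ∀ y, E y b → ∃ x, FunVal E f x y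

def IsTransSet (x : V) : Prop := ∀ y, E y x → SubV E y x

/-- `x` is an ordinal: a transitive set linearly ordered by `E`. -/
def IsOrdV (x : V) : Prop :=
  IsTransSet E x ∧ ∀ y z, E y x → E z x → (E y z ∨ y = z ∨ E z y)

def IsLimitOrdV (x : V) : Prop :=
  IsOrdV E x ∧ (∃ y, E y x) ∧ ∀ y, E y x → ∃ z, E z x ∧ E y z

/-- `w = ω` in `V`: the least limit ordinal. -/
def IsOmegaV (w : V) : Prop := IsLimitOrdV E w ∧ ∀ x, E x w → ¬ IsLimitOrdV E x

/-- `x` is countable in `V`. -/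
def CountableV (x : V) : Prop := ∃ w, IsOmegaV E w ∧ InjInto E x w

/-- `k = ω₁` in `V`: the least uncountable ordinal. -/
def IsOmega1V (k : V) : Prop :=
  IsOrdV E k ∧ ¬ CountableV E k ∧ ∀ a, E a k → CountableV E a

/-- `k = ω₂` in `V`: the least ordinal of cardinality `> ω₁`. -/
def IsOmega2V (k : V) : Prop :=
  IsOrdV E k ∧ ∀ k₁, IsOmega1V E k₁ → (¬ InjInto E k k₁ ∧ ∀ a, E a k → InjInto E a k₁)

/-- `p = 𝒫(x)` in `V`. -/
def IsPowOf (p x : V) : Prop := ∀ z, E z p ↔ SubV E z x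

/-- CH holds in `V`: `𝒫(ω)` is equinumerous with `ω₁`. -/
def CHV : Prop :=
  ∀ w p k₁, IsOmegaV E w → IsPowOf E p w → IsOmega1V E k₁ → EquinumV E p k₁

/-- `2^{ω₁} > ω₂` holds in `V`: `𝒫(ω₁)` does not inject into `ω₂`. -/
def PowOmega1AboveOmega2V : Prop :=
  ∀ k₁ p k₂, IsOmega1V E k₁ → IsPowOf E p k₁ → IsOmega2V E k₂ → ¬ InjInto E p k₂

/-- `k` is a cardinal in `V`. -/
def IsCardV (k : V) : Prop := IsOrdV E k ∧ ∀ a, E a k → ¬ EquinumV E a k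

/-- `k` is regular in `V`: every function from a smaller ordinal into `k` is bounded. -/
def IsRegularV (k : V) : Prop :=
  IsOrdV E k ∧ ∀ a f, E a k → IsFuncInto E f a k →
    ∃ b, E b k ∧ ∀ x y, FunVal E f x y → E y b

/-- `k` is strongly inaccessible in `V`. -/
def IsInaccessibleV (k : V) : Prop :=
  IsCardV E k ∧ ¬ CountableV E k ∧ IsRegularV E k ∧
    ∀ a p, E a k → IsPowOf E p a → ∃ b, E b k ∧ InjInto E p b

def IsOneV (o : V) : Prop := ∀ z, E z o ↔ IsEmptyV E z

/-- `t = 2 = {0, 1}` in `V`. -/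
def IsTwoV (t : V) : Prop := ∀ z, E z t ↔ (IsEmptyV E z ∨ IsOneV E z)

/-- `x` is a node of `2^{<ω₁}` in `V` (`k₁` standing for ω₁): a function from a
countable ordinal into `2`. -/
def IsNodeV (k₁ x : V) : Prop :=
  ∃ a t, E a k₁ ∧ IsOrdV E a ∧ IsTwoV E t ∧ IsFuncInto E x a t

/-- The node `x` has domain (height) `a`. -/
def HasDomV (x a : V) : Prop := ∀ u, (∃ y, FunVal E x u y) ↔ E u a

/-- `t` is a tree in `V`: a subtree of `2^{<ω₁}`, ordered by inclusion. -/
def IsTreeV (k₁ t : V) : Prop := ∀ x, E x t → IsNodeV E k₁ x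

/-- `t` is an ω₁-tree in `V`: cardinality ω₁ and height ω₁. -/
def IsOmega1TreeV (k₁ t : V) : Prop :=
  IsTreeV E k₁ t ∧ EquinumV E t k₁ ∧ ∀ a, E a k₁ → IsOrdV E a → ∃ x, E x t ∧ HasDomV E x a

/-- `b` is a branch of the tree `t` in `V`: a linearly ordered subset meeting every
nonempty level. -/
def IsBranchV (t b : V) : Prop :=
  SubV E b t ∧ (∀ x y, E x b → E y b → (SubV E x y ∨ SubV E y x)) ∧
    ∀ a, (∃ x, E x t ∧ HasDomV E x a) → ∃ x, E x b ∧ HasDomV E x a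

/-- `bs = B(t)`, the set of all branches of `t`, in `V`. -/
def IsBranchSetOf (t bs : V) : Prop := ∀ z, E z bs ↔ IsBranchV E t z

/-- `l` is the `a`-th level of `t` in `V`. -/
def IsLevelSetOf (t a l : V) : Prop := ∀ x, E x l ↔ (E x t ∧ HasDomV E x a)

/-- `t` is a Kurepa tree in `V`: an ω₁-tree with countable levels and more than
ω₁-many branches. -/
def IsKurepaV (k₁ t : V) : Prop :=
  IsOmega1TreeV E k₁ t ∧
  (∀ a l, E a k₁ → IsLevelSetOf E t a l → CountableV E l) ∧
  ∀ bs, IsBranchSetOf E t bs → ¬ InjInto E bs k₁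

/-- `t` is a Jech–Kunen tree in `V`: an ω₁-tree with `ω₁ < |B(t)| < 2^{ω₁}`. -/
def IsJechKunenV (k₁ t : V) : Prop :=
  IsOmega1TreeV E k₁ t ∧
  ∀ bs p, IsBranchSetOf E t bs → IsPowOf E p k₁ →
    (¬ InjInto E bs k₁ ∧ InjInto E bs p ∧ ¬ EquinumV E bs p)

end Semantics

namespace JK
open FirstOrder FirstOrder.Language

universe u

/-! ### Ultrafilters on a complete Boolean algebra -/

/-- An ultrafilter on `B`. -/
structure Ult (B : Type u) [CompleteBooleanAlgebra B] where
  s : Set B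
  inf_iff : ∀ a b, a ⊓ b ∈ s ↔ a ∈ s ∧ b ∈ s
  compl_iff : ∀ a, aᶜ ∈ s ↔ a ∉ s

variable {B : Type u} [CompleteBooleanAlgebra B]

theorem Ult.mono (U : Ult B) {a b : B} (h : a ≤ b) (ha : a ∈ U.s) : b ∈ U.s := by
  have h1 : a ⊓ b = a := inf_eq_left.2 h
  rw [← h1] at ha
  exact ((U.inf_iff _ _).1 ha).2

theorem Ult.bot_nmem (U : Ult B) : (⊥ : B) ∉ U.s := by
  intro h
  have h1 := (U.compl_iff ⊤).1 (by simpa using h)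
  exact h1 (U.mono bot_le h)

theorem Ult.top_mem (U : Ult B) : (⊤ : B) ∈ U.s := by
  have h1 := (U.compl_iff (⊥ : B)).2 U.bot_nmem
  simpa using h1

theorem Ult.sup_iff (U : Ult B) (a b : B) : a ⊔ b ∈ U.s ↔ a ∈ U.s ∨ b ∈ U.s := by
  have h1 := U.compl_iff (a ⊔ b)
  rw [compl_sup, U.inf_iff, U.compl_iff, U.compl_iff] at h1
  tauto

theorem Ult.himp_iff (U : Ult B) (a b : B) : a ⇨ b ∈ U.s ↔ (a ∈ U.s → b ∈ U.s) := by
  rw [himp_eq, U.sup_iff, U.compl_iff]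
  tauto

theorem exists_ult {a b : B} (h : ¬ a ≤ b) : ∃ U : Ult B, a ∈ U.s ∧ b ∉ U.s := by
  have hd : Disjoint ((Order.PFilter.principal a : Order.PFilter B) : Set B)
      ((Order.Ideal.principal b : Order.Ideal B) : Set B) := by
    rw [Set.disjoint_left]
    intro x hx hx2
    have hx' : a ≤ x := hx
    have hx2' : x ≤ b := hx2
    exact h (hx'.trans hx2')
  obtain ⟨J, hJ, hle, hdis⟩ := DistribLattice.prime_ideal_of_disjoint_filter_ideal hd
  refine ⟨⟨{x | x ∉ J}, ?_, ?_⟩, ?_, ?_⟩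
  · intro x y
    simp only [Set.mem_ofPred_eq]
    constructor
    · intro hxy
      exact ⟨fun hx => hxy (J.lower inf_le_left hx), fun hy => hxy (J.lower inf_le_right hy)⟩
    · rintro ⟨hx, hy⟩ hxy
      rcases hJ.mem_or_mem hxy with h' | h'
      · exact hx h'
      · exact hy h'
  · intro x
    simp only [Set.mem_ofPred_eq, not_not]
    constructor
    · intro hx
      have : x ⊓ xᶜ ∈ J := by simp
      rcases hJ.mem_or_mem this with h' | h'
      · exact h'
      · exact absurd h' hx
    · intro hx hx2
      have : x ⊔ xᶜ ∈ J := Order.Ideal.sup_mem hx hx2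
      rw [sup_compl_eq_top] at this
      exact hJ.toIsProper.ne_univ (Set.eq_univ_of_forall fun y => J.lower le_top this)
  · intro ha
    exact Set.disjoint_left.1 hdis (show a ∈ Order.PFilter.principal a from le_refl a) ha
  · intro hb
    exact hb (hle (show b ∈ Order.Ideal.principal b from le_refl b))

theorem le_of_ult {a b : B} (h : ∀ U : Ult B, a ∈ U.s → b ∈ U.s) : a ≤ b := by
  by_contra hc
  obtain ⟨U, h1, h2⟩ := exists_ult hc
  exact h2 (h U h1)

/-! ### Names -/

inductive Nm (B : Type u) : Type (u + 1)
  | mk (ι : Type u) (f : ι → Nm B) (b : ι → B) : Nm B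

/-- Boolean value of equality. -/
def eqv : Nm B → Nm B → B
  | ⟨_, f, b⟩, ⟨_, g, c⟩ =>
    (⨅ i, b i ⇨ ⨆ j, c j ⊓ eqv (f i) (g j)) ⊓ (⨅ j, c j ⇨ ⨆ i, b i ⊓ eqv (f i) (g j))

/-- Boolean value of membership. -/
def memv (x : Nm B) : Nm B → B
  | ⟨_, g, c⟩ => ⨆ j, c j ⊓ eqv x (g j)

theorem eqv_symm (x : Nm B) : ∀ y, eqv x y = eqv y x := by
  induction x with
  | mk ι f b ih =>
    intro y
    cases y with
    | mk κ g c =>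
      simp only [eqv]
      rw [inf_comm]
      simp only [ih]

theorem eqv_mk (ι : Type u) (f : ι → Nm B) (b : ι → B) (y : Nm B) :
    eqv ⟨ι, f, b⟩ y ≤ ⨅ i, b i ⇨ memv (f i) y := by
  cases y with
  | mk κ g c => exact inf_le_left

theorem eqv_refl (x : Nm B) : eqv x x = ⊤ := by
  induction x with
  | mk ι f b ih =>
    simp only [eqv]
    rw [eq_top_iff]
    refine le_inf ?_ ?_
    all_goals
      refine le_iInf fun i => ?_
      rw [le_himp_iff]
      refine le_iSup_of_le i ?_
      rw [ih]
      simp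

theorem le_eqv {a : B} {ι : Type u} {f : ι → Nm B} {b : ι → B} {κ : Type u} {g : κ → Nm B}
    {c : κ → B} (h1 : ∀ i, a ⊓ b i ≤ memv (f i) ⟨κ, g, c⟩)
    (h2 : ∀ j, a ⊓ c j ≤ memv (g j) ⟨ι, f, b⟩) : a ≤ eqv ⟨ι, f, b⟩ ⟨κ, g, c⟩ := by
  simp only [eqv]
  refine le_inf ?_ ?_
  · refine le_iInf fun i => ?_
    rw [le_himp_iff]
    exact h1 i
  · refine le_iInf fun i => ?_
    rw [le_himp_iff]
    refine (h2 i).trans ?_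
    simp only [memv]
    exact iSup_mono fun j => by rw [eqv_symm]

theorem mem_congr_right_aux (x y z : Nm B)
    (h : ∀ y' z', eqv x y' ⊓ eqv y' z' ≤ eqv x z') : memv x y ⊓ eqv y z ≤ memv x z := by
  cases y with
  | mk ι f b =>
    cases z with
    | mk κ g c =>
      simp only [memv]
      rw [iSup_inf_eq]
      refine iSup_le fun i => ?_
      have h1 : eqv ⟨ι, f, b⟩ ⟨κ, g, c⟩ ⊓ b i ≤ ⨆ j, c j ⊓ eqv (f i) (g j) := by
        rw [← le_himp_iff]
        exact (eqv_mk ι f b _).trans (iInf_le _ i)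
      calc b i ⊓ eqv x (f i) ⊓ eqv ⟨ι, f, b⟩ ⟨κ, g, c⟩
          = eqv x (f i) ⊓ (eqv ⟨ι, f, b⟩ ⟨κ, g, c⟩ ⊓ b i) := by
            rw [inf_comm (b i), inf_assoc, inf_comm (b i)]
        _ ≤ eqv x (f i) ⊓ ⨆ j, c j ⊓ eqv (f i) (g j) := inf_le_inf_left _ h1
        _ ≤ ⨆ j, c j ⊓ eqv x (g j) := by
            rw [inf_iSup_eq]
            refine iSup_mono fun j => ?_
            refine le_inf (inf_le_right.trans inf_le_left) ?_
            exact (inf_le_inf_left _ inf_le_right).trans (h _ _)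

theorem eqv_trans (x : Nm B) : ∀ y z, eqv x y ⊓ eqv y z ≤ eqv x z := by
  induction x with
  | mk ι f b ih =>
    intro y z
    cases z with
    | mk κ g c =>
      refine le_eqv ?_ ?_
      · intro i
        have h1 : eqv ⟨ι, f, b⟩ y ⊓ b i ≤ memv (f i) y := by
          rw [← le_himp_iff]
          exact (eqv_mk ι f b _).trans (iInf_le _ i)
        refine le_trans ?_ (mem_congr_right_aux (f i) y _ (ih i))
        refine le_inf (le_trans ?_ h1) (inf_le_left.trans inf_le_right)
        exact le_inf (inf_le_left.trans inf_le_left) inf_le_right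
      · intro j
        have h1 : eqv ⟨κ, g, c⟩ y ⊓ c j ≤ memv (g j) y := by
          rw [← le_himp_iff]
          exact (eqv_mk κ g c _).trans (iInf_le _ j)
        cases y with
        | mk l h d =>
          have h3 : ⨆ k, d k ⊓ eqv (g j) (h k) ≥ eqv ⟨κ, g, c⟩ ⟨l, h, d⟩ ⊓ c j := h1
          calc eqv ⟨ι, f, b⟩ ⟨l, h, d⟩ ⊓ eqv ⟨l, h, d⟩ ⟨κ, g, c⟩ ⊓ c j
              ≤ eqv ⟨l, h, d⟩ ⟨ι, f, b⟩ ⊓ ⨆ k, d k ⊓ eqv (g j) (h k) := by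
                refine le_inf ?_ (le_trans ?_ h3)
                · rw [eqv_symm ⟨l, h, d⟩ ⟨ι, f, b⟩]
                  exact inf_le_left.trans inf_le_left
                · rw [eqv_symm ⟨κ, g, c⟩]
                  exact le_inf (inf_le_left.trans inf_le_right) inf_le_right
            _ ≤ memv (g j) ⟨ι, f, b⟩ := by
                rw [inf_iSup_eq]
                refine iSup_le fun k => ?_
                have h2 : eqv ⟨l, h, d⟩ ⟨ι, f, b⟩ ⊓ d k ≤ ⨆ i, b i ⊓ eqv (h k) (f i) := by
                  rw [← le_himp_iff]
                  exact (eqv_mk l h d _).trans (iInf_le _ k)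
                rw [← inf_assoc]
                refine (inf_le_inf_right _ h2).trans ?_
                rw [iSup_inf_eq]
                refine iSup_mono fun i => ?_
                refine le_inf (inf_le_left.trans inf_le_left) ?_
                rw [eqv_symm (g j) (f i), eqv_symm (h k) (f i), eqv_symm (g j) (h k)]
                exact (inf_le_inf_right _ inf_le_right).trans (ih i _ _)

theorem memv_congr_right (x y z : Nm B) : memv x y ⊓ eqv y z ≤ memv x z :=
  mem_congr_right_aux x y z (eqv_trans x)

theorem memv_congr_left (x y z : Nm B) : memv x z ⊓ eqv x y ≤ memv y z := by
  cases z with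
  | mk κ g c =>
    simp only [memv]
    rw [iSup_inf_eq]
    refine iSup_mono fun j => ?_
    refine le_inf (inf_le_left.trans inf_le_left) ?_
    refine le_trans ?_ (eqv_trans y x _)
    rw [eqv_symm y x]
    exact le_inf inf_le_right (inf_le_left.trans inf_le_right)

/-! ### The quotient models -/

def stoid (U : Ult B) : Setoid (Nm B) where
  r x y := eqv x y ∈ U.s
  iseqv := by
    refine ⟨fun x => ?_, fun {x y} h => ?_, fun {x y z} h1 h2 => ?_⟩
    · rw [eqv_refl]; exact U.top_mem
    · rw [eqv_symm]; exact h
    · exact U.mono (eqv_trans x y z) ((U.inf_iff _ _).2 ⟨h1, h2⟩)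

/-- The model attached to an ultrafilter. -/
def Mo (U : Ult B) : Type (u + 1) := Quotient (stoid U)

/-- The class of a name. -/
def cl (U : Ult B) (x : Nm B) : Mo U := Quotient.mk (stoid U) x

theorem cl_surj (U : Ult B) (v : Mo U) : ∃ x, cl U x = v := Quotient.exists_rep v

theorem cl_eq (U : Ult B) (x y : Nm B) : cl U x = cl U y ↔ eqv x y ∈ U.s :=
  ⟨fun h => Quotient.exact h, fun h => Quotient.sound h⟩

/-- Membership in the model. -/
def El (U : Ult B) (v w : Mo U) : Prop :=
  Quotient.liftOn₂ v w (fun x y => memv x y ∈ U.s) (by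
    intro x y x' y' hx hy
    have hx' : eqv x x' ∈ U.s := hx
    have hy' : eqv y y' ∈ U.s := hy
    refine propext ⟨fun h => ?_, fun h => ?_⟩
    · refine U.mono (memv_congr_left x x' y') ((U.inf_iff _ _).2 ⟨?_, hx'⟩)
      exact U.mono (memv_congr_right x y y') ((U.inf_iff _ _).2 ⟨h, hy'⟩)
    · rw [eqv_symm] at hx' hy'
      refine U.mono (memv_congr_left x' x y) ((U.inf_iff _ _).2 ⟨?_, hx'⟩)
      exact U.mono (memv_congr_right x' y' y) ((U.inf_iff _ _).2 ⟨h, hy'⟩))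

theorem El_cl (U : Ult B) (x y : Nm B) : El U (cl U x) (cl U y) ↔ memv x y ∈ U.s := Iff.rfl

/-! ### Clopen statements -/

class Clp (φ : Ult B → Prop) : Prop where
  ex : ∃ b : B, ∀ U, φ U ↔ b ∈ U.s

instance Clp.mem (x y : Nm B) : Clp (fun U => El U (cl U x) (cl U y)) := ⟨_, fun U => El_cl U x y⟩
instance Clp.eq (x y : Nm B) : Clp (fun U => cl U x = cl U y) := ⟨_, fun U => cl_eq U x y⟩
instance Clp.not (φ : Ult B → Prop) [h : Clp φ] : Clp (fun U => ¬ φ U) := by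
  obtain ⟨b, hb⟩ := h.ex
  exact ⟨bᶜ, fun U => by rw [U.compl_iff, hb]⟩
instance Clp.and (φ ψ : Ult B → Prop) [h : Clp φ] [h' : Clp ψ] : Clp (fun U => φ U ∧ ψ U) := by
  obtain ⟨b, hb⟩ := h.ex
  obtain ⟨c, hc⟩ := h'.ex
  exact ⟨b ⊓ c, fun U => by rw [U.inf_iff, hb, hc]⟩
instance Clp.or (φ ψ : Ult B → Prop) [h : Clp φ] [h' : Clp ψ] : Clp (fun U => φ U ∨ ψ U) := by
  obtain ⟨b, hb⟩ := h.ex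
  obtain ⟨c, hc⟩ := h'.ex
  exact ⟨b ⊔ c, fun U => by rw [U.sup_iff, hb, hc]⟩
instance Clp.imp (φ ψ : Ult B → Prop) [h : Clp φ] [h' : Clp ψ] : Clp (fun U => φ U → ψ U) := by
  obtain ⟨b, hb⟩ := h.ex
  obtain ⟨c, hc⟩ := h'.ex
  exact ⟨b ⇨ c, fun U => by rw [U.himp_iff, hb, hc]⟩
instance Clp.iff (φ ψ : Ult B → Prop) [h : Clp φ] [h' : Clp ψ] : Clp (fun U => φ U ↔ ψ U) := by
  have : Clp (fun U => (φ U → ψ U) ∧ (ψ U → φ U)) := inferInstance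
  obtain ⟨b, hb⟩ := this.ex
  exact ⟨b, fun U => by rw [← hb]; exact iff_iff_implies_and_implies⟩
instance Clp.val (b : B) : Clp (fun U : Ult B => b ∈ U.s) := ⟨b, fun _ => Iff.rfl⟩
instance Clp.const (q : Prop) : Clp (fun _ : Ult B => q) := by
  by_cases h : q
  · exact ⟨⊤, fun U => by simp [h, U.top_mem]⟩
  · exact ⟨⊥, fun U => by simp [h, U.bot_nmem]⟩

/-! ### Mixing and the maximum principle -/

def Nm.idx : Nm B → Type u
  | ⟨ι, _, _⟩ => ι
def Nm.fn : (x : Nm B) → x.idx → Nm B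
  | ⟨_, f, _⟩ => f
def Nm.vl : (x : Nm B) → x.idx → B
  | ⟨_, _, b⟩ => b

theorem Nm.eta (x : Nm B) : (⟨x.idx, x.fn, x.vl⟩ : Nm B) = x := by cases x; rfl

theorem El_mk (U : Ult B) {ι : Type u} (f : ι → Nm B) (b : ι → B) (i : ι) (h : b i ∈ U.s) :
    El U (cl U (f i)) (cl U ⟨ι, f, b⟩) := by
  rw [El_cl]
  refine U.mono ?_ h
  simp only [memv]
  refine le_iSup_of_le i ?_
  rw [eqv_refl]; simp

/-- Mixing names along a small family of Boolean values. -/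
def mix {K : Type u} (c : K → B) (x : K → Nm B) : Nm B :=
  ⟨Σ k, (x k).idx, fun p => (x p.1).fn p.2, fun p => c p.1 ⊓ (x p.1).vl p.2⟩

theorem mix_le {K : Type u} (c : K → B) (x : K → Nm B)
    (hd : ∀ k l, k ≠ l → c k ⊓ c l = ⊥) (k : K) : c k ≤ eqv (mix c x) (x k) := by
  have h1 : ∀ k, (⟨(x k).idx, (x k).fn, (x k).vl⟩ : Nm B) = x k := fun k => (x k).eta
  rw [← h1 k]
  refine le_eqv ?_ ?_
  · rintro ⟨l, i⟩
    by_cases hkl : k = l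
    · subst hkl
      simp only [memv]
      refine le_iSup_of_le i ?_
      rw [eqv_refl]
      simp only [inf_top_eq]
      exact inf_le_right.trans inf_le_right
    · rw [← inf_assoc, hd k l hkl]
      simp
  · intro i
    simp only [memv, mix]
    refine le_iSup_of_le ⟨k, i⟩ ?_
    rw [eqv_refl]; simp

theorem Clp.bval (φ : Ult B → Prop) [h : Clp φ] : ∃ b : B, ∀ U, φ U ↔ b ∈ U.s := h.ex

/-- The maximum principle. -/
theorem max_principle (R : ∀ U : Ult B, Mo U → Prop) [h : ∀ x, Clp (fun U => R U (cl U x))] :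
    ∃ τ, ∀ U v, R U v → R U (cl U τ) := by
  choose r hr using fun x => (h x).ex
  classical
  let K := {b : B // ∃ x, r x = b}
  choose y hy using fun k : K => k.2
  let lt : K → K → Prop := WellOrderingRel
  let c : K → B := fun k => k.1 ⊓ (⨆ l : {l : K // lt l k}, l.1.1)ᶜ
  have hd0 : ∀ k l : K, lt l k → c k ⊓ c l = ⊥ := by
    intro k l hlk
    have h1 : c l ≤ ⨆ l : {l : K // lt l k}, l.1.1 :=
      inf_le_left.trans (le_iSup (fun l : {l : K // lt l k} => l.1.1) ⟨l, hlk⟩)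
    have h2 : c k ≤ (⨆ l : {l : K // lt l k}, l.1.1)ᶜ := inf_le_right
    rw [eq_bot_iff]
    refine (inf_le_inf h2 h1).trans ?_
    simp
  have hd : ∀ k l : K, k ≠ l → c k ⊓ c l = ⊥ := by
    intro k l hkl
    rcases trichotomous_of lt k l with h' | h' | h'
    · rw [inf_comm]; exact hd0 _ _ h'
    · exact absurd h' hkl
    · exact hd0 _ _ h'
  refine ⟨mix c y, fun U v hv => ?_⟩
  obtain ⟨x, rfl⟩ := cl_surj U v
  -- every `c k` lies below the value of the mixed name
  have key : ∀ k : K, c k ≤ r (mix c y) := by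
    intro k
    refine le_of_ult fun U' hU => ?_
    rw [← hr, (cl_eq U' _ _).2 (U'.mono (mix_le c y hd k) hU), hr, hy]
    exact U'.mono inf_le_left hU
  have key2 : ∀ k : K, k.1 ≤ r (mix c y) := by
    intro k
    induction k using (WellOrderingRel.isWellOrder (α := K)).wf.induction with
    | _ k ih =>
      have h3 : (⨆ l : {l : K // lt l k}, l.1.1) ≤ r (mix c y) := iSup_le fun l => ih l.1 l.2
      have h4 : k.1 ≤ c k ⊔ ⨆ l : {l : K // lt l k}, l.1.1 := by
        simp only [c]
        rw [sup_inf_right, compl_sup_eq_top]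
        simp
      exact h4.trans (sup_le (key k) h3)
  rw [hr] at hv ⊢
  exact U.mono (key2 ⟨r x, x, rfl⟩) hv

instance Clp.exi (R : ∀ U : Ult B, Mo U → Prop) [∀ x, Clp (fun U => R U (cl U x))] :
    Clp (fun U => ∃ v, R U v) := by
  obtain ⟨τ, hτ⟩ := max_principle R
  obtain ⟨b, hb⟩ := Clp.bval (fun U => R U (cl U τ))
  exact ⟨b, fun U => by rw [← hb]; exact ⟨fun ⟨v, hv⟩ => hτ U v hv, fun h => ⟨_, h⟩⟩⟩

instance Clp.all (R : ∀ U : Ult B, Mo U → Prop) [∀ x, Clp (fun U => R U (cl U x))] :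
    Clp (fun U => ∀ v, R U v) := by
  obtain ⟨b, hb⟩ := Clp.bval (fun U => ¬ ∃ v, ¬ R U v)
  exact ⟨b, fun U => by rw [← hb]; push Not; rfl⟩

/-- small conjunctions -/
theorem Clp.alls {ι : Type u} (φ : ι → Ult B → Prop) [h : ∀ i, Clp (φ i)] :
    ∃ b : B, (∀ U, b ∈ U.s → ∀ i, φ i U) ∧
      ∀ c : B, (∀ U, c ∈ U.s → ∀ i, φ i U) → c ≤ b := by
  choose r hr using fun i => (h i).ex
  refine ⟨⨅ i, r i, fun U hU i => ?_, fun c hc => le_iInf fun i => le_of_ult fun U hU => ?_⟩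
  · rw [hr]; exact U.mono (iInf_le _ i) hU
  · rw [← hr]; exact hc U hU i

/-- Bounded quantification over a name. -/
theorem ball {ι : Type u} (f : ι → Nm B) (b : ι → B) (p : B) (R : ∀ U : Ult B, Mo U → Prop)
    [∀ x, Clp (fun U => R U (cl U x))]
    (h : ∀ i U, p ∈ U.s → b i ∈ U.s → R U (cl U (f i))) :
    ∀ U, p ∈ U.s → ∀ v, El U v (cl U ⟨ι, f, b⟩) → R U v := by
  intro U hp v hv
  obtain ⟨x, rfl⟩ := cl_surj U v
  obtain ⟨r, hr⟩ := Clp.bval (fun U => R U (cl U x))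
  rw [hr]
  rw [El_cl] at hv
  have : p ⊓ memv x ⟨ι, f, b⟩ ≤ r := by
    simp only [memv]
    rw [inf_iSup_eq]
    refine iSup_le fun i => ?_
    refine le_of_ult fun U hU => ?_
    rw [U.inf_iff, U.inf_iff] at hU
    obtain ⟨h1, h2, h3⟩ := hU
    rw [← hr, (cl_eq U _ _).2 h3]
    exact h i U h1 h2
  exact U.mono this ((U.inf_iff _ _).2 ⟨hp, hv⟩)

theorem ball' {ι : Type u} (f : ι → Nm B) (b : ι → B) (R : ∀ U : Ult B, Mo U → Prop)
    [∀ x, Clp (fun U => R U (cl U x))]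
    (h : ∀ i U, b i ∈ U.s → R U (cl U (f i))) :
    ∀ U, ∀ v, El U v (cl U ⟨ι, f, b⟩) → R U v := fun U =>
  ball f b ⊤ R (fun i U _ => h i U) U U.top_mem

theorem nm_ext (U : Ult B) (v w : Mo U) (h : ∀ z, El U z v ↔ El U z w) : v = w := by
  obtain ⟨x, rfl⟩ := cl_surj U v
  obtain ⟨y, rfl⟩ := cl_surj U w
  obtain ⟨r, hr⟩ := Clp.bval (fun U => ∀ z, El U z (cl U x) ↔ El U z (cl U y))
  have h1 : r ∈ U.s := (hr U).1 h
  rw [cl_eq]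
  refine U.mono ?_ h1
  rw [← x.eta, ← y.eta]
  refine le_eqv ?_ ?_
  · intro i
    refine le_of_ult fun U hU => ?_
    rw [U.inf_iff, ← hr] at hU
    rw [← El_cl]
    rw [y.eta, ← hU.1]
    have := El_mk U x.fn x.vl i hU.2
    rwa [x.eta] at this
  · intro i
    refine le_of_ult fun U hU => ?_
    rw [U.inf_iff, ← hr] at hU
    rw [← El_cl]
    rw [x.eta, hU.1]
    have := El_mk U y.fn y.vl i hU.2
    rwa [y.eta] at this

/-- Separation. -/
theorem sep (a : Nm B) (R : ∀ U : Ult B, Mo U → Prop) [h : ∀ x, Clp (fun U => R U (cl U x))] :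
    ∃ s, ∀ U v, El U v (cl U s) ↔ El U v (cl U a) ∧ R U v := by
  choose r hr using fun x => (h x).ex
  refine ⟨⟨a.idx, a.fn, fun i => a.vl i ⊓ r (a.fn i)⟩, fun U v => ⟨?_, ?_⟩⟩
  · revert U v
    refine ball' _ _ (fun U v => El U v (cl U a) ∧ R U v) fun i U hi => ?_
    rw [U.inf_iff] at hi
    refine ⟨?_, (hr _ U).2 hi.2⟩
    have := El_mk U a.fn a.vl i hi.1
    rwa [a.eta] at this
  · rintro ⟨h1, h2⟩
    rw [← a.eta] at h1
    refine ball' a.fn a.vl (fun U v => R U v → El U v (cl U ⟨a.idx, a.fn, fun i => a.vl i ⊓ r (a.fn i)⟩))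
      (fun i U hi h2 => ?_) U v h1 h2
    refine El_mk U a.fn _ i ?_
    rw [U.inf_iff]
    exact ⟨hi, (hr _ U).1 h2⟩

/-- Collection. -/
theorem coll (a : Nm B) (R : ∀ U : Ult B, Mo U → Mo U → Prop)
    [h : ∀ x y, Clp (fun U => R U (cl U x) (cl U y))] :
    ∃ s, ∀ U v, El U v (cl U a) → (∃ w, R U v w) → ∃ w, El U w (cl U s) ∧ R U v w := by
  choose τ hτ using fun i => max_principle (fun U w => R U (cl U (a.fn i)) w)
  refine ⟨⟨a.idx, τ, fun _ => ⊤⟩, fun U v hv => ?_⟩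
  rw [← a.eta] at hv
  refine ball' a.fn a.vl (fun U v => (∃ w, R U v w) →
    ∃ w, El U w (cl U ⟨a.idx, τ, fun _ => ⊤⟩) ∧ R U v w) (fun i U _ ⟨w, hw⟩ => ?_) U v hv
  exact ⟨_, El_mk U τ (fun _ => ⊤) i U.top_mem, hτ i U w hw⟩

theorem pairing (x y : Nm B) : ∃ s, ∀ U v, El U v (cl U s) ↔ v = cl U x ∨ v = cl U y := by
  let f : ULift.{u} Bool → Nm B := fun i => cond i.down x y
  refine ⟨⟨ULift.{u} Bool, f, fun _ => ⊤⟩, fun U v => ⟨?_, ?_⟩⟩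
  · revert U v
    refine ball' _ _ (fun U v => v = cl U x ∨ v = cl U y) fun i U _ => ?_
    rcases i with ⟨_ | _⟩
    · exact Or.inr rfl
    · exact Or.inl rfl
  · rintro (rfl | rfl)
    · exact El_mk U f _ ⟨true⟩ U.top_mem
    · exact El_mk U f _ ⟨false⟩ U.top_mem

theorem union_sup (a : Nm B) : ∃ s, ∀ U v w, El U v (cl U a) → El U w v → El U w (cl U s) := by
  let f : (Σ i, (a.fn i).idx) → Nm B := fun p => (a.fn p.1).fn p.2
  refine ⟨⟨_, f, fun _ => ⊤⟩, fun U v w hv => ?_⟩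
  revert w
  rw [← a.eta] at hv
  refine ball' a.fn a.vl (fun U v => ∀ w, El U w v → El U w (cl U ⟨_, f, fun _ => ⊤⟩))
    (fun i U _ w hw => ?_) U v hv
  rw [← (a.fn i).eta] at hw
  exact ball' (a.fn i).fn (a.fn i).vl (fun U w => El U w (cl U ⟨_, f, fun _ => ⊤⟩))
    (fun j U _ => El_mk U f _ ⟨i, j⟩ U.top_mem) U w hw

theorem power_sup (a : Nm B) :
    ∃ s, ∀ U v, (∀ w, El U w v → El U w (cl U a)) → El U v (cl U s) := by
  let f : (a.idx → B) → Nm B := fun c => ⟨a.idx, a.fn, c⟩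
  refine ⟨⟨_, f, fun _ => ⊤⟩, fun U v hv => ?_⟩
  obtain ⟨x, rfl⟩ := cl_surj U v
  have : cl U x = cl U (f fun i => a.vl i ⊓ memv (a.fn i) x) := by
    refine nm_ext _ _ _ fun z => ⟨fun hz => ?_, ?_⟩
    · have hz2 := hv z hz
      rw [← a.eta] at hz2
      refine ball' a.fn a.vl (fun U z => El U z (cl U x) →
        El U z (cl U (f fun i => a.vl i ⊓ memv (a.fn i) x))) (fun i U hi h2 => ?_) U z hz2 hz
      exact El_mk U a.fn _ i ((U.inf_iff _ _).2 ⟨hi, h2⟩)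
    · exact ball' a.fn _ (fun U z => El U z (cl U x))
        (fun i U hi => ((U.inf_iff _ _).1 hi).2) U z
  rw [this]
  exact El_mk U f _ _ U.top_mem

/-- Foundation, as induction. -/
theorem found (R : ∀ U : Ult B, Mo U → Prop) [∀ x, Clp (fun U => R U (cl U x))]
    (U : Ult B) (h : ∀ v, (∀ w, El U w v → R U w) → R U v) (v : Mo U) : R U v := by
  obtain ⟨x, rfl⟩ := cl_surj U v
  obtain ⟨r, hr⟩ := Clp.bval (fun U => ∀ v, (∀ w, El U w v → R U w) → R U v)
  have key : ∀ U : Ult B, r ∈ U.s → R U (cl U x) := by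
    induction x with
    | mk ι f b ih =>
      intro U hU
      refine (hr U).2 hU _ ?_
      exact ball f b r R (fun i U h1 _ => ih i U h1) U hU
  exact key U ((hr U).1 h)

end JK

namespace JK
open FirstOrder FirstOrder.Language

universe u

set_option linter.unusedSimpArgs false

variable {B : Type u} [CompleteBooleanAlgebra B]

/-! ### ZFC in the models -/

/-- Names for ground model ordinals. -/
noncomputable def ordn (α : Ordinal.{u}) : Nm B :=
  ⟨α.ToType, fun i => ordn (Ordinal.typein (α := α.ToType) (· < ·) i), fun _ => ⊤⟩
termination_by α
decreasing_by exact Ordinal.typein_lt_self i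

theorem mem_ordn (U : Ult B) {β α : Ordinal.{u}} (h : β < α) :
    El U (cl U (ordn β)) (cl U (ordn α)) := by
  rw [ordn.eq_1 α]
  have h1 : β < Ordinal.type (α := α.ToType) (· < ·) := by simpa using h
  have h2 := Ordinal.typein_enum (α := α.ToType) (· < ·) h1
  have h3 := El_mk U (fun i : α.ToType =>
    (ordn (Ordinal.typein (α := α.ToType) (· < ·) i) : Nm B)) (fun _ => ⊤)
    (Ordinal.enum (α := α.ToType) (· < ·) ⟨β, h1⟩) U.top_mem
  simp only [h2] at h3
  exact h3

theorem ball_ord (α : Ordinal.{u}) (p : B) (R : ∀ U : Ult B, Mo U → Prop)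
    [∀ x, Clp (fun U => R U (cl U x))]
    (h : ∀ β < α, ∀ U, p ∈ U.s → R U (cl U (ordn β))) :
    ∀ U, p ∈ U.s → ∀ v, El U v (cl U (ordn α)) → R U v := by
  intro U hU v hv
  rw [ordn.eq_1 α] at hv
  exact ball _ _ p R (fun i U hp _ => h _ (Ordinal.typein_lt_self i) U hp) U hU v hv

theorem ball_ord' (α : Ordinal.{u}) (R : ∀ U : Ult B, Mo U → Prop)
    [∀ x, Clp (fun U => R U (cl U x))]
    (h : ∀ β < α, ∀ U, R U (cl U (ordn β))) :
    ∀ U, ∀ v, El U v (cl U (ordn α)) → R U v := fun U =>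
  ball_ord α ⊤ R (fun β hβ U _ => h β hβ U) U U.top_mem

theorem mem_ordn_succ (U : Ult B) (α : Ordinal.{u}) (v : Mo U) :
    El U v (cl U (ordn (Order.succ α))) ↔ El U v (cl U (ordn α)) ∨ v = cl U (ordn α) := by
  constructor
  · revert U v
    refine ball_ord' _ (fun U v => El U v (cl U (ordn α)) ∨ v = cl U (ordn α)) fun β hβ U => ?_
    rcases (Order.lt_succ_iff.1 hβ).lt_or_eq with h | h
    · exact Or.inl (mem_ordn U h)
    · exact Or.inr (by rw [h])
  · rintro (h | rfl)
    · refine ball_ord' α (fun U v => El U v (cl U (ordn (Order.succ α)))) (fun β hβ U => ?_) U v h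
      exact mem_ordn U (hβ.trans (Order.lt_succ α))
    · exact mem_ordn U (Order.lt_succ α)

theorem choice (a : Nm B) : ∃ c : Nm B, ∀ U : Ult B,
    (∀ x, El U x (cl U a) → ∃ y, El U y x) →
    (∀ x y, (El U x (cl U a) ∧ El U y (cl U a)) ∧ (∃ z, El U z x ∧ El U z y) → x = y) →
    ∀ x, El U x (cl U a) → ∃ y, (El U y x ∧ El U y (cl U c)) ∧
      ∀ z, El U z x ∧ El U z (cl U c) → z = y := by
  obtain ⟨s, hs⟩ := union_sup a
  let lt : s.idx → s.idx → Prop := WellOrderingRel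
  let seg : s.idx → Nm B := fun j => ⟨{i // lt i j}, fun i => s.fn i.1, fun _ => ⊤⟩
  choose r hr using fun j => Clp.bval (fun U => ∃ x, El U x (cl U a) ∧
    El U (cl U (s.fn j)) x ∧ ∀ v, El U v (cl U (seg j)) → ¬ El U v x)
  let c : Nm B := ⟨s.idx, s.fn, r⟩
  refine ⟨c, fun U h1 h2 x hx => ?_⟩
  have e1 : ∀ j, ∀ U : Ult B, ∀ x, El U x (cl U a) → El U (cl U (s.fn j)) x →
      ∃ y, El U y x ∧ El U y (cl U c) := by
    intro j
    induction j using (WellOrderingRel.isWellOrder (α := s.idx)).wf.induction with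
    | _ j ih =>
      intro U x hx hj
      by_cases hc : ∃ v, El U v (cl U (seg j)) ∧ El U v x
      · obtain ⟨v, hv, hv2⟩ := hc
        exact ball' (fun i : {i // lt i j} => s.fn i.1) (fun _ => ⊤)
          (fun U v => ∀ x, El U x (cl U a) → El U v x → ∃ y, El U y x ∧ El U y (cl U c))
          (fun i U _ => ih i.1 i.2 U) U v hv x hx hv2
      · refine ⟨_, hj, El_mk U s.fn r j ?_⟩
        rw [← hr]
        exact ⟨x, hx, hj, fun v hv hv2 => hc ⟨v, hv, hv2⟩⟩
  obtain ⟨y0, hy0⟩ := h1 x hx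
  have hy1 := hs U x y0 hx hy0
  obtain ⟨y, hy, hyc⟩ : ∃ y, El U y x ∧ El U y (cl U c) := by
    rw [← s.eta] at hy1
    exact ball' s.fn s.vl (fun U v => ∀ x, El U x (cl U a) → El U v x →
      ∃ y, El U y x ∧ El U y (cl U c)) (fun i U _ => e1 i U) U y0 hy1 x hx hy0
  refine ⟨y, ⟨hy, hyc⟩, fun z hz => ?_⟩
  refine ball' s.fn r (fun U z => (∀ x y, (El U x (cl U a) ∧ El U y (cl U a)) ∧
    (∃ z, El U z x ∧ El U z y) → x = y) → ∀ x, El U x (cl U a) → El U z x → 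
    ∀ y, El U y (cl U c) → El U y x → z = y) (fun i U hi h2 x hx hz y hyc => ?_)
    U z hz.2 h2 x hx hz.1 y hyc hy
  refine ball' s.fn r (fun U y => (∀ x y, (El U x (cl U a) ∧ El U y (cl U a)) ∧
    (∃ z, El U z x ∧ El U z y) → x = y) → r i ∈ U.s → ∀ x, El U x (cl U a) →
    El U (cl U (s.fn i)) x → El U y x → cl U (s.fn i) = y)
    (fun j U hj h2 hi x hx hix hjx => ?_) U y hyc h2 hi x hx hz
  rw [← hr] at hi hj
  obtain ⟨xi, hi1, hi2, hi3⟩ := hi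
  obtain ⟨xj, hj1, hj2, hj3⟩ := hj
  have ei := h2 xi x ⟨⟨hi1, hx⟩, ⟨_, hi2, hix⟩⟩
  have ej := h2 xj x ⟨⟨hj1, hx⟩, ⟨_, hj2, hjx⟩⟩
  subst ei
  subst ej
  rcases trichotomous_of lt i j with h | h | h
  · exact absurd hix (hj3 _ (El_mk U (fun i : {i // lt i j} => s.fn i.1) (fun _ => ⊤) ⟨i, h⟩
      U.top_mem))
  · rw [h]
  · exact absurd hjx (hi3 _ (El_mk U (fun i' : {i' // lt i' i} => s.fn i'.1) (fun _ => ⊤) ⟨j, h⟩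
      U.top_mem))

instance moStr (U : Ult B) : memLang.Structure (Mo U) where
  funMap := fun f => Empty.elim f
  RelMap := fun {n} r xs => match n, r, xs with
    | 2, _, xs => El U (xs 0) (xs 1)

theorem real_mem {V : Type*} [memLang.Structure V] {n : ℕ} (i j : Fin n) (v : Empty → V)
    (xs : Fin n → V) :
    (mem' i j).Realize v xs ↔ Structure.RelMap memSym ![xs i, xs j] := by
  simp [mem', BoundedFormula.realize_rel₂]

theorem real_eq {V : Type*} [memLang.Structure V] {n : ℕ} (i j : Fin n) (v : Empty → V)
    (xs : Fin n → V) : (eq' i j).Realize v xs ↔ xs i = xs j := by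
  simp [eq']

theorem mo_mem (U : Ult B) {n : ℕ} (i j : Fin n) (v : Empty → Mo U) (xs : Fin n → Mo U) :
    (mem' i j).Realize v xs ↔ El U (xs i) (xs j) := by
  rw [real_mem]; rfl

theorem term_var {n : ℕ} (t : memLang.Term (Empty ⊕ Fin n)) : ∃ i, t = Term.var (Sum.inr i) := by
  cases t with
  | var x =>
    cases x with
    | inl e => exact e.elim
    | inr i => exact ⟨i, rfl⟩
  | func f _ => exact Empty.elim f

theorem snoc_cl (U : Ult B) {n : ℕ} (xs : Fin n → Nm B) (y : Nm B) :
    (Fin.snoc (fun i => cl U (xs i)) (cl U y) : Fin (n + 1) → Mo U)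
      = fun i => cl U ((Fin.snoc xs y : Fin (n + 1) → Nm B) i) := by
  funext i
  refine Fin.lastCases ?_ (fun i => ?_) i
  · simp
  · simp

theorem clp_formula {n : ℕ} (φ : memLang.BoundedFormula Empty n) : ∀ (xs : Fin n → Nm B),
    Clp (fun U => φ.Realize (M := Mo U) (fun e => e.elim) (fun i => cl U (xs i))) := by
  induction φ with
  | falsum => intro xs; exact Clp.const False
  | @equal n t₁ t₂ =>
    intro xs
    obtain ⟨i, rfl⟩ := term_var t₁
    obtain ⟨j, rfl⟩ := term_var t₂
    exact Clp.eq (xs i) (xs j)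
  | @rel n l r ts =>
    intro xs
    match l, r, ts with
    | 2, r, ts =>
      obtain ⟨i, hi⟩ := term_var (ts 0)
      obtain ⟨j, hj⟩ := term_var (ts 1)
      have := Clp.mem (xs i) (xs j)
      obtain ⟨b, hb⟩ := this.ex
      refine ⟨b, fun U => ?_⟩
      rw [← hb]
      simp only [BoundedFormula.Realize]
      change El U _ _ ↔ _
      simp only [hi, hj]
      rfl
  | imp φ ψ ih1 ih2 =>
    intro xs
    have h1 := ih1 xs
    have h2 := ih2 xs
    exact Clp.imp _ _
  | all φ ih =>
    intro xs
    refine @Clp.all B _ (fun U v => φ.Realize (M := Mo U) (fun e => e.elim)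
      (Fin.snoc (fun i => cl U (xs i)) v)) fun y => ?_
    obtain ⟨b, hb⟩ := (ih (Fin.snoc xs y)).ex
    refine ⟨b, fun U => ?_⟩
    rw [← hb, snoc_cl]

theorem real_default (U : Ult B) {n : ℕ} (φ : memLang.BoundedFormula Empty n) (v : Empty → Mo U)
    (xs : Fin n → Mo U) : φ.Realize v xs ↔ φ.Realize (fun e => e.elim) xs := by
  have : v = fun e => e.elim := by funext e; exact e.elim
  rw [this]

theorem mo_zfc (U : Ult B) : ZFCTheory.Model (Mo U) := by
  refine ⟨fun φ hφ => ?_⟩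
  rcases hφ with (hφ | hφ) | hφ
  · simp only [Set.mem_insert_iff, Set.mem_singleton_iff] at hφ
    rcases hφ with rfl | rfl | rfl | rfl | rfl | rfl | rfl
    · simp only [Sentence.Realize, Formula.Realize, extAx, BoundedFormula.realize_all,
        BoundedFormula.realize_imp, BoundedFormula.realize_iff, mo_mem, real_eq]
      exact fun a b h => nm_ext U a b h
    · simp only [Sentence.Realize, Formula.Realize, pairAx, BoundedFormula.realize_all,
        BoundedFormula.realize_ex, BoundedFormula.realize_sup,
        BoundedFormula.realize_imp, BoundedFormula.realize_iff, mo_mem, real_eq]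
      intro a b
      obtain ⟨x, rfl⟩ := cl_surj U a
      obtain ⟨y, rfl⟩ := cl_surj U b
      obtain ⟨s, hs⟩ := pairing x y
      exact ⟨cl U s, hs U⟩
    · simp only [Sentence.Realize, Formula.Realize, unionAx, BoundedFormula.realize_all,
        BoundedFormula.realize_ex, BoundedFormula.realize_inf,
        BoundedFormula.realize_imp, BoundedFormula.realize_iff, mo_mem, real_eq]
      intro a
      obtain ⟨x, rfl⟩ := cl_surj U a
      obtain ⟨s, hs⟩ := union_sup x
      obtain ⟨t, ht⟩ := sep s (fun U v => ∃ w, El U w (cl U x) ∧ El U v w)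
      refine ⟨cl U t, fun v => ?_⟩
      exact (ht U v).trans ⟨fun h => h.2, fun h => ⟨by
        obtain ⟨w, h1, h2⟩ := h
        exact hs U w v h1 h2, h⟩⟩
    · simp only [Sentence.Realize, Formula.Realize, powerAx, BoundedFormula.realize_all,
        BoundedFormula.realize_ex, BoundedFormula.realize_inf,
        BoundedFormula.realize_imp, BoundedFormula.realize_iff, mo_mem, real_eq]
      intro a
      obtain ⟨x, rfl⟩ := cl_surj U a
      obtain ⟨s, hs⟩ := power_sup x
      obtain ⟨t, ht⟩ := sep s (fun U v => ∀ w, El U w v → El U w (cl U x))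
      refine ⟨cl U t, fun v => ?_⟩
      exact (ht U v).trans ⟨fun h => h.2, fun h => ⟨hs U v h, h⟩⟩
    · simp only [Sentence.Realize, Formula.Realize, infAx, BoundedFormula.realize_all,
        BoundedFormula.realize_ex, BoundedFormula.realize_inf, BoundedFormula.realize_sup,
        BoundedFormula.realize_not,
        BoundedFormula.realize_imp, BoundedFormula.realize_iff, mo_mem, real_eq]
      refine ⟨cl U (ordn Ordinal.omega0), ⟨cl U (ordn 0), mem_ordn U Ordinal.omega0_pos, ?_⟩, ?_⟩
      · intro v hv
        exact ball_ord' 0 (fun _ _ => False) (fun β hβ => absurd hβ not_lt_zero) U v hv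
      · intro v hv
        refine ball_ord' Ordinal.omega0 (fun U v => ∃ z, El U z (cl U (ordn Ordinal.omega0)) ∧
          ∀ w, El U w z ↔ El U w v ∨ w = v) (fun β hβ U => ?_) U v hv
        refine ⟨cl U (ordn (Order.succ β)), mem_ordn U ?_, mem_ordn_succ U β⟩
        exact Ordinal.isSuccLimit_omega0.succ_lt hβ
    · simp only [Sentence.Realize, Formula.Realize, foundAx, BoundedFormula.realize_all,
        BoundedFormula.realize_ex, BoundedFormula.realize_inf, BoundedFormula.realize_sup,
        BoundedFormula.realize_not,
        BoundedFormula.realize_imp, BoundedFormula.realize_iff, mo_mem, real_eq]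
      rintro a ⟨v, hv⟩
      obtain ⟨x, rfl⟩ := cl_surj U a
      by_contra hc
      have hv' : El U v (cl U x) := hv
      refine found (fun U v => ¬ El U v (cl U x)) U (fun v ih hv => hc ?_) v hv'
      exact ⟨v, hv, ih⟩
    · simp only [Sentence.Realize, Formula.Realize, choiceAx, BoundedFormula.realize_all,
        BoundedFormula.realize_ex, BoundedFormula.realize_inf, BoundedFormula.realize_sup,
        BoundedFormula.realize_not,
        BoundedFormula.realize_imp, BoundedFormula.realize_iff, mo_mem, real_eq]
      rintro a ⟨h1, h2⟩
      obtain ⟨x, rfl⟩ := cl_surj U a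
      obtain ⟨c, hc⟩ := choice x
      exact ⟨cl U c, hc U h1 h2⟩
  · simp only [Set.mem_iUnion, Set.mem_range] at hφ
    obtain ⟨n, φ, rfl⟩ := hφ
    simp only [Sentence.Realize, sepAx, BoundedFormula.realize_alls,
      BoundedFormula.realize_all, BoundedFormula.realize_ex, BoundedFormula.realize_iff,
      BoundedFormula.realize_inf, mo_mem]
    intro xs a
    choose ys hys using fun i => cl_surj U (xs i)
    obtain ⟨x, rfl⟩ := cl_surj U a
    have : ∀ z : Nm B, Clp (fun U => φ.Realize (M := Mo U) (fun e => e.elim)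
        (Fin.snoc (fun i => cl U (ys i)) (cl U z))) := by
      intro z
      obtain ⟨b, hb⟩ := (clp_formula φ (Fin.snoc ys z)).ex
      refine ⟨b, fun U => ?_⟩
      rw [← hb, snoc_cl]
    obtain ⟨s, hs⟩ := sep x (fun U v => φ.Realize (M := Mo U) (fun e => e.elim)
        (Fin.snoc (fun i => cl U (ys i)) v))
    refine ⟨cl U s, fun v => ?_⟩
    have e1 := hs U v
    rw [BoundedFormula.realize_liftAt (by omega), real_default]
    have e2 : ((Fin.snoc (Fin.snoc (Fin.snoc xs (cl U x)) (cl U s)) v : Fin (n + 3) → Mo U) ∘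
        fun i : Fin (n + 1) => if (i : ℕ) < n then Fin.castAdd 2 i else Fin.addNat i 2) =
        (Fin.snoc (fun i => cl U (ys i)) v : Fin (n + 1) → Mo U) := by
      funext i
      by_cases hi : (i : ℕ) < n
      · simp [Fin.snoc, hi, hys, show (i : ℕ) < n + 1 by omega, show (i : ℕ) < n + 2 by omega]
        rfl
      · simp [Fin.snoc, hi]
    rw [e2]
    convert e1 using 2 <;> simp [Fin.snoc]
  · simp only [Set.mem_iUnion, Set.mem_range] at hφ
    obtain ⟨n, φ, rfl⟩ := hφ
    simp only [Sentence.Realize, collAx, BoundedFormula.realize_alls,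
      BoundedFormula.realize_all, BoundedFormula.realize_ex, BoundedFormula.realize_imp,
      BoundedFormula.realize_inf, mo_mem]
    intro xs a
    choose ys hys using fun i => cl_surj U (xs i)
    obtain ⟨x, rfl⟩ := cl_surj U a
    have : ∀ z z' : Nm B, Clp (fun U => φ.Realize (M := Mo U) (fun e => e.elim)
        (Fin.snoc (Fin.snoc (fun i => cl U (ys i)) (cl U z)) (cl U z'))) := by
      intro z z'
      obtain ⟨b, hb⟩ := (clp_formula φ (Fin.snoc (Fin.snoc ys z) z')).ex
      refine ⟨b, fun U => ?_⟩
      rw [← hb, snoc_cl, snoc_cl]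
    obtain ⟨s, hs⟩ := coll x (fun U v w => φ.Realize (M := Mo U) (fun e => e.elim)
        (Fin.snoc (Fin.snoc (fun i => cl U (ys i)) v) w))
    refine ⟨cl U s, fun v hv => ?_⟩
    have e1 := hs U v (by simpa [Fin.snoc] using hv)
    have e2 : ∀ w, ((Fin.snoc (Fin.snoc (Fin.snoc (Fin.snoc xs (cl U x)) (cl U s)) v) w :
          Fin (n + 4) → Mo U) ∘
        fun i : Fin (n + 2) => if (i : ℕ) < n then Fin.castAdd 2 i else Fin.addNat i 2) =
        (Fin.snoc (Fin.snoc (fun i => cl U (ys i)) v) w : Fin (n + 2) → Mo U) := by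
      intro w
      funext i
      by_cases hi : (i : ℕ) < n
      · simp [Fin.snoc, hi, hys, show (i : ℕ) < n + 1 by omega, show (i : ℕ) < n + 2 by omega,
          show (i : ℕ) < n + 3 by omega]
        rfl
      · by_cases hi2 : (i : ℕ) = n
        · simp [Fin.snoc, hi2]
        · have hi3 : (i : ℕ) = n + 1 := by omega
          simp [Fin.snoc, hi3]
    rintro ⟨w, hw⟩
    rw [BoundedFormula.realize_liftAt (by omega), real_default] at hw
    obtain ⟨w', h1, h2⟩ := e1 ⟨w, by rw [← e2]; exact hw⟩
    refine ⟨w', by simpa [Fin.snoc] using h1, ?_⟩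
    rw [BoundedFormula.realize_liftAt (by omega), real_default]
    have e3 := e2 w'
    rw [← e3] at h2
    exact h2

end JK

namespace JK
open FirstOrder FirstOrder.Language

set_option linter.unusedSimpArgs false
set_option linter.style.longLine false
set_option linter.unusedSectionVars false

/-! ### Universe polymorphic copies of the semantic notions -/

section Semantics

variable {V : Type*} (E : V → V → Prop)

/-- `x ⊆ y` in `V`. -/
def SubV (x y : V) : Prop := ∀ z, E z x → E z y

def IsEmptyV (e : V) : Prop := ∀ z, ¬ E z e

def IsSingletonOf (s a : V) : Prop := ∀ z, E z s ↔ z = a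

def IsUPairOf (u a b : V) : Prop := ∀ z, E z u ↔ (z = a ∨ z = b)

/-- `p` is the Kuratowski ordered pair `⟨a, b⟩`. -/
def IsOPairOf (p a b : V) : Prop :=
  ∃ s u, IsSingletonOf E s a ∧ IsUPairOf E u a b ∧ IsUPairOf E p s u

/-- `f(x) = y`, for `f` a set of ordered pairs. -/
def FunVal (f x y : V) : Prop := ∃ p, E p f ∧ IsOPairOf E p x y

/-- `f` is a function with domain `a` (a set of ordered pairs in `V`). -/
def IsFuncOn (f a : V) : Prop :=
  (∀ p, E p f → ∃ x y, IsOPairOf E p x y) ∧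
  (∀ x y y', FunVal E f x y → FunVal E f x y' → y = y') ∧
  (∀ x, (∃ y, FunVal E f x y) ↔ E x a)

/-- `f : a → b` in `V`. -/
def IsFuncInto (f a b : V) : Prop := IsFuncOn E f a ∧ ∀ x y, FunVal E f x y → E y b

def InjFun (f : V) : Prop := ∀ x x' y, FunVal E f x y → FunVal E f x' y → x = x'

def InjInto (a b : V) : Prop := ∃ f, IsFuncInto E f a b ∧ InjFun E f

/-- `|a| = |b|` in `V`: a bijection exists in `V`. -/
def EquinumV (a b : V) : Prop :=
  ∃ f, IsFuncInto E f a b ∧ InjFun E f ∧ ∀ y, E y b → ∃ x, FunVal E f x y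

def IsTransSet (x : V) : Prop := ∀ y, E y x → SubV E y x

/-- `x` is an ordinal: a transitive set linearly ordered by `E`. -/
def IsOrdV (x : V) : Prop :=
  IsTransSet E x ∧ ∀ y z, E y x → E z x → (E y z ∨ y = z ∨ E z y)

def IsLimitOrdV (x : V) : Prop :=
  IsOrdV E x ∧ (∃ y, E y x) ∧ ∀ y, E y x → ∃ z, E z x ∧ E y z

/-- `w = ω` in `V`: the least limit ordinal. -/
def IsOmegaV (w : V) : Prop := IsLimitOrdV E w ∧ ∀ x, E x w → ¬ IsLimitOrdV E x

/-- `x` is countable in `V`. -/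
def CountableV (x : V) : Prop := ∃ w, IsOmegaV E w ∧ InjInto E x w

/-- `k = ω₁` in `V`: the least uncountable ordinal. -/
def IsOmega1V (k : V) : Prop :=
  IsOrdV E k ∧ ¬ CountableV E k ∧ ∀ a, E a k → CountableV E a

/-- `k = ω₂` in `V`: the least ordinal of cardinality `> ω₁`. -/
def IsOmega2V (k : V) : Prop :=
  IsOrdV E k ∧ ∀ k₁, IsOmega1V E k₁ → (¬ InjInto E k k₁ ∧ ∀ a, E a k → InjInto E a k₁)

/-- `p = 𝒫(x)` in `V`. -/
def IsPowOf (p x : V) : Prop := ∀ z, E z p ↔ SubV E z x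

/-- CH holds in `V`: `𝒫(ω)` is equinumerous with `ω₁`. -/
def CHV : Prop :=
  ∀ w p k₁, IsOmegaV E w → IsPowOf E p w → IsOmega1V E k₁ → EquinumV E p k₁

/-- `2^{ω₁} > ω₂` holds in `V`: `𝒫(ω₁)` does not inject into `ω₂`. -/
def PowOmega1AboveOmega2V : Prop :=
  ∀ k₁ p k₂, IsOmega1V E k₁ → IsPowOf E p k₁ → IsOmega2V E k₂ → ¬ InjInto E p k₂

/-- `k` is a cardinal in `V`. -/
def IsCardV (k : V) : Prop := IsOrdV E k ∧ ∀ a, E a k → ¬ EquinumV E a k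

/-- `k` is regular in `V`: every function from a smaller ordinal into `k` is bounded. -/
def IsRegularV (k : V) : Prop :=
  IsOrdV E k ∧ ∀ a f, E a k → IsFuncInto E f a k →
    ∃ b, E b k ∧ ∀ x y, FunVal E f x y → E y b

/-- `k` is strongly inaccessible in `V`. -/
def IsInaccessibleV (k : V) : Prop :=
  IsCardV E k ∧ ¬ CountableV E k ∧ IsRegularV E k ∧
    ∀ a p, E a k → IsPowOf E p a → ∃ b, E b k ∧ InjInto E p b

def IsOneV (o : V) : Prop := ∀ z, E z o ↔ IsEmptyV E z

/-- `t = 2 = {0, 1}` in `V`. -/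
def IsTwoV (t : V) : Prop := ∀ z, E z t ↔ (IsEmptyV E z ∨ IsOneV E z)

/-- `x` is a node of `2^{<ω₁}` in `V` (`k₁` standing for ω₁): a function from a
countable ordinal into `2`. -/
def IsNodeV (k₁ x : V) : Prop :=
  ∃ a t, E a k₁ ∧ IsOrdV E a ∧ IsTwoV E t ∧ IsFuncInto E x a t

/-- The node `x` has domain (height) `a`. -/
def HasDomV (x a : V) : Prop := ∀ u, (∃ y, FunVal E x u y) ↔ E u a

/-- `t` is a tree in `V`: a subtree of `2^{<ω₁}`, ordered by inclusion. -/
def IsTreeV (k₁ t : V) : Prop := ∀ x, E x t → IsNodeV E k₁ x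

/-- `t` is an ω₁-tree in `V`: cardinality ω₁ and height ω₁. -/
def IsOmega1TreeV (k₁ t : V) : Prop :=
  IsTreeV E k₁ t ∧ EquinumV E t k₁ ∧ ∀ a, E a k₁ → IsOrdV E a → ∃ x, E x t ∧ HasDomV E x a

/-- `b` is a branch of the tree `t` in `V`: a linearly ordered subset meeting every
nonempty level. -/
def IsBranchV (t b : V) : Prop :=
  SubV E b t ∧ (∀ x y, E x b → E y b → (SubV E x y ∨ SubV E y x)) ∧
    ∀ a, (∃ x, E x t ∧ HasDomV E x a) → ∃ x, E x b ∧ HasDomV E x a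

/-- `bs = B(t)`, the set of all branches of `t`, in `V`. -/
def IsBranchSetOf (t bs : V) : Prop := ∀ z, E z bs ↔ IsBranchV E t z

/-- `l` is the `a`-th level of `t` in `V`. -/
def IsLevelSetOf (t a l : V) : Prop := ∀ x, E x l ↔ (E x t ∧ HasDomV E x a)

/-- `t` is a Kurepa tree in `V`: an ω₁-tree with countable levels and more than
ω₁-many branches. -/
def IsKurepaV (k₁ t : V) : Prop :=
  IsOmega1TreeV E k₁ t ∧
  (∀ a l, E a k₁ → IsLevelSetOf E t a l → CountableV E l) ∧
  ∀ bs, IsBranchSetOf E t bs → ¬ InjInto E bs k₁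

/-- `t` is a Jech–Kunen tree in `V`: an ω₁-tree with `ω₁ < |B(t)| < 2^{ω₁}`. -/
def IsJechKunenV (k₁ t : V) : Prop :=
  IsOmega1TreeV E k₁ t ∧
  ∀ bs p, IsBranchSetOf E t bs → IsPowOf E p k₁ →
    (¬ InjInto E bs k₁ ∧ InjInto E bs p ∧ ¬ EquinumV E bs p)

end Semantics

universe u
variable {B : Type u} [CompleteBooleanAlgebra B]

instance clp_SubV (x y : Nm B) : Clp (fun U : Ult B => SubV (El U) (cl U x) (cl U y)) := by
  unfold SubV; infer_instance
instance clp_IsEmptyV (e : Nm B) : Clp (fun U : Ult B => IsEmptyV (El U) (cl U e)) := by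
  unfold IsEmptyV; infer_instance
instance clp_IsSingletonOf (s a : Nm B) : Clp (fun U : Ult B => IsSingletonOf (El U) (cl U s) (cl U a)) := by
  unfold IsSingletonOf; infer_instance
instance clp_IsUPairOf (x a b : Nm B) : Clp (fun U : Ult B => IsUPairOf (El U) (cl U x) (cl U a) (cl U b)) := by
  unfold IsUPairOf; infer_instance
instance clp_IsOPairOf (p a b : Nm B) : Clp (fun U : Ult B => IsOPairOf (El U) (cl U p) (cl U a) (cl U b)) := by
  unfold IsOPairOf; infer_instance
instance clp_FunVal (f x y : Nm B) : Clp (fun U : Ult B => FunVal (El U) (cl U f) (cl U x) (cl U y)) := by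
  unfold FunVal; infer_instance
instance clp_IsFuncOn (f a : Nm B) : Clp (fun U : Ult B => IsFuncOn (El U) (cl U f) (cl U a)) := by
  unfold IsFuncOn; infer_instance
instance clp_IsFuncInto (f a b : Nm B) : Clp (fun U : Ult B => IsFuncInto (El U) (cl U f) (cl U a) (cl U b)) := by
  unfold IsFuncInto; infer_instance
instance clp_InjFun (f : Nm B) : Clp (fun U : Ult B => InjFun (El U) (cl U f)) := by
  unfold InjFun; infer_instance
instance clp_InjInto (a b : Nm B) : Clp (fun U : Ult B => InjInto (El U) (cl U a) (cl U b)) := by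
  unfold InjInto; infer_instance
instance clp_EquinumV (a b : Nm B) : Clp (fun U : Ult B => EquinumV (El U) (cl U a) (cl U b)) := by
  unfold EquinumV; infer_instance
instance clp_IsTransSet (x : Nm B) : Clp (fun U : Ult B => IsTransSet (El U) (cl U x)) := by
  unfold IsTransSet; infer_instance
instance clp_IsOrdV (x : Nm B) : Clp (fun U : Ult B => IsOrdV (El U) (cl U x)) := by
  unfold IsOrdV; infer_instance
instance clp_IsLimitOrdV (x : Nm B) : Clp (fun U : Ult B => IsLimitOrdV (El U) (cl U x)) := by
  unfold IsLimitOrdV; infer_instance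
instance clp_IsOmegaV (w : Nm B) : Clp (fun U : Ult B => IsOmegaV (El U) (cl U w)) := by
  unfold IsOmegaV; infer_instance
instance clp_CountableV (x : Nm B) : Clp (fun U : Ult B => CountableV (El U) (cl U x)) := by
  unfold CountableV; infer_instance
instance clp_IsOmega1V (k : Nm B) : Clp (fun U : Ult B => IsOmega1V (El U) (cl U k)) := by
  unfold IsOmega1V; infer_instance
instance clp_IsOmega2V (k : Nm B) : Clp (fun U : Ult B => IsOmega2V (El U) (cl U k)) := by
  unfold IsOmega2V; infer_instance
instance clp_IsPowOf (p x : Nm B) : Clp (fun U : Ult B => IsPowOf (El U) (cl U p) (cl U x)) := by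
  unfold IsPowOf; infer_instance
instance clp_CHV : Clp (fun U : Ult B => CHV (El U) ) := by
  unfold CHV; infer_instance
instance clp_PowOmega1AboveOmega2V : Clp (fun U : Ult B => PowOmega1AboveOmega2V (El U) ) := by
  unfold PowOmega1AboveOmega2V; infer_instance
instance clp_IsOneV (o : Nm B) : Clp (fun U : Ult B => IsOneV (El U) (cl U o)) := by
  unfold IsOneV; infer_instance
instance clp_IsTwoV (t : Nm B) : Clp (fun U : Ult B => IsTwoV (El U) (cl U t)) := by
  unfold IsTwoV; infer_instance
instance clp_IsNodeV (k x : Nm B) : Clp (fun U : Ult B => IsNodeV (El U) (cl U k) (cl U x)) := by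
  unfold IsNodeV; infer_instance
instance clp_HasDomV (x a : Nm B) : Clp (fun U : Ult B => HasDomV (El U) (cl U x) (cl U a)) := by
  unfold HasDomV; infer_instance
instance clp_IsTreeV (k t : Nm B) : Clp (fun U : Ult B => IsTreeV (El U) (cl U k) (cl U t)) := by
  unfold IsTreeV; infer_instance
instance clp_IsOmega1TreeV (k t : Nm B) : Clp (fun U : Ult B => IsOmega1TreeV (El U) (cl U k) (cl U t)) := by
  unfold IsOmega1TreeV; infer_instance
instance clp_IsBranchV (t b : Nm B) : Clp (fun U : Ult B => IsBranchV (El U) (cl U t) (cl U b)) := by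
  unfold IsBranchV; infer_instance
instance clp_IsBranchSetOf (t bs : Nm B) : Clp (fun U : Ult B => IsBranchSetOf (El U) (cl U t) (cl U bs)) := by
  unfold IsBranchSetOf; infer_instance
instance clp_IsLevelSetOf (t a l : Nm B) : Clp (fun U : Ult B => IsLevelSetOf (El U) (cl U t) (cl U a) (cl U l)) := by
  unfold IsLevelSetOf; infer_instance
instance clp_IsKurepaV (k t : Nm B) : Clp (fun U : Ult B => IsKurepaV (El U) (cl U k) (cl U t)) := by
  unfold IsKurepaV; infer_instance
instance clp_IsJechKunenV (k t : Nm B) : Clp (fun U : Ult B => IsJechKunenV (El U) (cl U k) (cl U t)) := by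
  unfold IsJechKunenV; infer_instance

/-! ### Deep formulas, for the Löwenheim-Skolem transfer -/

section Deep
local postfix:max "↟" => Fin.castSucc
local notation "ℓ" => Fin.last _

/-- membership relation of a structure -/
def mE (V : Type*) [memLang.Structure V] : V → V → Prop :=
  fun x y => Structure.RelMap memSym ![x, y]

theorem real_mem2 {V : Type*} [memLang.Structure V] {n : ℕ} (i j : Fin n) (v : Empty → V)
    (xs : Fin n → V) : (mem' i j).Realize v xs ↔ mE V (xs i) (xs j) := real_mem i j v xs

/-- The full conclusion, polymorphic. -/
def Concl {V : Type*} (E : V → V → Prop) : Prop :=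
      CHV E ∧ PowOmega1AboveOmega2V E ∧
      ∀ k₁ : V, IsOmega1V E k₁ →
        (∀ t : V, ¬ IsKurepaV E k₁ t) ∧
        ∃ F : V, IsFuncOn E F k₁ ∧
          (∀ α t : V, E α k₁ → FunVal E F α t → IsJechKunenV E k₁ t) ∧
          (∀ α α' t t' bs bs' : V, E α k₁ → E α' k₁ → α ≠ α' →
            FunVal E F α t → FunVal E F α' t' →
            IsBranchSetOf E t bs → IsBranchSetOf E t' bs' → ¬ EquinumV E bs bs')

def fSubV {n : ℕ} (x y : Fin n) : memLang.BoundedFormula Empty n :=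
  ∀' (mem' ℓ x↟ ⟹ mem' ℓ y↟)
theorem rSubV {V : Type*} [memLang.Structure V] {n : ℕ} (x y : Fin n) (v : Empty → V) (xs : Fin n → V) :
    (fSubV x y).Realize v xs ↔ SubV (mE V) (xs x) (xs y) := by
  simp only [fSubV, SubV, real_mem2, real_eq, BoundedFormula.realize_all, BoundedFormula.realize_ex, BoundedFormula.realize_inf, BoundedFormula.realize_sup, BoundedFormula.realize_not, BoundedFormula.realize_imp, BoundedFormula.realize_iff, Fin.snoc_castSucc, Fin.snoc_last, ne_eq]
def fIsEmptyV {n : ℕ} (e : Fin n) : memLang.BoundedFormula Empty n :=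
  ∀' ∼(mem' ℓ e↟)
theorem rIsEmptyV {V : Type*} [memLang.Structure V] {n : ℕ} (e : Fin n) (v : Empty → V) (xs : Fin n → V) :
    (fIsEmptyV e).Realize v xs ↔ IsEmptyV (mE V) (xs e) := by
  simp only [fIsEmptyV, IsEmptyV, real_mem2, real_eq, BoundedFormula.realize_all, BoundedFormula.realize_ex, BoundedFormula.realize_inf, BoundedFormula.realize_sup, BoundedFormula.realize_not, BoundedFormula.realize_imp, BoundedFormula.realize_iff, Fin.snoc_castSucc, Fin.snoc_last, ne_eq]
def fIsSingletonOf {n : ℕ} (s a : Fin n) : memLang.BoundedFormula Empty n :=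
  ∀' (mem' ℓ s↟ ⇔ eq' ℓ a↟)
theorem rIsSingletonOf {V : Type*} [memLang.Structure V] {n : ℕ} (s a : Fin n) (v : Empty → V) (xs : Fin n → V) :
    (fIsSingletonOf s a).Realize v xs ↔ IsSingletonOf (mE V) (xs s) (xs a) := by
  simp only [fIsSingletonOf, IsSingletonOf, real_mem2, real_eq, BoundedFormula.realize_all, BoundedFormula.realize_ex, BoundedFormula.realize_inf, BoundedFormula.realize_sup, BoundedFormula.realize_not, BoundedFormula.realize_imp, BoundedFormula.realize_iff, Fin.snoc_castSucc, Fin.snoc_last, ne_eq]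
def fIsUPairOf {n : ℕ} (x a b : Fin n) : memLang.BoundedFormula Empty n :=
  ∀' (mem' ℓ x↟ ⇔ (eq' ℓ a↟ ⊔ eq' ℓ b↟))
theorem rIsUPairOf {V : Type*} [memLang.Structure V] {n : ℕ} (x a b : Fin n) (v : Empty → V) (xs : Fin n → V) :
    (fIsUPairOf x a b).Realize v xs ↔ IsUPairOf (mE V) (xs x) (xs a) (xs b) := by
  simp only [fIsUPairOf, IsUPairOf, real_mem2, real_eq, BoundedFormula.realize_all, BoundedFormula.realize_ex, BoundedFormula.realize_inf, BoundedFormula.realize_sup, BoundedFormula.realize_not, BoundedFormula.realize_imp, BoundedFormula.realize_iff, Fin.snoc_castSucc, Fin.snoc_last, ne_eq]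
def fIsOPairOf {n : ℕ} (p a b : Fin n) : memLang.BoundedFormula Empty n :=
  ∃' ∃' (fIsSingletonOf ℓ↟ a↟↟ ⊓ (fIsUPairOf ℓ a↟↟ b↟↟ ⊓ fIsUPairOf p↟↟ ℓ↟ ℓ))
theorem rIsOPairOf {V : Type*} [memLang.Structure V] {n : ℕ} (p a b : Fin n) (v : Empty → V) (xs : Fin n → V) :
    (fIsOPairOf p a b).Realize v xs ↔ IsOPairOf (mE V) (xs p) (xs a) (xs b) := by
  simp only [fIsOPairOf, IsOPairOf, real_mem2, real_eq, rIsSingletonOf, rIsUPairOf, BoundedFormula.realize_all, BoundedFormula.realize_ex, BoundedFormula.realize_inf, BoundedFormula.realize_sup, BoundedFormula.realize_not, BoundedFormula.realize_imp, BoundedFormula.realize_iff, Fin.snoc_castSucc, Fin.snoc_last, ne_eq]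
def fFunVal {n : ℕ} (f x y : Fin n) : memLang.BoundedFormula Empty n :=
  ∃' (mem' ℓ f↟ ⊓ fIsOPairOf ℓ x↟ y↟)
theorem rFunVal {V : Type*} [memLang.Structure V] {n : ℕ} (f x y : Fin n) (v : Empty → V) (xs : Fin n → V) :
    (fFunVal f x y).Realize v xs ↔ FunVal (mE V) (xs f) (xs x) (xs y) := by
  simp only [fFunVal, FunVal, real_mem2, real_eq, rIsOPairOf, BoundedFormula.realize_all, BoundedFormula.realize_ex, BoundedFormula.realize_inf, BoundedFormula.realize_sup, BoundedFormula.realize_not, BoundedFormula.realize_imp, BoundedFormula.realize_iff, Fin.snoc_castSucc, Fin.snoc_last, ne_eq]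
def fIsFuncOn {n : ℕ} (f a : Fin n) : memLang.BoundedFormula Empty n :=
  (∀' (mem' ℓ f↟ ⟹ ∃' ∃' fIsOPairOf ℓ↟↟ ℓ↟ ℓ)) ⊓ ((∀' ∀' ∀' (fFunVal f↟↟↟ ℓ↟↟ ℓ↟ ⟹ (fFunVal f↟↟↟ ℓ↟↟ ℓ ⟹ eq' ℓ↟ ℓ))) ⊓ (∀' ((∃' fFunVal f↟↟ ℓ↟ ℓ) ⇔ mem' ℓ a↟)))
theorem rIsFuncOn {V : Type*} [memLang.Structure V] {n : ℕ} (f a : Fin n) (v : Empty → V) (xs : Fin n → V) :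
    (fIsFuncOn f a).Realize v xs ↔ IsFuncOn (mE V) (xs f) (xs a) := by
  simp only [fIsFuncOn, IsFuncOn, real_mem2, real_eq, rFunVal, rIsOPairOf, BoundedFormula.realize_all, BoundedFormula.realize_ex, BoundedFormula.realize_inf, BoundedFormula.realize_sup, BoundedFormula.realize_not, BoundedFormula.realize_imp, BoundedFormula.realize_iff, Fin.snoc_castSucc, Fin.snoc_last, ne_eq]
def fIsFuncInto {n : ℕ} (f a b : Fin n) : memLang.BoundedFormula Empty n :=
  fIsFuncOn f a ⊓ ∀' ∀' (fFunVal f↟↟ ℓ↟ ℓ ⟹ mem' ℓ b↟↟)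
theorem rIsFuncInto {V : Type*} [memLang.Structure V] {n : ℕ} (f a b : Fin n) (v : Empty → V) (xs : Fin n → V) :
    (fIsFuncInto f a b).Realize v xs ↔ IsFuncInto (mE V) (xs f) (xs a) (xs b) := by
  simp only [fIsFuncInto, IsFuncInto, real_mem2, real_eq, rFunVal, rIsFuncOn, BoundedFormula.realize_all, BoundedFormula.realize_ex, BoundedFormula.realize_inf, BoundedFormula.realize_sup, BoundedFormula.realize_not, BoundedFormula.realize_imp, BoundedFormula.realize_iff, Fin.snoc_castSucc, Fin.snoc_last, ne_eq]
def fInjFun {n : ℕ} (f : Fin n) : memLang.BoundedFormula Empty n :=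
  ∀' ∀' ∀' (fFunVal f↟↟↟ ℓ↟↟ ℓ ⟹ (fFunVal f↟↟↟ ℓ↟ ℓ ⟹ eq' ℓ↟↟ ℓ↟))
theorem rInjFun {V : Type*} [memLang.Structure V] {n : ℕ} (f : Fin n) (v : Empty → V) (xs : Fin n → V) :
    (fInjFun f).Realize v xs ↔ InjFun (mE V) (xs f) := by
  simp only [fInjFun, InjFun, real_mem2, real_eq, rFunVal, BoundedFormula.realize_all, BoundedFormula.realize_ex, BoundedFormula.realize_inf, BoundedFormula.realize_sup, BoundedFormula.realize_not, BoundedFormula.realize_imp, BoundedFormula.realize_iff, Fin.snoc_castSucc, Fin.snoc_last, ne_eq]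
def fInjInto {n : ℕ} (a b : Fin n) : memLang.BoundedFormula Empty n :=
  ∃' (fIsFuncInto ℓ a↟ b↟ ⊓ fInjFun ℓ)
theorem rInjInto {V : Type*} [memLang.Structure V] {n : ℕ} (a b : Fin n) (v : Empty → V) (xs : Fin n → V) :
    (fInjInto a b).Realize v xs ↔ InjInto (mE V) (xs a) (xs b) := by
  simp only [fInjInto, InjInto, real_mem2, real_eq, rInjFun, rIsFuncInto, BoundedFormula.realize_all, BoundedFormula.realize_ex, BoundedFormula.realize_inf, BoundedFormula.realize_sup, BoundedFormula.realize_not, BoundedFormula.realize_imp, BoundedFormula.realize_iff, Fin.snoc_castSucc, Fin.snoc_last, ne_eq]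
def fEquinumV {n : ℕ} (a b : Fin n) : memLang.BoundedFormula Empty n :=
  ∃' (fIsFuncInto ℓ a↟ b↟ ⊓ (fInjFun ℓ ⊓ ∀' (mem' ℓ b↟↟ ⟹ ∃' fFunVal ℓ↟↟ ℓ ℓ↟)))
theorem rEquinumV {V : Type*} [memLang.Structure V] {n : ℕ} (a b : Fin n) (v : Empty → V) (xs : Fin n → V) :
    (fEquinumV a b).Realize v xs ↔ EquinumV (mE V) (xs a) (xs b) := by
  simp only [fEquinumV, EquinumV, real_mem2, real_eq, rFunVal, rInjFun, rIsFuncInto, BoundedFormula.realize_all, BoundedFormula.realize_ex, BoundedFormula.realize_inf, BoundedFormula.realize_sup, BoundedFormula.realize_not, BoundedFormula.realize_imp, BoundedFormula.realize_iff, Fin.snoc_castSucc, Fin.snoc_last, ne_eq]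
def fIsTransSet {n : ℕ} (x : Fin n) : memLang.BoundedFormula Empty n :=
  ∀' (mem' ℓ x↟ ⟹ fSubV ℓ x↟)
theorem rIsTransSet {V : Type*} [memLang.Structure V] {n : ℕ} (x : Fin n) (v : Empty → V) (xs : Fin n → V) :
    (fIsTransSet x).Realize v xs ↔ IsTransSet (mE V) (xs x) := by
  simp only [fIsTransSet, IsTransSet, real_mem2, real_eq, rSubV, BoundedFormula.realize_all, BoundedFormula.realize_ex, BoundedFormula.realize_inf, BoundedFormula.realize_sup, BoundedFormula.realize_not, BoundedFormula.realize_imp, BoundedFormula.realize_iff, Fin.snoc_castSucc, Fin.snoc_last, ne_eq]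
def fIsOrdV {n : ℕ} (x : Fin n) : memLang.BoundedFormula Empty n :=
  fIsTransSet x ⊓ ∀' ∀' (mem' ℓ↟ x↟↟ ⟹ (mem' ℓ x↟↟ ⟹ (mem' ℓ↟ ℓ ⊔ (eq' ℓ↟ ℓ ⊔ mem' ℓ ℓ↟))))
theorem rIsOrdV {V : Type*} [memLang.Structure V] {n : ℕ} (x : Fin n) (v : Empty → V) (xs : Fin n → V) :
    (fIsOrdV x).Realize v xs ↔ IsOrdV (mE V) (xs x) := by
  simp only [fIsOrdV, IsOrdV, real_mem2, real_eq, rIsTransSet, BoundedFormula.realize_all, BoundedFormula.realize_ex, BoundedFormula.realize_inf, BoundedFormula.realize_sup, BoundedFormula.realize_not, BoundedFormula.realize_imp, BoundedFormula.realize_iff, Fin.snoc_castSucc, Fin.snoc_last, ne_eq]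
def fIsLimitOrdV {n : ℕ} (x : Fin n) : memLang.BoundedFormula Empty n :=
  fIsOrdV x ⊓ ((∃' mem' ℓ x↟) ⊓ ∀' (mem' ℓ x↟ ⟹ ∃' (mem' ℓ x↟↟ ⊓ mem' ℓ↟ ℓ)))
theorem rIsLimitOrdV {V : Type*} [memLang.Structure V] {n : ℕ} (x : Fin n) (v : Empty → V) (xs : Fin n → V) :
    (fIsLimitOrdV x).Realize v xs ↔ IsLimitOrdV (mE V) (xs x) := by
  simp only [fIsLimitOrdV, IsLimitOrdV, real_mem2, real_eq, rIsOrdV, BoundedFormula.realize_all, BoundedFormula.realize_ex, BoundedFormula.realize_inf, BoundedFormula.realize_sup, BoundedFormula.realize_not, BoundedFormula.realize_imp, BoundedFormula.realize_iff, Fin.snoc_castSucc, Fin.snoc_last, ne_eq]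
def fIsOmegaV {n : ℕ} (w : Fin n) : memLang.BoundedFormula Empty n :=
  fIsLimitOrdV w ⊓ ∀' (mem' ℓ w↟ ⟹ ∼(fIsLimitOrdV ℓ))
theorem rIsOmegaV {V : Type*} [memLang.Structure V] {n : ℕ} (w : Fin n) (v : Empty → V) (xs : Fin n → V) :
    (fIsOmegaV w).Realize v xs ↔ IsOmegaV (mE V) (xs w) := by
  simp only [fIsOmegaV, IsOmegaV, real_mem2, real_eq, rIsLimitOrdV, BoundedFormula.realize_all, BoundedFormula.realize_ex, BoundedFormula.realize_inf, BoundedFormula.realize_sup, BoundedFormula.realize_not, BoundedFormula.realize_imp, BoundedFormula.realize_iff, Fin.snoc_castSucc, Fin.snoc_last, ne_eq]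
def fCountableV {n : ℕ} (x : Fin n) : memLang.BoundedFormula Empty n :=
  ∃' (fIsOmegaV ℓ ⊓ fInjInto x↟ ℓ)
theorem rCountableV {V : Type*} [memLang.Structure V] {n : ℕ} (x : Fin n) (v : Empty → V) (xs : Fin n → V) :
    (fCountableV x).Realize v xs ↔ CountableV (mE V) (xs x) := by
  simp only [fCountableV, CountableV, real_mem2, real_eq, rInjInto, rIsOmegaV, BoundedFormula.realize_all, BoundedFormula.realize_ex, BoundedFormula.realize_inf, BoundedFormula.realize_sup, BoundedFormula.realize_not, BoundedFormula.realize_imp, BoundedFormula.realize_iff, Fin.snoc_castSucc, Fin.snoc_last, ne_eq]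
def fIsOmega1V {n : ℕ} (k : Fin n) : memLang.BoundedFormula Empty n :=
  fIsOrdV k ⊓ (∼(fCountableV k) ⊓ ∀' (mem' ℓ k↟ ⟹ fCountableV ℓ))
theorem rIsOmega1V {V : Type*} [memLang.Structure V] {n : ℕ} (k : Fin n) (v : Empty → V) (xs : Fin n → V) :
    (fIsOmega1V k).Realize v xs ↔ IsOmega1V (mE V) (xs k) := by
  simp only [fIsOmega1V, IsOmega1V, real_mem2, real_eq, rCountableV, rIsOrdV, BoundedFormula.realize_all, BoundedFormula.realize_ex, BoundedFormula.realize_inf, BoundedFormula.realize_sup, BoundedFormula.realize_not, BoundedFormula.realize_imp, BoundedFormula.realize_iff, Fin.snoc_castSucc, Fin.snoc_last, ne_eq]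
def fIsOmega2V {n : ℕ} (k : Fin n) : memLang.BoundedFormula Empty n :=
  fIsOrdV k ⊓ ∀' (fIsOmega1V ℓ ⟹ (∼(fInjInto k↟ ℓ) ⊓ ∀' (mem' ℓ k↟↟ ⟹ fInjInto ℓ ℓ↟)))
theorem rIsOmega2V {V : Type*} [memLang.Structure V] {n : ℕ} (k : Fin n) (v : Empty → V) (xs : Fin n → V) :
    (fIsOmega2V k).Realize v xs ↔ IsOmega2V (mE V) (xs k) := by
  simp only [fIsOmega2V, IsOmega2V, real_mem2, real_eq, rInjInto, rIsOmega1V, rIsOrdV, BoundedFormula.realize_all, BoundedFormula.realize_ex, BoundedFormula.realize_inf, BoundedFormula.realize_sup, BoundedFormula.realize_not, BoundedFormula.realize_imp, BoundedFormula.realize_iff, Fin.snoc_castSucc, Fin.snoc_last, ne_eq]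
def fIsPowOf {n : ℕ} (p x : Fin n) : memLang.BoundedFormula Empty n :=
  ∀' (mem' ℓ p↟ ⇔ fSubV ℓ x↟)
theorem rIsPowOf {V : Type*} [memLang.Structure V] {n : ℕ} (p x : Fin n) (v : Empty → V) (xs : Fin n → V) :
    (fIsPowOf p x).Realize v xs ↔ IsPowOf (mE V) (xs p) (xs x) := by
  simp only [fIsPowOf, IsPowOf, real_mem2, real_eq, rSubV, BoundedFormula.realize_all, BoundedFormula.realize_ex, BoundedFormula.realize_inf, BoundedFormula.realize_sup, BoundedFormula.realize_not, BoundedFormula.realize_imp, BoundedFormula.realize_iff, Fin.snoc_castSucc, Fin.snoc_last, ne_eq]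
def fCHV {n : ℕ} : memLang.BoundedFormula Empty n :=
  ∀' ∀' ∀' (fIsOmegaV ℓ↟↟ ⟹ (fIsPowOf ℓ↟ ℓ↟↟ ⟹ (fIsOmega1V ℓ ⟹ fEquinumV ℓ↟ ℓ)))
theorem rCHV {V : Type*} [memLang.Structure V] {n : ℕ} (v : Empty → V) (xs : Fin n → V) :
    (fCHV ).Realize v xs ↔ CHV (mE V)  := by
  simp only [fCHV, CHV, real_mem2, real_eq, rEquinumV, rIsOmega1V, rIsOmegaV, rIsPowOf, BoundedFormula.realize_all, BoundedFormula.realize_ex, BoundedFormula.realize_inf, BoundedFormula.realize_sup, BoundedFormula.realize_not, BoundedFormula.realize_imp, BoundedFormula.realize_iff, Fin.snoc_castSucc, Fin.snoc_last, ne_eq]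
def fPowOmega1AboveOmega2V {n : ℕ} : memLang.BoundedFormula Empty n :=
  ∀' ∀' ∀' (fIsOmega1V ℓ↟↟ ⟹ (fIsPowOf ℓ↟ ℓ↟↟ ⟹ (fIsOmega2V ℓ ⟹ ∼(fInjInto ℓ↟ ℓ))))
theorem rPowOmega1AboveOmega2V {V : Type*} [memLang.Structure V] {n : ℕ} (v : Empty → V) (xs : Fin n → V) :
    (fPowOmega1AboveOmega2V ).Realize v xs ↔ PowOmega1AboveOmega2V (mE V)  := by
  simp only [fPowOmega1AboveOmega2V, PowOmega1AboveOmega2V, real_mem2, real_eq, rInjInto, rIsOmega1V, rIsOmega2V, rIsPowOf, BoundedFormula.realize_all, BoundedFormula.realize_ex, BoundedFormula.realize_inf, BoundedFormula.realize_sup, BoundedFormula.realize_not, BoundedFormula.realize_imp, BoundedFormula.realize_iff, Fin.snoc_castSucc, Fin.snoc_last, ne_eq]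
def fIsOneV {n : ℕ} (o : Fin n) : memLang.BoundedFormula Empty n :=
  ∀' (mem' ℓ o↟ ⇔ fIsEmptyV ℓ)
theorem rIsOneV {V : Type*} [memLang.Structure V] {n : ℕ} (o : Fin n) (v : Empty → V) (xs : Fin n → V) :
    (fIsOneV o).Realize v xs ↔ IsOneV (mE V) (xs o) := by
  simp only [fIsOneV, IsOneV, real_mem2, real_eq, rIsEmptyV, BoundedFormula.realize_all, BoundedFormula.realize_ex, BoundedFormula.realize_inf, BoundedFormula.realize_sup, BoundedFormula.realize_not, BoundedFormula.realize_imp, BoundedFormula.realize_iff, Fin.snoc_castSucc, Fin.snoc_last, ne_eq]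
def fIsTwoV {n : ℕ} (t : Fin n) : memLang.BoundedFormula Empty n :=
  ∀' (mem' ℓ t↟ ⇔ (fIsEmptyV ℓ ⊔ fIsOneV ℓ))
theorem rIsTwoV {V : Type*} [memLang.Structure V] {n : ℕ} (t : Fin n) (v : Empty → V) (xs : Fin n → V) :
    (fIsTwoV t).Realize v xs ↔ IsTwoV (mE V) (xs t) := by
  simp only [fIsTwoV, IsTwoV, real_mem2, real_eq, rIsEmptyV, rIsOneV, BoundedFormula.realize_all, BoundedFormula.realize_ex, BoundedFormula.realize_inf, BoundedFormula.realize_sup, BoundedFormula.realize_not, BoundedFormula.realize_imp, BoundedFormula.realize_iff, Fin.snoc_castSucc, Fin.snoc_last, ne_eq]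
def fIsNodeV {n : ℕ} (k x : Fin n) : memLang.BoundedFormula Empty n :=
  ∃' ∃' (mem' ℓ↟ k↟↟ ⊓ (fIsOrdV ℓ↟ ⊓ (fIsTwoV ℓ ⊓ fIsFuncInto x↟↟ ℓ↟ ℓ)))
theorem rIsNodeV {V : Type*} [memLang.Structure V] {n : ℕ} (k x : Fin n) (v : Empty → V) (xs : Fin n → V) :
    (fIsNodeV k x).Realize v xs ↔ IsNodeV (mE V) (xs k) (xs x) := by
  simp only [fIsNodeV, IsNodeV, real_mem2, real_eq, rIsFuncInto, rIsOrdV, rIsTwoV, BoundedFormula.realize_all, BoundedFormula.realize_ex, BoundedFormula.realize_inf, BoundedFormula.realize_sup, BoundedFormula.realize_not, BoundedFormula.realize_imp, BoundedFormula.realize_iff, Fin.snoc_castSucc, Fin.snoc_last, ne_eq]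
def fHasDomV {n : ℕ} (x a : Fin n) : memLang.BoundedFormula Empty n :=
  ∀' ((∃' fFunVal x↟↟ ℓ↟ ℓ) ⇔ mem' ℓ a↟)
theorem rHasDomV {V : Type*} [memLang.Structure V] {n : ℕ} (x a : Fin n) (v : Empty → V) (xs : Fin n → V) :
    (fHasDomV x a).Realize v xs ↔ HasDomV (mE V) (xs x) (xs a) := by
  simp only [fHasDomV, HasDomV, real_mem2, real_eq, rFunVal, BoundedFormula.realize_all, BoundedFormula.realize_ex, BoundedFormula.realize_inf, BoundedFormula.realize_sup, BoundedFormula.realize_not, BoundedFormula.realize_imp, BoundedFormula.realize_iff, Fin.snoc_castSucc, Fin.snoc_last, ne_eq]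
def fIsTreeV {n : ℕ} (k t : Fin n) : memLang.BoundedFormula Empty n :=
  ∀' (mem' ℓ t↟ ⟹ fIsNodeV k↟ ℓ)
theorem rIsTreeV {V : Type*} [memLang.Structure V] {n : ℕ} (k t : Fin n) (v : Empty → V) (xs : Fin n → V) :
    (fIsTreeV k t).Realize v xs ↔ IsTreeV (mE V) (xs k) (xs t) := by
  simp only [fIsTreeV, IsTreeV, real_mem2, real_eq, rIsNodeV, BoundedFormula.realize_all, BoundedFormula.realize_ex, BoundedFormula.realize_inf, BoundedFormula.realize_sup, BoundedFormula.realize_not, BoundedFormula.realize_imp, BoundedFormula.realize_iff, Fin.snoc_castSucc, Fin.snoc_last, ne_eq]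
def fIsOmega1TreeV {n : ℕ} (k t : Fin n) : memLang.BoundedFormula Empty n :=
  fIsTreeV k t ⊓ (fEquinumV t k ⊓ ∀' (mem' ℓ k↟ ⟹ (fIsOrdV ℓ ⟹ ∃' (mem' ℓ t↟↟ ⊓ fHasDomV ℓ ℓ↟))))
theorem rIsOmega1TreeV {V : Type*} [memLang.Structure V] {n : ℕ} (k t : Fin n) (v : Empty → V) (xs : Fin n → V) :
    (fIsOmega1TreeV k t).Realize v xs ↔ IsOmega1TreeV (mE V) (xs k) (xs t) := by
  simp only [fIsOmega1TreeV, IsOmega1TreeV, real_mem2, real_eq, rEquinumV, rHasDomV, rIsOrdV, rIsTreeV, BoundedFormula.realize_all, BoundedFormula.realize_ex, BoundedFormula.realize_inf, BoundedFormula.realize_sup, BoundedFormula.realize_not, BoundedFormula.realize_imp, BoundedFormula.realize_iff, Fin.snoc_castSucc, Fin.snoc_last, ne_eq]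
def fIsBranchV {n : ℕ} (t b : Fin n) : memLang.BoundedFormula Empty n :=
  fSubV b t ⊓ ((∀' ∀' (mem' ℓ↟ b↟↟ ⟹ (mem' ℓ b↟↟ ⟹ (fSubV ℓ↟ ℓ ⊔ fSubV ℓ ℓ↟)))) ⊓ ∀' ((∃' (mem' ℓ t↟↟ ⊓ fHasDomV ℓ ℓ↟)) ⟹ ∃' (mem' ℓ b↟↟ ⊓ fHasDomV ℓ ℓ↟)))
theorem rIsBranchV {V : Type*} [memLang.Structure V] {n : ℕ} (t b : Fin n) (v : Empty → V) (xs : Fin n → V) :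
    (fIsBranchV t b).Realize v xs ↔ IsBranchV (mE V) (xs t) (xs b) := by
  simp only [fIsBranchV, IsBranchV, real_mem2, real_eq, rHasDomV, rSubV, BoundedFormula.realize_all, BoundedFormula.realize_ex, BoundedFormula.realize_inf, BoundedFormula.realize_sup, BoundedFormula.realize_not, BoundedFormula.realize_imp, BoundedFormula.realize_iff, Fin.snoc_castSucc, Fin.snoc_last, ne_eq]
def fIsBranchSetOf {n : ℕ} (t bs : Fin n) : memLang.BoundedFormula Empty n :=
  ∀' (mem' ℓ bs↟ ⇔ fIsBranchV t↟ ℓ)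
theorem rIsBranchSetOf {V : Type*} [memLang.Structure V] {n : ℕ} (t bs : Fin n) (v : Empty → V) (xs : Fin n → V) :
    (fIsBranchSetOf t bs).Realize v xs ↔ IsBranchSetOf (mE V) (xs t) (xs bs) := by
  simp only [fIsBranchSetOf, IsBranchSetOf, real_mem2, real_eq, rIsBranchV, BoundedFormula.realize_all, BoundedFormula.realize_ex, BoundedFormula.realize_inf, BoundedFormula.realize_sup, BoundedFormula.realize_not, BoundedFormula.realize_imp, BoundedFormula.realize_iff, Fin.snoc_castSucc, Fin.snoc_last, ne_eq]
def fIsLevelSetOf {n : ℕ} (t a x : Fin n) : memLang.BoundedFormula Empty n :=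
  ∀' (mem' ℓ x↟ ⇔ (mem' ℓ t↟ ⊓ fHasDomV ℓ a↟))
theorem rIsLevelSetOf {V : Type*} [memLang.Structure V] {n : ℕ} (t a x : Fin n) (v : Empty → V) (xs : Fin n → V) :
    (fIsLevelSetOf t a x).Realize v xs ↔ IsLevelSetOf (mE V) (xs t) (xs a) (xs x) := by
  simp only [fIsLevelSetOf, IsLevelSetOf, real_mem2, real_eq, rHasDomV, BoundedFormula.realize_all, BoundedFormula.realize_ex, BoundedFormula.realize_inf, BoundedFormula.realize_sup, BoundedFormula.realize_not, BoundedFormula.realize_imp, BoundedFormula.realize_iff, Fin.snoc_castSucc, Fin.snoc_last, ne_eq]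
def fIsKurepaV {n : ℕ} (k t : Fin n) : memLang.BoundedFormula Empty n :=
  fIsOmega1TreeV k t ⊓ ((∀' ∀' (mem' ℓ↟ k↟↟ ⟹ (fIsLevelSetOf t↟↟ ℓ↟ ℓ ⟹ fCountableV ℓ))) ⊓ ∀' (fIsBranchSetOf t↟ ℓ ⟹ ∼(fInjInto ℓ k↟)))
theorem rIsKurepaV {V : Type*} [memLang.Structure V] {n : ℕ} (k t : Fin n) (v : Empty → V) (xs : Fin n → V) :
    (fIsKurepaV k t).Realize v xs ↔ IsKurepaV (mE V) (xs k) (xs t) := by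
  simp only [fIsKurepaV, IsKurepaV, real_mem2, real_eq, rCountableV, rInjInto, rIsBranchSetOf, rIsLevelSetOf, rIsOmega1TreeV, BoundedFormula.realize_all, BoundedFormula.realize_ex, BoundedFormula.realize_inf, BoundedFormula.realize_sup, BoundedFormula.realize_not, BoundedFormula.realize_imp, BoundedFormula.realize_iff, Fin.snoc_castSucc, Fin.snoc_last, ne_eq]
def fIsJechKunenV {n : ℕ} (k t : Fin n) : memLang.BoundedFormula Empty n :=
  fIsOmega1TreeV k t ⊓ ∀' ∀' (fIsBranchSetOf t↟↟ ℓ↟ ⟹ (fIsPowOf ℓ k↟↟ ⟹ (∼(fInjInto ℓ↟ k↟↟) ⊓ (fInjInto ℓ↟ ℓ ⊓ ∼(fEquinumV ℓ↟ ℓ)))))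
theorem rIsJechKunenV {V : Type*} [memLang.Structure V] {n : ℕ} (k t : Fin n) (v : Empty → V) (xs : Fin n → V) :
    (fIsJechKunenV k t).Realize v xs ↔ IsJechKunenV (mE V) (xs k) (xs t) := by
  simp only [fIsJechKunenV, IsJechKunenV, real_mem2, real_eq, rEquinumV, rInjInto, rIsBranchSetOf, rIsOmega1TreeV, rIsPowOf, BoundedFormula.realize_all, BoundedFormula.realize_ex, BoundedFormula.realize_inf, BoundedFormula.realize_sup, BoundedFormula.realize_not, BoundedFormula.realize_imp, BoundedFormula.realize_iff, Fin.snoc_castSucc, Fin.snoc_last, ne_eq]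
def fConcl {n : ℕ} : memLang.BoundedFormula Empty n :=
  fCHV ⊓ (fPowOmega1AboveOmega2V ⊓ ∀' (fIsOmega1V ℓ ⟹ ((∀' ∼(fIsKurepaV ℓ↟ ℓ)) ⊓ ∃' (fIsFuncOn ℓ ℓ↟ ⊓ ((∀' ∀' (mem' ℓ↟ ℓ↟↟↟ ⟹ (fFunVal ℓ↟↟ ℓ↟ ℓ ⟹ fIsJechKunenV ℓ↟↟↟ ℓ))) ⊓ (∀' ∀' ∀' ∀' ∀' ∀' (mem' ℓ↟↟↟↟↟ ℓ↟↟↟↟↟↟↟ ⟹ (mem' ℓ↟↟↟↟ ℓ↟↟↟↟↟↟↟ ⟹ (∼(eq' ℓ↟↟↟↟↟ ℓ↟↟↟↟) ⟹ (fFunVal ℓ↟↟↟↟↟↟ ℓ↟↟↟↟↟ ℓ↟↟↟ ⟹ (fFunVal ℓ↟↟↟↟↟↟ ℓ↟↟↟↟ ℓ↟↟ ⟹ (fIsBranchSetOf ℓ↟↟↟ ℓ↟ ⟹ (fIsBranchSetOf ℓ↟↟ ℓ ⟹ ∼(fEquinumV ℓ↟ ℓ))))))))))))))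
theorem rConcl {V : Type*} [memLang.Structure V] {n : ℕ} (v : Empty → V) (xs : Fin n → V) :
    (fConcl ).Realize v xs ↔ Concl (mE V)  := by
  simp only [fConcl, Concl, real_mem2, real_eq, rCHV, rEquinumV, rFunVal, rIsBranchSetOf, rIsFuncOn, rIsJechKunenV, rIsKurepaV, rIsOmega1V, rPowOmega1AboveOmega2V, BoundedFormula.realize_all, BoundedFormula.realize_ex, BoundedFormula.realize_inf, BoundedFormula.realize_sup, BoundedFormula.realize_not, BoundedFormula.realize_imp, BoundedFormula.realize_iff, Fin.snoc_castSucc, Fin.snoc_last, ne_eq]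

theorem transfer (M : Type (u+1)) [memLang.Structure M] [Infinite M] (h1 : ZFCTheory.Model M) (h2 : Concl (mE M)) :
    ∃ (V : Type) (str : memLang.Structure V), ZFCTheory.Model V ∧ Concl (mE V) := by
  obtain ⟨N, hN, -⟩ := FirstOrder.Language.exists_elementarilyEquivalent_card_eq memLang M
    Cardinal.aleph0.{0} le_rfl (by
      have : memLang.card ≤ Cardinal.aleph0 := by
        have e1 : ∀ n, Countable (memLang.Functions n) := fun n =>
          inferInstanceAs (Countable Empty)
        have e2 : ∀ n, Countable (memLang.Relations n) := by
          intro n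
          match n with
          | 0 => exact inferInstanceAs (Countable Empty)
          | 1 => exact inferInstanceAs (Countable Empty)
          | 2 => exact inferInstanceAs (Countable PUnit)
          | (n + 3) => exact inferInstanceAs (Countable Empty)
        have e3 : Countable memLang.Symbols := inferInstanceAs (Countable (_ ⊕ _))
        exact Cardinal.mk_le_aleph0
      simpa using this)
  refine ⟨N, N.str, ?_, ?_⟩
  · exact hN.theory_model_iff.1 h1
  · have e1 : M ⊨ (fConcl (n := 0) : memLang.Sentence) :=
      (rConcl (V := M) (n := 0) default default).2 h2
    have e2 := (hN.realize_sentence _).1 e1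
    exact (rConcl (V := N) (n := 0) default default).1 e2

theorem mo_infinite (U : Ult B) : Infinite (Mo U) := by
  refine Infinite.of_injective (fun n : ℕ => cl U (ordn (n : Ordinal.{u}))) ?_
  have key : ∀ m n : ℕ, m < n → cl U (ordn (m : Ordinal.{u})) ≠ cl U (ordn (n : Ordinal.{u})) := by
    intro m n h he
    have h1 : El U (cl U (ordn (m : Ordinal.{u}))) (cl U (ordn (n : Ordinal.{u}))) :=
      mem_ordn U (by exact_mod_cast h)
    rw [← he] at h1
    exact found (fun U v => ¬ El U v v) U (fun v ih hv => ih v hv hv) _ h1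
  intro m n h
  by_contra hne
  rcases lt_or_gt_of_ne hne with h' | h'
  · exact key _ _ h' h
  · exact key _ _ h' h.symm

theorem transfer_mo (U : Ult B) (h : Concl (El U)) :
    ∃ (V : Type) (str : memLang.Structure V), ZFCTheory.Model V ∧ Concl (memE V str) :=
  haveI := mo_infinite U
  transfer (Mo U) (mo_zfc U) h

end Deep

end JK

namespace JK
open FirstOrder FirstOrder.Language

/-! ### Elementary set theory inside the models -/

universe u
variable {B : Type u} [CompleteBooleanAlgebra B]

theorem irrefl (U : Ult B) (v : Mo U) : ¬ El U v v :=
  found (fun U v => ¬ El U v v) U (fun v ih hv => ih v hv hv) v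

theorem asymm (U : Ult B) (v w : Mo U) : El U v w → ¬ El U w v := by
  revert w
  exact found (fun U v => ∀ w, El U v w → ¬ El U w v) U
    (fun v ih w hv hw => ih w hw v hw hv) v

theorem acyc3 (U : Ult B) (v w z : Mo U) : El U v w → El U w z → ¬ El U z v := by
  revert w z
  exact found (fun U v => ∀ w z, El U v w → El U w z → ¬ El U z v) U
    (fun v ih w z hv hw hz => ih z hz v w hz hv hw) v

noncomputable def upn (x y : Nm B) : Nm B := Classical.choose (pairing x y)
theorem upn_spec (x y : Nm B) (U : Ult B) :
    IsUPairOf (El U) (cl U (upn x y)) (cl U x) (cl U y) :=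
  Classical.choose_spec (pairing x y) U

/-- ordered pair of names -/
noncomputable def opn (x y : Nm B) : Nm B := upn (upn x x) (upn x y)
theorem opn_spec (x y : Nm B) (U : Ult B) :
    IsOPairOf (El U) (cl U (opn x y)) (cl U x) (cl U y) := by
  refine ⟨cl U (upn x x), cl U (upn x y), ?_, upn_spec x y U, upn_spec _ _ U⟩
  intro z
  rw [upn_spec x x U z]
  exact or_self_iff

theorem opair_unique (U : Ult B) {p q a b : Mo U} (h : IsOPairOf (El U) p a b)
    (h' : IsOPairOf (El U) q a b) : p = q := by
  obtain ⟨s, w, h1, h2, h3⟩ := h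
  obtain ⟨s', w', h1', h2', h3'⟩ := h'
  have e1 : s = s' := nm_ext U _ _ fun z => by rw [h1 z, h1' z]
  have e2 : w = w' := nm_ext U _ _ fun z => by rw [h2 z, h2' z]
  subst e1 e2
  exact nm_ext U _ _ fun z => by rw [h3 z, h3' z]

theorem opair_inj (U : Ult B) {p a b c d : Mo U} (h : IsOPairOf (El U) p a b)
    (h' : IsOPairOf (El U) p c d) : a = c ∧ b = d := by
  obtain ⟨s, w, h1, h2, h3⟩ := h
  obtain ⟨s', w', h1', h2', h3'⟩ := h'
  have hs : s = s' ∨ s = w' := (h3' s).1 ((h3 s).2 (Or.inl rfl))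
  have hw : w = s' ∨ w = w' := (h3' w).1 ((h3 w).2 (Or.inr rfl))
  have hs' : s' = s ∨ s' = w := (h3 s').1 ((h3' s').2 (Or.inl rfl))
  have hw' : w' = s ∨ w' = w := (h3 w').1 ((h3' w').2 (Or.inr rfl))
  have hac : a = c := by
    rcases hs with e | e
    · subst e
      exact (h1' a).1 ((h1 a).2 rfl)
    · subst e
      exact ((h1 c).1 ((h2' c).2 (Or.inl rfl))).symm
  subst hac
  refine ⟨rfl, ?_⟩
  have hb : b = a ∨ b = d := by
    rcases hw with e | e
    · subst e
      exact Or.inl ((h1' b).1 ((h2 b).2 (Or.inr rfl)))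
    · subst e
      exact (h2' b).1 ((h2 b).2 (Or.inr rfl))
  have hd : d = a ∨ d = b := by
    rcases hw' with e | e
    · subst e
      exact Or.inl ((h1 d).1 ((h2' d).2 (Or.inr rfl)))
    · subst e
      exact (h2 d).1 ((h2' d).2 (Or.inr rfl))
  rcases hb with rfl | hb
  · rcases hd with rfl | hd
    · rfl
    · exact hd.symm
  · exact hb

theorem opn_inj (U : Ult B) {x y x' y' : Nm B} (h : cl U (opn x y) = cl U (opn x' y')) :
    cl U x = cl U x' ∧ cl U y = cl U y' := by
  have h1 := opn_spec x y U
  rw [h] at h1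
  exact opair_inj U h1 (opn_spec x' y' U)

theorem graph (a b : Nm B) (R : ∀ U : Ult B, Mo U → Mo U → Prop)
    [∀ x y, Clp (fun U => R U (cl U x) (cl U y))] :
    ∃ f, ∀ U, (∀ x y, FunVal (El U) (cl U f) x y ↔ El U x (cl U a) ∧ El U y (cl U b) ∧ R U x y) ∧
      ∀ p, El U p (cl U f) → ∃ x y, IsOPairOf (El U) p x y := by
  let g : a.idx × b.idx → Nm B := fun i => opn (a.fn i.1) (b.fn i.2)
  let P : Nm B := ⟨a.idx × b.idx, g, fun _ => ⊤⟩
  have hP : ∀ U x y p, El U x (cl U a) → El U y (cl U b) → IsOPairOf (El U) p x y →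
      El U p (cl U P) := by
    intro U x y p hx hy
    rw [← a.eta] at hx
    refine ball' a.fn a.vl (fun U x => ∀ y, El U y (cl U b) → ∀ p, IsOPairOf (El U) p x y →
      El U p (cl U P)) (fun i U _ y hy => ?_) U x hx y hy p
    rw [← b.eta] at hy
    refine ball' b.fn b.vl (fun U y => ∀ p, IsOPairOf (El U) p (cl U (a.fn i)) y →
      El U p (cl U P)) (fun j U _ p hp => ?_) U y hy
    rw [opair_unique U hp (opn_spec _ _ U)]
    exact El_mk U g _ (i, j) U.top_mem
  obtain ⟨f, hf⟩ := sep P (fun U p => ∃ x y, IsOPairOf (El U) p x y ∧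
    El U x (cl U a) ∧ El U y (cl U b) ∧ R U x y)
  refine ⟨f, fun U => ⟨fun x y => ⟨?_, ?_⟩, ?_⟩⟩
  · rintro ⟨p, hp, hxy⟩
    obtain ⟨-, x', y', h1, h2⟩ := (hf U p).1 hp
    obtain ⟨rfl, rfl⟩ := opair_inj U h1 hxy
    exact h2
  · rintro ⟨h1, h2, h3⟩
    obtain ⟨x, rfl⟩ := cl_surj U x
    obtain ⟨y, rfl⟩ := cl_surj U y
    refine ⟨_, (hf U _).2 ⟨hP U _ _ _ h1 h2 (opn_spec x y U), _, _, opn_spec x y U, h1, h2, h3⟩,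
      opn_spec x y U⟩
  · intro p hp
    obtain ⟨-, x', y', h1, -⟩ := (hf U p).1 hp
    exact ⟨x', y', h1⟩

theorem func_of_rel (a b : Nm B) (R : ∀ U : Ult B, Mo U → Mo U → Prop)
    [∀ x y, Clp (fun U => R U (cl U x) (cl U y))] (U : Ult B)
    (h1 : ∀ x, El U x (cl U a) → ∃ y, El U y (cl U b) ∧ R U x y)
    (h2 : ∀ x y y', El U x (cl U a) → El U y (cl U b) → El U y' (cl U b) →
      R U x y → R U x y' → y = y') :
    ∃ f, IsFuncInto (El U) f (cl U a) (cl U b) ∧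
      ∀ x y, FunVal (El U) f x y ↔ El U x (cl U a) ∧ El U y (cl U b) ∧ R U x y := by
  obtain ⟨f, hf⟩ := graph a b R
  obtain ⟨hf1, hf2⟩ := hf U
  refine ⟨cl U f, ⟨⟨hf2, ?_, ?_⟩, ?_⟩, hf1⟩
  · intro x y y' e1 e2
    rw [hf1] at e1 e2
    exact h2 x y y' e1.1 e1.2.1 e2.2.1 e1.2.2 e2.2.2
  · intro x
    constructor
    · rintro ⟨y, hy⟩
      exact ((hf1 _ _).1 hy).1
    · intro hx
      obtain ⟨y, hy, hR⟩ := h1 x hx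
      exact ⟨y, (hf1 _ _).2 ⟨hx, hy, hR⟩⟩
  · intro x y hxy
    exact ((hf1 _ _).1 hxy).2.1

theorem inj_of_rel (a b : Nm B) (R : ∀ U : Ult B, Mo U → Mo U → Prop)
    [∀ x y, Clp (fun U => R U (cl U x) (cl U y))] (U : Ult B)
    (h1 : ∀ x, El U x (cl U a) → ∃ y, El U y (cl U b) ∧ R U x y)
    (h2 : ∀ x y y', El U x (cl U a) → El U y (cl U b) → El U y' (cl U b) →
      R U x y → R U x y' → y = y')
    (h3 : ∀ x x' y, El U x (cl U a) → El U x' (cl U a) → El U y (cl U b) →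
      R U x y → R U x' y → x = x') :
    InjInto (El U) (cl U a) (cl U b) := by
  obtain ⟨f, hf1, hf2⟩ := func_of_rel a b R U h1 h2
  refine ⟨f, hf1, fun x x' y e1 e2 => ?_⟩
  rw [hf2] at e1 e2
  exact h3 x x' y e1.1 e2.1 e1.2.1 e1.2.2 e2.2.2

/-- If the target is an ordinal, functionality is not needed. -/
theorem inj_of_rel_ord (a b : Nm B) (R : ∀ U : Ult B, Mo U → Mo U → Prop)
    [∀ x y, Clp (fun U => R U (cl U x) (cl U y))] (U : Ult B) (hb : IsOrdV (El U) (cl U b))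
    (h1 : ∀ x, El U x (cl U a) → ∃ y, El U y (cl U b) ∧ R U x y)
    (h3 : ∀ x x' y, El U x (cl U a) → El U x' (cl U a) → El U y (cl U b) →
      R U x y → R U x' y → x = x') :
    InjInto (El U) (cl U a) (cl U b) := by
  refine inj_of_rel a b (fun U x y => R U x y ∧ ∀ z, El U z y → ¬ R U x z) U ?_ ?_ ?_
  · intro x hx
    by_contra hc
    obtain ⟨y, hy, hR⟩ := h1 x hx
    obtain ⟨x, rfl⟩ := cl_surj U x
    refine found (fun U y => El U y (cl U b) → ¬ R U (cl U x) y) U (fun y ih hy hR => ?_) y hy hR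
    refine hc ⟨y, hy, hR, fun z hz => ih z hz (hb.1 y hy z hz)⟩
  · intro x y y' _ hy hy' e1 e2
    rcases hb.2 y y' hy hy' with h | h | h
    · exact absurd e1.1 (e2.2 y h)
    · exact h
    · exact absurd e2.1 (e1.2 y' h)
  · intro x x' y hx hx' hy e1 e2
    exact h3 x x' y hx hx' hy e1.1 e2.1

theorem inj_of_sub (U : Ult B) {a b : Mo U} (h : SubV (El U) a b) : InjInto (El U) a b := by
  obtain ⟨a, rfl⟩ := cl_surj U a
  obtain ⟨b, rfl⟩ := cl_surj U b
  refine inj_of_rel a b (fun U x y => x = y) U (fun x hx => ⟨x, h x hx, rfl⟩) ?_ ?_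
  · rintro x y y' _ _ _ rfl rfl; rfl
  · rintro x y y' _ _ _ rfl rfl; rfl

theorem func_val (U : Ult B) {f a b : Mo U} (h : IsFuncInto (El U) f a b) {x : Mo U}
    (hx : El U x a) : ∃ y, El U y b ∧ FunVal (El U) f x y := by
  obtain ⟨y, hy⟩ := (h.1.2.2 x).2 hx
  exact ⟨y, h.2 x y hy, hy⟩

theorem inj_trans (U : Ult B) {a b c : Mo U} (h : InjInto (El U) a b) (h' : InjInto (El U) b c) :
    InjInto (El U) a c := by
  obtain ⟨f, hf, hf'⟩ := h
  obtain ⟨g, hg, hg'⟩ := h'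
  obtain ⟨a, rfl⟩ := cl_surj U a
  obtain ⟨b, rfl⟩ := cl_surj U b
  obtain ⟨c, rfl⟩ := cl_surj U c
  obtain ⟨f, rfl⟩ := cl_surj U f
  obtain ⟨g, rfl⟩ := cl_surj U g
  refine inj_of_rel a c (fun U x z => ∃ y, FunVal (El U) (cl U f) x y ∧
    FunVal (El U) (cl U g) y z) U ?_ ?_ ?_
  · intro x hx
    obtain ⟨y, hy, hxy⟩ := func_val U hf hx
    obtain ⟨z, hz, hyz⟩ := func_val U hg hy
    exact ⟨z, hz, y, hxy, hyz⟩
  · rintro x z z' _ _ _ ⟨y, h1, h2⟩ ⟨y', h1', h2'⟩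
    obtain rfl := hf.1.2.1 x y y' h1 h1'
    exact hg.1.2.1 y z z' h2 h2'
  · rintro x x' z _ _ _ ⟨y, h1, h2⟩ ⟨y', h1', h2'⟩
    obtain rfl := hg' y y' z h2 h2'
    exact hf' x x' y h1 h1'

theorem inj_of_equinum (U : Ult B) {a b : Mo U} (h : EquinumV (El U) a b) : InjInto (El U) a b := by
  obtain ⟨f, h1, h2, -⟩ := h
  exact ⟨f, h1, h2⟩

theorem inj_of_equinum' (U : Ult B) {a b : Mo U} (h : EquinumV (El U) a b) :
    InjInto (El U) b a := by
  obtain ⟨f, h1, h2, h3⟩ := h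
  obtain ⟨a, rfl⟩ := cl_surj U a
  obtain ⟨b, rfl⟩ := cl_surj U b
  obtain ⟨f, rfl⟩ := cl_surj U f
  refine inj_of_rel b a (fun U x y => FunVal (El U) (cl U f) y x) U ?_ ?_ ?_
  · intro y hy
    obtain ⟨x, hx⟩ := h3 y hy
    exact ⟨x, (h1.1.2.2 x).1 ⟨y, hx⟩, hx⟩
  · intro x y y' _ _ _ e1 e2
    exact h2 _ _ _ e1 e2
  · intro x x' y _ _ _ e1 e2
    exact h1.1.2.1 _ _ _ e1 e2

/-- Cantor-Bernstein. -/
theorem cantor_bernstein (U : Ult B) {a b : Mo U} (h : InjInto (El U) a b)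
    (h' : InjInto (El U) b a) : EquinumV (El U) a b := by
  obtain ⟨f, hf, hf'⟩ := h
  obtain ⟨g, hg, hg'⟩ := h'
  obtain ⟨a, rfl⟩ := cl_surj U a
  obtain ⟨b, rfl⟩ := cl_surj U b
  obtain ⟨f, rfl⟩ := cl_surj U f
  obtain ⟨g, rfl⟩ := cl_surj U g
  -- `S` : the union of all `Y ⊆ a` with `Y ⊆ a \ g[b \ f[Y]]`
  obtain ⟨C, hC⟩ := sep a (fun U x => ∃ Y, El U x Y ∧ ∀ x, El U x Y →
    El U x (cl U a) ∧ ∀ y, El U y (cl U b) → FunVal (El U) (cl U g) y x →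
      ∃ x', El U x' Y ∧ FunVal (El U) (cl U f) x' y)
  have hC1 : ∀ x, El U x (cl U C) → ∀ y, El U y (cl U b) → FunVal (El U) (cl U g) y x →
      ∃ x', El U x' (cl U C) ∧ FunVal (El U) (cl U f) x' y := by
    intro x hx y hy hyx
    obtain ⟨hxa, Y, hxY, hY⟩ := (hC U x).1 hx
    obtain ⟨x', hx', hx'y⟩ := (hY x hxY).2 y hy hyx
    exact ⟨x', (hC U x').2 ⟨(hY x' hx').1, Y, hx', hY⟩, hx'y⟩
  have hC2 : ∀ x, El U x (cl U a) → (∀ y, El U y (cl U b) → FunVal (El U) (cl U g) y x →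
      ∃ x', El U x' (cl U C) ∧ FunVal (El U) (cl U f) x' y) → El U x (cl U C) := by
    intro x hx hx2
    obtain ⟨x, rfl⟩ := cl_surj U x
    obtain ⟨Y, hY⟩ := sep a (fun U z => El U z (cl U C) ∨ z = cl U x)
    rw [hC]
    refine ⟨hx, cl U Y, (hY U _).2 ⟨hx, Or.inr rfl⟩, ?_⟩
    intro z hz
    obtain ⟨hza, hz⟩ := (hY U z).1 hz
    refine ⟨hza, fun y hy hyz => ?_⟩
    have : ∃ x', El U x' (cl U C) ∧ FunVal (El U) (cl U f) x' y := by
      rcases hz with hz | rfl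
      · exact hC1 z hz y hy hyz
      · exact hx2 y hy hyz
    obtain ⟨x', hx', e⟩ := this
    exact ⟨x', (hY U _).2 ⟨((hC U x').1 hx').1, Or.inl hx'⟩, e⟩
  obtain ⟨k, hk1, hk2⟩ := func_of_rel a b (fun U x y =>
    (El U x (cl U C) ∧ FunVal (El U) (cl U f) x y) ∨
    (¬ El U x (cl U C) ∧ FunVal (El U) (cl U g) y x)) U (by
      intro x hx
      by_cases hxC : El U x (cl U C)
      · obtain ⟨y, hy, hxy⟩ := func_val U hf hx
        exact ⟨y, hy, Or.inl ⟨hxC, hxy⟩⟩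
      · by_contra hc
        refine hxC (hC2 x hx fun y hy hyx => ?_)
        exact absurd ⟨y, hy, Or.inr ⟨hxC, hyx⟩⟩ hc) (by
      rintro x y y' _ _ _ (⟨e1, e2⟩ | ⟨e1, e2⟩) (⟨e3, e4⟩ | ⟨e3, e4⟩)
      · exact hf.1.2.1 _ _ _ e2 e4
      · exact absurd e1 e3
      · exact absurd e3 e1
      · exact hg' _ _ _ e2 e4)
  refine ⟨k, hk1, ?_, ?_⟩
  · intro x x' y e1 e2
    rw [hk2] at e1 e2
    obtain ⟨hx, hy, e1⟩ := e1
    obtain ⟨hx', -, e2⟩ := e2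
    rcases e1 with ⟨c1, d1⟩ | ⟨c1, d1⟩ <;> rcases e2 with ⟨c2, d2⟩ | ⟨c2, d2⟩
    · exact hf' _ _ _ d1 d2
    · refine absurd (hC2 x' hx' fun y' hy' e => ?_) c2
      obtain rfl := hg' _ _ _ d2 e
      exact ⟨x, c1, d1⟩
    · refine absurd (hC2 x hx fun y' hy' e => ?_) c1
      obtain rfl := hg' _ _ _ d1 e
      exact ⟨x', c2, d2⟩
    · exact hg.1.2.1 _ _ _ d1 d2
  · intro y hy
    by_cases hc : ∃ x, El U x (cl U C) ∧ FunVal (El U) (cl U f) x y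
    · obtain ⟨x, hx, hxy⟩ := hc
      exact ⟨x, (hk2 _ _).2 ⟨((hC U x).1 hx).1, hy, Or.inl ⟨hx, hxy⟩⟩⟩
    · obtain ⟨x, hx, hyx⟩ := func_val U hg hy
      refine ⟨x, (hk2 _ _).2 ⟨hx, hy, Or.inr ⟨fun hxC => hc ?_, hyx⟩⟩⟩
      exact hC1 x hxC y hy hyx

/-! ordinals -/

theorem ord_of_mem (U : Ult B) {x y : Mo U} (hx : IsOrdV (El U) x) (hy : El U y x) :
    IsOrdV (El U) y := by
  have h1 := hx.1 y hy
  refine ⟨fun w hw z hz => ?_, fun z w hz hw => hx.2 z w (h1 z hz) (h1 w hw)⟩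
  rcases hx.2 z y (hx.1 w (h1 w hw) z hz) hy with h | h | h
  · exact h
  · subst h
    exact absurd hz (asymm U _ _ hw)
  · exact absurd h (acyc3 U _ _ _ hz hw)

theorem ord_trich (U : Ult B) (x y : Mo U) (hx : IsOrdV (El U) x) (hy : IsOrdV (El U) y) :
    El U x y ∨ x = y ∨ El U y x := by
  revert hy y
  refine found (fun U x => IsOrdV (El U) x → ∀ y, IsOrdV (El U) y → 
    El U x y ∨ x = y ∨ El U y x) U (fun x ih hx y => ?_) x hx
  obtain ⟨x, rfl⟩ := cl_surj U x
  refine found (fun U y => IsOrdV (El U) y → 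
    El U (cl U x) y ∨ (cl U x) = y ∨ El U y (cl U x)) U (fun y ih2 hy => ?_) y
  by_contra hc
  push Not at hc
  refine hc.2.1 (nm_ext U _ _ fun z => ⟨fun hz => ?_, fun hz => ?_⟩)
  · rcases ih z hz (ord_of_mem U hx hz) y hy with h | h | h
    · exact h
    · subst h; exact absurd hz hc.2.2
    · exact absurd (hx.1 z hz y h) hc.2.2
  · rcases ih2 z hz (ord_of_mem U hy hz) with h | h | h
    · exact absurd (hy.1 z hz _ h) hc.1
    · subst h; exact absurd hz hc.1
    · exact h

theorem ord_ordn (U : Ult B) (α : Ordinal.{u}) : IsOrdV (El U) (cl U (ordn α)) := by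
  refine ⟨?_, ?_⟩
  · intro y hy
    refine ball_ord' α (fun U y => SubV (El U) y (cl U (ordn α))) (fun β hβ U => ?_) U y hy
    intro z hz
    exact ball_ord' β (fun U z => El U z (cl U (ordn α))) (fun γ hγ U => mem_ordn U (hγ.trans hβ))
      U z hz
  · intro y z hy hz
    refine ball_ord' α (fun U y => ∀ z, El U z (cl U (ordn α)) → El U y z ∨ y = z ∨ El U z y)
      (fun β hβ U z hz => ?_) U y hy z hz
    refine ball_ord' α (fun U z => El U (cl U (ordn β)) z ∨ (cl U (ordn β)) = z ∨
      El U z (cl U (ordn β))) (fun γ hγ U => ?_) U z hz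
    rcases lt_trichotomy β γ with h | h | h
    · exact Or.inl (mem_ordn U h)
    · rw [h]; exact Or.inr (Or.inl rfl)
    · exact Or.inr (Or.inr (mem_ordn U h))

theorem ordn_inj (U : Ult B) {α β : Ordinal.{u}} (h : cl U (ordn α) = cl U (ordn β)) : α = β := by
  rcases lt_trichotomy α β with h' | h' | h'
  · have := mem_ordn U h'
    rw [h] at this
    exact absurd this (irrefl U _)
  · exact h'
  · have := mem_ordn U h'
    rw [h] at this
    exact absurd this (irrefl U _)

theorem mem_ordn_iff (U : Ult B) {α β : Ordinal.{u}} :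
    El U (cl U (ordn α)) (cl U (ordn β)) ↔ α < β := by
  refine ⟨fun h => ?_, mem_ordn U⟩
  rcases lt_trichotomy α β with h' | h' | h'
  · exact h'
  · rw [h'] at h; exact absurd h (irrefl U _)
  · exact absurd (mem_ordn U h') (asymm U _ _ h)

/-! families indexed by ground model ordinals -/

noncomputable def fam {J : Type u} (e : J → Ordinal.{u}) (τ : J → Nm B) : Nm B :=
  ⟨J, fun j => opn (ordn (e j)) (τ j), fun _ => ⊤⟩

theorem fam_val {J : Type u} (e : J → Ordinal.{u}) (τ : J → Nm B) (j : J) (U : Ult B) :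
    FunVal (El U) (cl U (fam e τ)) (cl U (ordn (e j))) (cl U (τ j)) :=
  ⟨_, El_mk U (fun j => opn (ordn (e j)) (τ j)) (fun _ => ⊤) j U.top_mem, opn_spec _ _ U⟩

theorem fam_ball {J : Type u} (e : J → Ordinal.{u}) (τ : J → Nm B) (p : B)
    (R : ∀ U : Ult B, Mo U → Mo U → Prop) [∀ x y, Clp (fun U => R U (cl U x) (cl U y))]
    (h : ∀ j U, p ∈ U.s → R U (cl U (ordn (e j))) (cl U (τ j))) (U : Ult B) (hp : p ∈ U.s)
    (x y : Mo U) (hxy : FunVal (El U) (cl U (fam e τ)) x y) : R U x y := by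
  obtain ⟨q, hq, hxy⟩ := hxy
  refine ball (fun j => opn (ordn (e j)) (τ j)) (fun _ => ⊤) p (fun U q => ∀ x y,
    IsOPairOf (El U) q x y → R U x y) (fun j U hp _ x y hxy => ?_) U hp q hq x y hxy
  obtain ⟨rfl, rfl⟩ := opair_inj U hxy (opn_spec _ _ U)
  exact h j U hp

theorem fam_functional {J : Type u} (e : J → Ordinal.{u}) (he : Function.Injective e)
    (τ : J → Nm B) (U : Ult B) (x y y' : Mo U) (h1 : FunVal (El U) (cl U (fam e τ)) x y)
    (h2 : FunVal (El U) (cl U (fam e τ)) x y') : y = y' := by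
  refine fam_ball e τ ⊤ (fun U x y => ∀ y', FunVal (El U) (cl U (fam e τ)) x y' → y = y')
    (fun j U _ y' h2 => ?_) U U.top_mem x y h1 y' h2
  refine fam_ball e τ ⊤ (fun U x y' => cl U (ordn (e j)) = x → cl U (τ j) = y')
    (fun j' U _ hx => ?_) U U.top_mem _ y' h2 rfl
  rw [he (ordn_inj U hx)]

theorem fam_pair {J : Type u} (e : J → Ordinal.{u}) (τ : J → Nm B) (U : Ult B) (q : Mo U)
    (hq : El U q (cl U (fam e τ))) : ∃ x y, IsOPairOf (El U) q x y :=
  ball' (fun j => opn (ordn (e j)) (τ j)) (fun _ => ⊤) (fun U q => ∃ x y, IsOPairOf (El U) q x y)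
    (fun _ U _ => ⟨_, _, opn_spec _ _ U⟩) U q hq

theorem fam_func (γ : Ordinal.{u}) (τ : γ.ToType → Nm B) (U : Ult B) :
    IsFuncOn (El U) (cl U (fam (fun i => Ordinal.typein (α := γ.ToType) (· < ·) i) τ))
      (cl U (ordn γ)) := by
  refine ⟨fam_pair _ _ U, fam_functional _ (Ordinal.typein_injective _) τ U, fun x => ⟨?_, ?_⟩⟩
  · rintro ⟨y, hy⟩
    exact fam_ball _ τ ⊤ (fun U x y => El U x (cl U (ordn γ)))
      (fun j U _ => mem_ordn U (Ordinal.typein_lt_self j)) U U.top_mem x y hy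
  · intro hx
    refine ball_ord' γ (fun U x => ∃ y, FunVal (El U) (cl U (fam (fun i =>
      Ordinal.typein (α := γ.ToType) (· < ·) i) τ)) x y) (fun β hβ U => ?_) U x hx
    have h1 : β < Ordinal.type (α := γ.ToType) (· < ·) := by simpa using hβ
    have h2 := Ordinal.typein_enum (α := γ.ToType) (· < ·) h1
    have h3 := fam_val (fun i => Ordinal.typein (α := γ.ToType) (· < ·) i) τ
      (Ordinal.enum (α := γ.ToType) (· < ·) ⟨β, h1⟩) U
    rw [h2] at h3
    exact ⟨_, h3⟩

/-- Lemma A -/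
theorem inj_of_cover {J : Type u} (e : J → Ordinal.{u}) (he : Function.Injective e)
    (γ : Ordinal.{u}) (hγ : ∀ j, e j < γ) (τ : J → Nm B) (U : Ult B) (a : Mo U)
    (ha : ∀ v, El U v a → El U v (cl U ⟨J, τ, fun _ => ⊤⟩)) :
    InjInto (El U) a (cl U (ordn γ)) := by
  obtain ⟨a, rfl⟩ := cl_surj U a
  refine inj_of_rel_ord a (ordn γ) (fun U x y => FunVal (El U) (cl U (fam e τ)) y x) U
    (ord_ordn U γ) ?_ ?_
  · intro x hx
    refine ball' τ (fun _ => ⊤) (fun U x => ∃ y, El U y (cl U (ordn γ)) ∧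
      FunVal (El U) (cl U (fam e τ)) y x) (fun j U _ => ?_) U x (ha x hx)
    exact ⟨_, mem_ordn U (hγ j), fam_val e τ j U⟩
  · intro x x' y _ _ _ h1 h2
    exact fam_functional e he τ U y x x' h1 h2

theorem inj_of_cover_card {J : Type u} (τ : J → Nm B) (U : Ult B) (a : Mo U)
    (ha : ∀ v, El U v a → El U v (cl U ⟨J, τ, fun _ => ⊤⟩)) :
    InjInto (El U) a (cl U (ordn (Cardinal.mk J).ord)) := by
  have h1 : Cardinal.mk J = Cardinal.mk (Cardinal.mk J).ord.ToType := by simp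
  obtain ⟨i⟩ := Cardinal.eq.1 h1
  refine inj_of_cover (fun j => Ordinal.typein (α := (Cardinal.mk J).ord.ToType) (· < ·) (i j))
    (fun j j' h => i.injective (Ordinal.typein_injective _ h)) _
    (fun j => Ordinal.typein_lt_self _) τ U a ha

/-- Lemma B -/
theorem inj_of_distinct (γ : Ordinal.{u}) (τ : γ.ToType → Nm B) (U : Ult B) (a : Mo U)
    (ha : ∀ v, El U v (cl U ⟨γ.ToType, τ, fun _ => ⊤⟩) → El U v a)
    (hd : ∀ i j, i ≠ j → ∀ U : Ult B, cl U (τ i) ≠ cl U (τ j)) :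
    InjInto (El U) (cl U (ordn γ)) a := by
  set F : Nm B := fam (fun i => Ordinal.typein (α := γ.ToType) (· < ·) i) τ with hF
  refine ⟨cl U F, ⟨fam_func γ τ U, fun x y hxy => ha _ ?_⟩, ?_⟩
  · exact fam_ball _ τ ⊤ (fun U x y => El U y (cl U ⟨γ.ToType, τ, fun _ => ⊤⟩))
      (fun j U _ => El_mk U τ _ j U.top_mem) U U.top_mem x y hxy
  · intro x x' y h1 h2
    refine fam_ball _ τ ⊤ (fun U x y => ∀ x', FunVal (El U) (cl U F) x' y → x = x')
      (fun j U _ x' h2 => ?_) U U.top_mem x y h1 x' h2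
    refine fam_ball _ τ ⊤ (fun U x' y => cl U (τ j) = y →
      cl U (ordn (Ordinal.typein (α := γ.ToType) (· < ·) j)) = x')
      (fun j' U _ he => ?_) U U.top_mem x' _ h2 rfl
    by_contra hc
    exact hd j j' (fun e => hc (by rw [e])) U he

theorem inj_ordn_ordn {α β : Ordinal.{u}} (h : α.card ≤ β.card) (U : Ult B) :
    InjInto (El U) (cl U (ordn α)) (cl U (ordn β)) := by
  have h1 : Cardinal.mk α.ToType ≤ Cardinal.mk β.ToType := by simpa using h
  obtain ⟨i⟩ := Cardinal.le_def _ _ |>.1 h1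
  refine inj_of_distinct α (fun j => ordn (Ordinal.typein (α := β.ToType) (· < ·) (i j))) U _ ?_ ?_
  · intro v hv
    exact ball' _ _ (fun U v => El U v (cl U (ordn β))) (fun j U _ =>
      mem_ordn U (Ordinal.typein_lt_self _)) U v hv
  · intro j j' hj U he
    exact hj (i.injective (Ordinal.typein_injective _ (ordn_inj U he)))

/-! omega -/

theorem limit_omega (U : Ult B) : IsOmegaV (El U) (cl U (ordn Ordinal.omega0)) := by
  refine ⟨⟨ord_ordn U _, ⟨_, mem_ordn U Ordinal.omega0_pos⟩, ?_⟩, ?_⟩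
  · intro y hy
    refine ball_ord' Ordinal.omega0 (fun U y => ∃ z, El U z (cl U (ordn Ordinal.omega0)) ∧
      El U y z) (fun β hβ U => ?_) U y hy
    exact ⟨_, mem_ordn U (Ordinal.isSuccLimit_omega0.succ_lt hβ), mem_ordn U (Order.lt_succ β)⟩
  · intro y hy
    refine ball_ord' Ordinal.omega0 (fun U y => ¬ IsLimitOrdV (El U) y) (fun β hβ U => ?_) U y hy
    rintro ⟨-, ⟨y, hy⟩, h2⟩
    obtain ⟨n, rfl⟩ := Ordinal.lt_omega0.1 hβ
    cases n with
    | zero =>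
      refine ball_ord' 0 (fun _ _ => False) (fun β hβ => absurd hβ not_lt_zero) U y ?_
      simpa using hy
    | succ n =>
      obtain ⟨z, hz1, hz2⟩ := h2 _ (mem_ordn U (show ((n : ℕ) : Ordinal.{u}) < ((n + 1 : ℕ) : Ordinal.{u})
        by exact_mod_cast Nat.lt_succ_self n))
      have e : ((n + 1 : ℕ) : Ordinal.{u}) = Order.succ ((n : ℕ) : Ordinal.{u}) := by
        simp
      rw [e, mem_ordn_succ] at hz1
      rcases hz1 with h | h
      · exact asymm U _ _ h hz2
      · rw [h] at hz2; exact irrefl U _ hz2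

theorem omega_unique (U : Ult B) {w : Mo U} (h : IsOmegaV (El U) w) :
    w = cl U (ordn Ordinal.omega0) := by
  have h' := limit_omega U
  rcases ord_trich U _ _ h.1.1 h'.1.1 with e | e | e
  · exact absurd h.1 (h'.2 _ e)
  · exact e
  · exact absurd h'.1 (h.2 _ e)

theorem omega1_unique (U : Ult B) {k k' : Mo U} (h : IsOmega1V (El U) k)
    (h' : IsOmega1V (El U) k') : k = k' := by
  rcases ord_trich U _ _ h.1 h'.1 with e | e | e
  · exact absurd (h'.2.2 _ e) h.2.1
  · exact e
  · exact absurd (h.2.2 _ e) h'.2.1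

end JK

namespace JK
open FirstOrder FirstOrder.Language
universe u

section RO
variable (P : Type u) [Preorder P]

/-- The regular open algebra of a preorder. -/
abbrev RO : Type u := Heyting.Regular (LowerSet P)

noncomputable instance roCBA : CompleteBooleanAlgebra (RO P) where
  __ := (inferInstance : BooleanAlgebra (RO P))
  sSup s := Heyting.Regular.toRegular (sSup ((fun a : RO P => (a : LowerSet P)) '' s))
  sInf s := Heyting.Regular.toRegular (sInf ((fun a : RO P => (a : LowerSet P)) '' s))
  isLUB_sSup s := by
    constructor
    · intro a ha
      rw [← Heyting.Regular.toRegular_coe a]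
      exact Heyting.Regular.toRegular.monotone (le_sSup ⟨a, ha, rfl⟩)
    · intro a ha
      rw [← Heyting.Regular.toRegular_coe a]
      apply Heyting.Regular.toRegular.monotone
      apply sSup_le
      rintro _ ⟨b, hb, rfl⟩
      exact ha hb
  isGLB_sInf s := by
    constructor
    · intro a ha
      rw [← Heyting.Regular.toRegular_coe a]
      exact Heyting.Regular.toRegular.monotone (sInf_le ⟨a, ha, rfl⟩)
    · intro a ha
      rw [← Heyting.Regular.toRegular_coe a]
      apply Heyting.Regular.toRegular.monotone
      apply le_sInf
      rintro _ ⟨b, hb, rfl⟩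
      exact ha hb

variable {P}

theorem mem_compl_lower (a : LowerSet P) (p : P) : p ∈ (aᶜ : LowerSet P) ↔ ∀ q ≤ p, q ∉ a := by
  rw [← LowerSet.Iic_le, le_compl_iff_disjoint_right, disjoint_iff_inf_le]
  constructor
  · intro h q hq hqa
    exact (h (show q ∈ LowerSet.Iic p ⊓ a from ⟨hq, hqa⟩)).elim
  · rintro h q ⟨hq, hqa⟩
    exact (h q hq hqa).elim

/-- lower set of conditions hereditarily satisfying `Q` -/
def lw (Q : P → Prop) : LowerSet P := ⟨{p | ∀ q ≤ p, Q q}, fun _ _ hba ha q hq => ha q (hq.trans hba)⟩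

/-- Boolean value of a property of conditions -/
noncomputable def val (Q : P → Prop) : RO P := Heyting.Regular.toRegular (lw Q)

noncomputable def io (p : P) : RO P := val (fun q => q ≤ p)

theorem mem_toReg (a : LowerSet P) (p : P) :
    p ∈ ((Heyting.Regular.toRegular a : RO P) : LowerSet P) ↔ ∀ q ≤ p, ∃ r ≤ q, r ∈ a := by
  rw [Heyting.Regular.coe_toRegular, mem_compl_lower]
  simp only [mem_compl_lower]
  push Not
  rfl

theorem mem_val (Q : P → Prop) (p : P) :
    p ∈ (val Q : LowerSet P) ↔ ∀ q ≤ p, ∃ r ≤ q, ∀ r' ≤ r, Q r' := mem_toReg _ _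

theorem mem_reg (b : RO P) (p : P) :
    p ∈ (b : LowerSet P) ↔ ∀ q ≤ p, ∃ r ≤ q, r ∈ (b : LowerSet P) := by
  conv_lhs => rw [← Heyting.Regular.toRegular_coe b]
  exact mem_toReg _ _

theorem io_le (b : RO P) (p : P) : io p ≤ b ↔ p ∈ (b : LowerSet P) := by
  constructor
  · intro h
    apply h
    change p ∈ ((val (fun q => q ≤ p) : RO P) : LowerSet P)
    rw [mem_val]
    intro q hq
    exact ⟨q, le_rfl, fun r hr => hr.trans hq⟩
  · intro h
    change ((io p : RO P) : LowerSet P) ≤ b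
    intro q hq
    change q ∈ ((val (fun q => q ≤ p) : RO P) : LowerSet P) at hq
    rw [mem_val] at hq
    refine (mem_reg b q).2 ?_
    intro r hr
    obtain ⟨r', hr', h2⟩ := hq r hr
    exact ⟨r', hr', (b : LowerSet P).lower (h2 r' le_rfl) h⟩

/-- Forcing. -/
def Fo (p : P) (φ : Ult (RO P) → Prop) : Prop := ∀ U, io p ∈ U.s → φ U

theorem fo_iff {φ : Ult (RO P) → Prop} {b : RO P} (h : ∀ U, φ U ↔ b ∈ U.s) (p : P) :
    Fo p φ ↔ p ∈ (b : LowerSet P) := by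
  rw [← io_le]
  constructor
  · intro h'
    exact le_of_ult fun U hU => (h U).1 (h' U hU)
  · intro h' U hU
    exact (h U).2 (U.mono h' hU)

theorem fo_mono {φ : Ult (RO P) → Prop} {p q : P} (hqp : q ≤ p) (h : Fo p φ) : Fo q φ := by
  intro U hU
  apply h U (U.mono _ hU)
  rw [io_le]
  change q ∈ ((val (fun q => q ≤ p) : RO P) : LowerSet P)
  rw [mem_val]
  exact fun r hr => ⟨r, le_rfl, fun r' hr' => hr'.trans (hr.trans hqp)⟩

theorem fo_imp {φ ψ : Ult (RO P) → Prop} {p : P} (h : Fo p φ) (h' : ∀ U, φ U → ψ U) : Fo p ψ :=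
  fun U hU => h' U (h U hU)

theorem fo_dense {φ : Ult (RO P) → Prop} [Clp φ] {p : P} (h : ∀ q ≤ p, ∃ r ≤ q, Fo r φ) : Fo p φ := by
  obtain ⟨b, hb⟩ := Clp.bval φ
  rw [fo_iff hb, mem_reg]
  intro q hq
  obtain ⟨r, hr, h2⟩ := h q hq
  exact ⟨r, hr, (fo_iff hb r).1 h2⟩

theorem fo_false {p : P} : ¬ Fo p (fun _ => False) := by
  intro h
  have hb : ∀ U : Ult (RO P), False ↔ (⊥ : RO P) ∈ U.s := fun U => ⟨False.elim, U.bot_nmem⟩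
  have h1 := (io_le _ _).2 ((fo_iff hb p).1 h)
  have h2 : p ∈ ((⊥ : RO P) : LowerSet P) := (io_le _ _).1 h1
  rw [Heyting.Regular.coe_bot] at h2
  exact h2

theorem fo_em (φ : Ult (RO P) → Prop) [Clp φ] (p : P) (h : ¬ Fo p φ) : ∃ q ≤ p, Fo q (fun U => ¬ φ U) := by
  by_contra h'
  push Not at h'
  apply h
  apply fo_dense
  intro q hq
  have h2 := h' q hq
  obtain ⟨b, hb⟩ := Clp.bval φ
  by_contra h3
  push Not at h3
  apply h2
  rw [fo_iff (b := bᶜ) (fun U => by rw [hb, U.compl_iff])]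
  rw [Heyting.Regular.coe_compl, mem_compl_lower]
  intro r hr hr2
  exact h3 r hr ((fo_iff hb r).2 hr2)

theorem fo_dec (φ : Ult (RO P) → Prop) [Clp φ] (p : P) :
    ∃ q ≤ p, Fo q φ ∨ Fo q (fun U => ¬ φ U) := by
  by_cases h : Fo p φ
  · exact ⟨p, le_rfl, Or.inl h⟩
  · obtain ⟨q, hq, h2⟩ := fo_em φ p h
    exact ⟨q, hq, Or.inr h2⟩

theorem fo_contra {φ : Ult (RO P) → Prop} {p : P} (h : Fo p φ) (h' : Fo p (fun U => ¬ φ U)) : False :=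
  fo_false fun U hU => h' U hU (h U hU)

theorem fo_val (Q : P → Prop) (p : P) :
    Fo p (fun U => val Q ∈ U.s) ↔ ∀ q ≤ p, ∃ r ≤ q, ∀ r' ≤ r, Q r' := by
  rw [fo_iff (b := val Q) (fun U => Iff.rfl), mem_val]

/-- every ultrafilter statement reduces to forcing -/
theorem all_of_fo (φ : Ult (RO P) → Prop) [Clp φ] (h : ∀ p : P, ∃ q ≤ p, Fo q φ) : ∀ U, φ U := by
  obtain ⟨b, hb⟩ := Clp.bval φ
  have h2 : ∀ p : P, p ∈ (b : LowerSet P) := by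
    intro p
    rw [mem_reg]
    intro q _
    obtain ⟨r, hr, h3⟩ := h q
    exact ⟨r, hr, (fo_iff hb r).1 h3⟩
  intro U
  rw [hb]
  refine U.mono ?_ U.top_mem
  change ((⊤ : RO P) : LowerSet P) ≤ b
  intro p _
  exact h2 p

theorem fo_exi (R : ∀ U : Ult (RO P), Mo U → Prop) [∀ x, Clp (fun U => R U (cl U x))] {p : P}
    (h : Fo p (fun U => ∃ v, R U v)) : ∃ τ, Fo p (fun U => R U (cl U τ)) := by
  obtain ⟨τ, hτ⟩ := max_principle R
  refine ⟨τ, fun U hU => ?_⟩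
  obtain ⟨v, hv⟩ := h U hU
  exact hτ U v hv

theorem fo_bex {ι : Type u} (f : ι → Nm (RO P)) (b : ι → RO P) (R : ∀ U : Ult (RO P), Mo U → Prop)
    [∀ x, Clp (fun U => R U (cl U x))] {p : P}
    (h : Fo p (fun U => ∃ v, El U v (cl U ⟨ι, f, b⟩) ∧ R U v)) :
    ∃ q ≤ p, ∃ i, Fo q (fun U => b i ∈ U.s) ∧ Fo q (fun U => R U (cl U (f i))) := by
  by_contra h'
  push Not at h'
  have key := ball f b (io p) (fun U v => ¬ R U v) (fun i => by
    have : Fo p (fun U => ¬ (b i ∈ U.s ∧ R U (cl U (f i)))) := by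
      by_contra h2
      obtain ⟨q, hq, h3⟩ := fo_em _ p h2
      exact h' q hq i (fo_imp h3 fun U hU => (not_not.1 hU).1) (fo_imp h3 fun U hU => (not_not.1 hU).2)
    intro U hU hb hR
    exact this U hU ⟨hb, hR⟩)
  refine fo_false (p := p) fun U hU => ?_
  obtain ⟨v, hv, hR⟩ := h U hU
  exact key U hU v hv hR

theorem fo_mem {ι : Type u} (f : ι → Nm (RO P)) (b : ι → RO P) {x : Nm (RO P)} {p : P}
    (h : Fo p (fun U => El U (cl U x) (cl U ⟨ι, f, b⟩))) :
    ∃ q ≤ p, ∃ i, Fo q (fun U => b i ∈ U.s) ∧ Fo q (fun U => cl U x = cl U (f i)) := by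
  apply fo_bex f b (fun U v => cl U x = v)
  intro U hU
  exact ⟨_, h U hU, rfl⟩

theorem fo_mem_ord {α : Ordinal.{u}} {x : Nm (RO P)} {p : P}
    (h : Fo p (fun U => El U (cl U x) (cl U (ordn α)))) :
    ∃ q ≤ p, ∃ β < α, Fo q (fun U => cl U x = cl U (ordn β)) := by
  rw [show (ordn α : Nm (RO P)) = _ from ordn.eq_1 α] at h
  obtain ⟨q, hq, i, -, h2⟩ := fo_mem _ _ h
  exact ⟨q, hq, _, Ordinal.typein_lt_self i, h2⟩

theorem fo_bex_ord {α : Ordinal.{u}} (R : ∀ U : Ult (RO P), Mo U → Prop)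
    [∀ x, Clp (fun U => R U (cl U x))] {p : P}
    (h : Fo p (fun U => ∃ v, El U v (cl U (ordn α)) ∧ R U v)) :
    ∃ q ≤ p, ∃ β < α, Fo q (fun U => R U (cl U (ordn β))) := by
  rw [show (ordn α : Nm (RO P)) = _ from ordn.eq_1 α] at h
  obtain ⟨q, hq, i, -, h2⟩ := fo_bex _ _ R h
  exact ⟨q, hq, _, Ordinal.typein_lt_self i, h2⟩

end RO
end JK

namespace JK
open FirstOrder FirstOrder.Language
universe u

/-- The ground model `ω₁`. -/
abbrev W : Type u := (Ordinal.omega.{u} 1).ToType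

theorem W_card : Cardinal.mk W.{u} = Cardinal.aleph 1 := by
  rw [Cardinal.mk_toType]; simp

theorem W_Iio (γ : W.{u}) : (Set.Iio γ).Countable := by
  have h := Cardinal.mk_Iio_lt γ (by
    rw [W_card, Cardinal.ord_aleph]
    exact (Ordinal.type_toType _).symm)
  rw [W_card] at h
  rw [← Cardinal.le_aleph0_iff_set_countable]
  rw [← Cardinal.succ_aleph0] at h
  exact Order.lt_succ_iff.1 h

theorem W_unc : ¬ (Set.univ : Set W.{u}).Countable := by
  rw [← Cardinal.le_aleph0_iff_set_countable, Cardinal.mk_univ, W_card, not_le]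
  exact Cardinal.aleph0_lt_aleph_one

theorem W_bdd (s : Set W.{u}) (hs : s.Countable) : ∃ δ, ∀ x ∈ s, x < δ := by
  by_contra h
  push Not at h
  apply W_unc
  have h2 : (⋃ x ∈ s, Set.Iic x).Countable := hs.biUnion fun x _ => by
    rw [← Set.Iio_insert]
    exact (W_Iio x).insert x
  refine h2.mono fun δ _ => ?_
  obtain ⟨x, hx, hx2⟩ := h δ
  exact Set.mem_biUnion hx hx2

theorem W_succ (γ : W.{u}) : ∃ δ, γ < δ := by
  obtain ⟨δ, h⟩ := W_bdd {γ} (Set.countable_singleton γ)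
  exact ⟨δ, h γ rfl⟩

instance W_nonempty : Nonempty W.{u} := by
  obtain ⟨δ, h⟩ := W_bdd ∅ Set.countable_empty
  exact ⟨δ⟩

/-- cofinal subsets of `γ` -/
def Cof (γ : W.{u}) (s : Set W.{u}) : Prop := (∃ β, β < γ) ∧ ∀ β < γ, ∃ ε ∈ s, β ≤ ε ∧ ε < γ

section Forcing
variable {Idx : Type u} (X : Idx → Type u) [∀ i, Inhabited (X i)] (al : Idx → Option W.{u})

structure Cond where
  δ : W.{u}
  S : Set Idx
  v : ∀ i, W.{u} → X i
  Z : W.{u} → W.{u} → Set W.{u} → Prop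
  hS : S.Countable
  hv1 : ∀ i, i ∉ S → ∀ ε, v i ε = default
  hv2 : ∀ i ε, δ ≤ ε → v i ε = default
  hZ : ∀ α γ s, Z α γ s → γ ≤ δ ∧ s ⊆ Set.Iio γ ∧ Cof γ s
  hav : ∀ i ∈ S, ∀ α, al i = some α → ∀ γ, ¬ Z α γ ({ε | v i ε ≠ default} ∩ Set.Iio γ)

variable {X al}

def bits (p : Cond X al) (i : Idx) : Set W.{u} := {ε | p.v i ε ≠ default}

instance : Preorder (Cond X al) where
  le q p := p.δ ≤ q.δ ∧ p.S ⊆ q.S ∧ (∀ i ∈ p.S, ∀ ε < p.δ, q.v i ε = p.v i ε) ∧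
    ∀ α γ s, γ ≤ p.δ → (q.Z α γ s ↔ p.Z α γ s)
  le_refl p := ⟨le_rfl, subset_rfl, fun _ _ _ _ => rfl, fun _ _ _ _ => Iff.rfl⟩
  le_trans r q p hrq hqp := ⟨hqp.1.trans hrq.1, hqp.2.1.trans hrq.2.1,
    fun i hi ε hε => (hrq.2.2.1 i (hqp.2.1 hi) ε (hε.trans_le hqp.1)).trans (hqp.2.2.1 i hi ε hε),
    fun α γ s h => (hrq.2.2.2 α γ s (h.trans hqp.1)).trans (hqp.2.2.2 α γ s h)⟩

theorem le_def {q p : Cond X al} : q ≤ p ↔ p.δ ≤ q.δ ∧ p.S ⊆ q.S ∧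
    (∀ i ∈ p.S, ∀ ε < p.δ, q.v i ε = p.v i ε) ∧
    ∀ α γ s, γ ≤ p.δ → (q.Z α γ s ↔ p.Z α γ s) := Iff.rfl

theorem not_cof {γ δ : W.{u}} {s : Set W.{u}} (h : δ < γ) (hs : s ⊆ Set.Iio δ) : ¬ Cof γ s := by
  rintro ⟨-, h2⟩
  obtain ⟨ε, hε, h3, h4⟩ := h2 δ h
  exact absurd (hs hε) (not_lt.2 h3)

theorem not_cof' {γ : W.{u}} {s : Set W.{u}} (hs : s = ∅) : ¬ Cof γ s := by
  rintro ⟨⟨β, hβ⟩, h2⟩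
  obtain ⟨ε, hε, h3, h4⟩ := h2 β hβ
  simp [hs] at hε

theorem bits_sub (p : Cond X al) (i : Idx) : bits p i ⊆ Set.Iio p.δ := by
  intro ε hε
  by_contra h
  exact hε (p.hv2 i ε (not_lt.1 h))

open Classical in
/-- general end-extension -/
noncomputable def extend (p : Cond X al) (T : Set Idx) (hT : T.Countable) (δ' : W.{u}) (hδ : p.δ ≤ δ')
    (f : ∀ i, W.{u} → X i) : Cond X al where
  δ := δ'
  S := p.S ∪ T
  v i ε := if ε < p.δ then p.v i ε else if i ∈ p.S ∪ T ∧ ε < δ' then f i ε else default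
  Z := p.Z
  hS := p.hS.union hT
  hv1 i hi ε := by
    split_ifs with h1 h2
    · exact p.hv1 i (fun h => hi (Or.inl h)) ε
    · exact (hi h2.1).elim
    · rfl
  hv2 i ε h := by
    rw [if_neg (not_lt.2 (hδ.trans h)), if_neg (fun h2 => not_lt.2 h h2.2)]
  hZ α γ s h := ⟨(p.hZ α γ s h).1.trans hδ, (p.hZ α γ s h).2⟩
  hav i hi α hα γ h := by
    have h1 := p.hZ _ _ _ h
    have h2 : {ε | (if ε < p.δ then p.v i ε else if i ∈ p.S ∪ T ∧ ε < δ' then f i ε else default) ≠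
        default} ∩ Set.Iio γ = bits p i ∩ Set.Iio γ := by
      ext ε
      constructor
      · rintro ⟨h3, h4⟩
        refine ⟨?_, h4⟩
        have : ε < p.δ := lt_of_lt_of_le h4 h1.1
        simpa [this, bits] using h3
      · rintro ⟨h3, h4⟩
        refine ⟨?_, h4⟩
        have : ε < p.δ := lt_of_lt_of_le h4 h1.1
        simpa [this, bits] using h3
    by_cases hi' : i ∈ p.S
    · exact p.hav i hi' α hα γ (by rw [h2] at h; exact h)
    · rw [h2] at h h1
      refine not_cof' (Set.eq_empty_of_forall_notMem ?_) h1.2.2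
      rintro ε ⟨h3, -⟩
      exact h3 (p.hv1 i hi' ε)

theorem extend_le (p : Cond X al) (T : Set Idx) (hT : T.Countable) (δ' : W.{u}) (hδ : p.δ ≤ δ')
    (f : ∀ i, W.{u} → X i) : extend p T hT δ' hδ f ≤ p :=
  ⟨hδ, Set.subset_union_left, fun i _ ε hε => if_pos hε, fun _ _ _ _ => Iff.rfl⟩

open Classical in
theorem extend_v (p : Cond X al) (T : Set Idx) (hT : T.Countable) (δ' : W.{u}) (hδ : p.δ ≤ δ')
    (f : ∀ i, W.{u} → X i) (i : Idx) (hi : i ∈ T) (ε : W.{u}) (h1 : p.δ ≤ ε) (h2 : ε < δ') :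
    (extend p T hT δ' hδ f).v i ε = f i ε := by
  show ite _ _ _ = _
  rw [if_neg (not_lt.2 h1), if_pos ⟨Or.inr hi, h2⟩]

open Classical in
/-- restriction to a set of coordinates -/
noncomputable def res (I : Set Idx) (p : Cond X al) : Cond X al where
  δ := p.δ
  S := p.S ∩ I
  v i ε := if i ∈ I then p.v i ε else default
  Z := p.Z
  hS := p.hS.mono Set.inter_subset_left
  hv1 i hi ε := by
    split_ifs with h
    · exact p.hv1 i (fun h' => hi ⟨h', h⟩) ε
    · rfl
  hv2 i ε h := by
    split_ifs
    · exact p.hv2 i ε h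
    · rfl
  hZ := p.hZ
  hav i hi α hα γ := by
    simp only [if_pos hi.2]
    exact p.hav i hi.1 α hα γ

theorem res_v (I : Set Idx) (p : Cond X al) (i : Idx) (hi : i ∈ I) : (res I p).v i = p.v i := by
  funext ε
  exact if_pos hi

theorem le_res (I : Set Idx) (p : Cond X al) : p ≤ res I p :=
  ⟨le_rfl, Set.inter_subset_left, fun i hi _ _ => (congrFun (res_v I p i hi.2) _).symm,
    fun _ _ _ _ => Iff.rfl⟩

theorem res_mono (I : Set Idx) {p q : Cond X al} (h : q ≤ p) : res I q ≤ res I p :=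
  ⟨h.1, fun i hi => ⟨h.2.1 hi.1, hi.2⟩, fun i hi ε hε => by
    rw [res_v I _ i hi.2, res_v I _ i hi.2]; exact h.2.2.1 i hi.1 ε hε, h.2.2.2⟩

theorem Cond.ext' {p q : Cond X al} (h1 : p.δ = q.δ) (h2 : p.S = q.S) (h3 : p.v = q.v)
    (h4 : p.Z = q.Z) : p = q := by
  cases p; cases q; cases h1; cases h2; cases h3; cases h4; rfl

open Classical in
theorem res_eq {I : Set Idx} {p q : Cond X al} (h1 : p.δ = q.δ) (h2 : ∀ i ∈ I, i ∈ p.S ↔ i ∈ q.S)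
    (h3 : ∀ i ∈ I, p.v i = q.v i) (h4 : p.Z = q.Z) : res I p = res I q := by
  refine Cond.ext' (p := res I p) (q := res I q) h1 ?_ ?_ h4
  · ext i
    exact ⟨fun h => ⟨(h2 i h.2).1 h.1, h.2⟩, fun h => ⟨(h2 i h.2).2 h.1, h.2⟩⟩
  · funext i ε
    show ite _ _ _ = ite _ _ _
    split_ifs with h
    · rw [h3 i h]
    · rfl

theorem res_of_eq {I : Set Idx} {p q : Cond X al} (h : res I p = res I q) : p.δ = q.δ ∧
    (∀ i ∈ I, i ∈ p.S ↔ i ∈ q.S) ∧ (∀ i ∈ I, p.v i = q.v i) ∧ p.Z = q.Z := by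
  have e1 : (res I p).δ = (res I q).δ := by rw [h]
  have e2 : (res I p).Z = (res I q).Z := by rw [h]
  refine ⟨e1, fun i hi => ?_, fun i hi => ?_, e2⟩
  · have : i ∈ (res I p).S ↔ i ∈ (res I q).S := by rw [h]
    simpa [res, hi] using this
  · rw [← res_v I p i hi, ← res_v I q i hi, h]

theorem res_res (I : Set Idx) (p : Cond X al) : res I (res I p) = res I p :=
  res_eq rfl (fun i hi => ⟨fun h => h.1, fun h => ⟨h, hi⟩⟩) (fun i hi => res_v I p i hi) rfl

theorem res_le_of_sub {I : Set Idx} {p d : Cond X al} (h : p ≤ d) (hd : d.S ⊆ I) : res I p ≤ d :=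
  ⟨h.1, fun i hi => ⟨h.2.1 hi, hd hi⟩, fun i hi ε hε => by
    rw [res_v I p i (hd hi)]; exact h.2.2.1 i hi ε hε, h.2.2.2⟩

open Classical in
/-- amalgamation -/
noncomputable def am (r s : Cond X al) (I : Set Idx) (h : res I s ≤ res I r) : Cond X al where
  δ := s.δ
  S := (r.S \ I) ∪ (s.S ∩ I)
  v i ε := if i ∈ I then s.v i ε else r.v i ε
  Z := s.Z
  hS := (r.hS.mono Set.sdiff_subset).union (s.hS.mono Set.inter_subset_left)
  hv1 i hi ε := by
    split_ifs with h'
    · exact s.hv1 i (fun h2 => hi (Or.inr ⟨h2, h'⟩)) ε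
    · exact r.hv1 i (fun h2 => hi (Or.inl ⟨h2, h'⟩)) ε
  hv2 i ε hε := by
    split_ifs with h'
    · exact s.hv2 i ε hε
    · exact r.hv2 i ε (h.1.trans hε)
  hZ := s.hZ
  hav i hi α hα γ := by
    rcases hi with hi | hi
    · simp only [if_neg hi.2]
      intro hz
      by_cases hγ : γ ≤ r.δ
      · exact r.hav i hi.1 α hα γ ((h.2.2.2 _ _ _ hγ).1 hz)
      · exact not_cof (not_le.1 hγ) (Set.inter_subset_left.trans (bits_sub r i)) (s.hZ _ _ _ hz).2.2
    · simp only [if_pos hi.2]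
      exact s.hav i hi.1 α hα γ

open Classical in
theorem am_le (r s : Cond X al) (I : Set Idx) (h : res I s ≤ res I r) : am r s I h ≤ r := by
  refine ⟨h.1, fun i hi => ?_, fun i hi ε hε => ?_, h.2.2.2⟩
  · by_cases hI : i ∈ I
    · exact Or.inr ⟨(h.2.1 ⟨hi, hI⟩).1, hI⟩
    · exact Or.inl ⟨hi, hI⟩
  · show ite _ _ _ = _
    split_ifs with hI
    · have := h.2.2.1 i ⟨hi, hI⟩ ε hε
      rwa [res_v I _ i hI, res_v I _ i hI] at this
    · rfl

theorem res_am (r s : Cond X al) (I : Set Idx) (h : res I s ≤ res I r) :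
    res I (am r s I h) = res I s := by
  refine res_eq rfl (fun i hi => ?_) (fun i hi => ?_) rfl
  · show i ∈ (r.S \ I) ∪ (s.S ∩ I) ↔ _
    simp [hi]
  · funext ε
    exact if_pos hi

/-- If `d` lives on `I` and is compatible with `res I p`, it is compatible with `p`. -/
theorem compat_of_res {I : Set Idx} {p d e : Cond X al} (hd : d.S ⊆ I) (h1 : e ≤ d) (h2 : e ≤ res I p) :
    ∃ m, m ≤ p ∧ m ≤ d := by
  have h : res I e ≤ res I p := by
    have := res_mono I h2
    rwa [res_res] at this
  refine ⟨am p e I h, am_le p e I h, ?_⟩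
  calc am p e I h ≤ res I (am p e I h) := le_res _ _
    _ = res I e := res_am _ _ _ _
    _ ≤ d := res_le_of_sub h1 hd

/-! limits -/

theorem chain_le {p : ℕ → Cond X al} (hp : ∀ n, p (n + 1) ≤ p n) {m n : ℕ} (h : m ≤ n) : p n ≤ p m :=
  antitone_nat_of_succ_le hp h

theorem chain_v {p : ℕ → Cond X al} (hp : ∀ n, p (n + 1) ≤ p n) {m n : ℕ} {i : Idx} {ε : W.{u}}
    (h1 : i ∈ (p m).S) (h2 : ε < (p m).δ) (h3 : i ∈ (p n).S) (h4 : ε < (p n).δ) :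
    (p m).v i ε = (p n).v i ε := by
  rcases le_total m n with h | h
  · exact ((chain_le hp h).2.2.1 i h1 ε h2).symm
  · exact (chain_le hp h).2.2.1 i h3 ε h4

theorem chain_Z {p : ℕ → Cond X al} (hp : ∀ n, p (n + 1) ≤ p n) {m n : ℕ} {α γ : W.{u}} {s : Set W.{u}}
    (h2 : γ ≤ (p m).δ) (h4 : γ ≤ (p n).δ) :
    (p m).Z α γ s ↔ (p n).Z α γ s := by
  rcases le_total m n with h | h
  · exact ((chain_le hp h).2.2.2 _ _ _ h2).symm
  · exact (chain_le hp h).2.2.2 _ _ _ h4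

theorem limit_exists (p : ℕ → Cond X al) (hp : ∀ n, p (n + 1) ≤ p n) (δ : W.{u}) (hδ : ∀ n, (p n).δ ≤ δ)
    (E : W.{u} → W.{u} → Set W.{u} → Prop)
    (hE : ∀ α γ s, E α γ s → (∀ n, (p n).δ < γ) ∧ γ ≤ δ ∧ s ⊆ Set.Iio γ ∧ Cof γ s ∧
      ∀ n i, i ∈ (p n).S → al i = some α → ∃ m, i ∈ (p m).S ∧ ∃ ε < (p m).δ,
        ¬ (ε ∈ s ↔ (p m).v i ε ≠ default)) :
    ∃ q : Cond X al, (∀ n, q ≤ p n) ∧ q.δ = δ ∧ (∀ i, i ∈ q.S ↔ ∃ n, i ∈ (p n).S) ∧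
      (∀ i n ε, i ∈ (p n).S → ε < (p n).δ → q.v i ε = (p n).v i ε) ∧
      (∀ i ε, (¬ ∃ n, i ∈ (p n).S ∧ ε < (p n).δ) → q.v i ε = default) ∧
      (∀ α γ s, q.Z α γ s ↔ E α γ s ∨ ∃ n, (p n).Z α γ s) := by
  classical
  let v : ∀ i, W.{u} → X i := fun i ε =>
    if h : ∃ n, i ∈ (p n).S ∧ ε < (p n).δ then (p (Classical.choose h)).v i ε else default
  have hv : ∀ i n ε, i ∈ (p n).S → ε < (p n).δ → v i ε = (p n).v i ε := by
    intro i n ε h1 h2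
    have h : ∃ n, i ∈ (p n).S ∧ ε < (p n).δ := ⟨n, h1, h2⟩
    show dite _ _ _ = _
    rw [dif_pos h]
    exact chain_v hp (Classical.choose_spec h).1 (Classical.choose_spec h).2 h1 h2
  have hv0 : ∀ i ε, (¬ ∃ n, i ∈ (p n).S ∧ ε < (p n).δ) → v i ε = default := by
    intro i ε h
    show dite _ _ _ = _
    rw [dif_neg h]
  have hle : ∀ α γ s n, (p n).Z α γ s → γ ≤ (p n).δ := fun α γ s n h => ((p n).hZ α γ s h).1
  let q : Cond X al :=
    { δ := δ
      S := ⋃ n, (p n).S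
      v := v
      Z := fun α γ s => E α γ s ∨ ∃ n, (p n).Z α γ s
      hS := Set.countable_iUnion fun n => (p n).hS
      hv1 := fun i hi ε => hv0 i ε (by
        rintro ⟨n, hn, -⟩
        exact hi (Set.mem_iUnion.2 ⟨n, hn⟩))
      hv2 := fun i ε h => hv0 i ε (by
        rintro ⟨n, -, hn⟩
        exact absurd (hn.trans_le (hδ n)) (not_lt.2 h))
      hZ := by
        rintro α γ s (h | ⟨n, h⟩)
        · have := hE α γ s h
          exact ⟨this.2.1, this.2.2.1, this.2.2.2.1⟩
        · have := (p n).hZ α γ s h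
          exact ⟨this.1.trans (hδ n), this.2⟩
      hav := by
        intro i hi α hα γ h
        obtain ⟨n, hn⟩ := Set.mem_iUnion.1 hi
        rcases h with h | ⟨k, h⟩
        · have := hE _ _ _ h
          obtain ⟨m, hm, ε, hε, h3⟩ := this.2.2.2.2 n i hn hα
          apply h3
          rw [← hv i m ε hm hε]
          exact ⟨fun h => h.1, fun h => ⟨h, hε.trans (this.1 m)⟩⟩
        · have hk : k ≤ max k n := le_max_left _ _
          have hn2 : n ≤ max k n := le_max_right _ _
          have hin := (chain_le hp hn2).2.1 hn
          have hγ := hle _ _ _ _ h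
          have hγ2 := hγ.trans (chain_le hp hk).1
          apply (p (max k n)).hav i hin α hα γ
          rw [chain_Z hp hγ2 hγ]
          convert h using 1
          ext ε
          constructor
          · rintro ⟨h3, h4⟩
            refine ⟨?_, h4⟩
            show v i ε ≠ default
            rw [hv i _ ε hin (lt_of_lt_of_le h4 hγ2)]
            exact h3
          · rintro ⟨h3, h4⟩
            refine ⟨?_, h4⟩
            show (p (max k n)).v i ε ≠ default
            rw [← hv i _ ε hin (lt_of_lt_of_le h4 hγ2)]
            exact h3 }
  refine ⟨q, fun n => ⟨hδ n, fun i hi => Set.mem_iUnion.2 ⟨n, hi⟩, fun i hi ε hε => hv i n ε hi hε, ?_⟩,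
    rfl, fun i => Set.mem_iUnion, hv, hv0, fun _ _ _ => Iff.rfl⟩
  intro α γ s hγ
  constructor
  · rintro (h | ⟨k, h⟩)
    · exact absurd ((hE _ _ _ h).1 n) (not_lt.2 hγ)
    · exact (chain_Z hp (hle _ _ _ _ h) hγ).1 h
  · intro h
    exact Or.inr ⟨n, h⟩

/-- the plain limit -/
theorem limit_plain (p : ℕ → Cond X al) (hp : ∀ n, p (n + 1) ≤ p n) : ∃ q : Cond X al, ∀ n, q ≤ p n := by
  obtain ⟨δ, hδ⟩ := W_bdd (Set.range fun n => (p n).δ) (Set.countable_range _)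
  obtain ⟨q, hq, -⟩ := limit_exists p hp δ (fun n => (hδ _ ⟨n, rfl⟩).le) (fun _ _ _ => False)
    (fun _ _ _ h => h.elim)
  exact ⟨q, hq⟩

/-- countable distributivity -/
theorem distrib (R : ℕ → Cond X al → Prop) (hR : ∀ n p q, q ≤ p → R n p → R n q) (p : Cond X al)
    (h : ∀ n, ∀ q ≤ p, ∃ r ≤ q, R n r) : ∃ q ≤ p, ∀ n, R n q := by
  choose! g hg hgR using h
  let f : ℕ → Cond X al := fun n => Nat.rec p (fun n q => g n q) n
  have hf : ∀ n, f n ≤ p := by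
    intro n
    induction n with
    | zero => exact le_rfl
    | succ n ih => exact (hg n _ ih).trans ih
  obtain ⟨q, hq⟩ := limit_plain f (fun n => hg n _ (hf n))
  exact ⟨q, (hq 0).trans (hf 0), fun n => hR n _ _ (hq (n + 1)) (hgR n _ (hf n))⟩

theorem distrib_c {ι : Type*} [Countable ι] (R : ι → Cond X al → Prop) (hR : ∀ n p q, q ≤ p → R n p → R n q)
    (p : Cond X al) (h : ∀ n, ∀ q ≤ p, ∃ r ≤ q, R n r) : ∃ q ≤ p, ∀ n, R n q := by
  cases isEmpty_or_nonempty ι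
  · exact ⟨p, le_rfl, fun n => isEmptyElim n⟩
  · obtain ⟨e, he⟩ := exists_surjective_nat ι
    obtain ⟨q, hq, h2⟩ := distrib (fun n => R (e n)) (fun n => hR (e n)) p (fun n => h (e n))
    refine ⟨q, hq, fun i => ?_⟩
    obtain ⟨n, rfl⟩ := he i
    exact h2 n

end Forcing
end JK

namespace JK
open FirstOrder FirstOrder.Language
universe u

section Card
variable {κ : Cardinal.{u}}

theorem aleph1_lt (hκ : κ.IsInaccessible) : Cardinal.aleph 1 < κ := by
  refine lt_of_le_of_lt ?_ (hκ.isStrongPrelimit hκ.aleph0_lt)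
  rw [← Cardinal.succ_aleph0]
  exact Order.succ_le_of_lt (Cardinal.cantor _)

theorem W_lt (hκ : κ.IsInaccessible) : Cardinal.mk W.{u} < κ := by
  rw [W_card]; exact aleph1_lt hκ

theorem set_lt (hκ : κ.IsInaccessible) {A : Type u} (h : Cardinal.mk A < κ) : Cardinal.mk (Set A) < κ := by
  rw [Cardinal.mk_set]; exact hκ.isStrongPrelimit h

theorem prod_lt (hκ : κ.IsInaccessible) {A C : Type u} (h : Cardinal.mk A < κ) (h' : Cardinal.mk C < κ) :
    Cardinal.mk (A × C) < κ := by
  rw [Cardinal.mk_prod, Cardinal.lift_id, Cardinal.lift_id]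
  exact Cardinal.mul_lt_of_lt hκ.aleph0_lt.le h h'

theorem sigma_lt (hκ : κ.IsInaccessible) {A : Type u} {C : A → Type u} (h : Cardinal.mk A < κ)
    (h' : ∀ a, Cardinal.mk (C a) < κ) :
    Cardinal.mk (Σ a, C a) < κ := by
  rw [Cardinal.mk_sigma]
  exact Cardinal.sum_lt_of_isRegular hκ.isRegular h h'

variable {Idx : Type u} {X : Idx → Type u} [∀ i, Inhabited (X i)] {al : Idx → Option W.{u}}

theorem PI_lt (hκ : κ.IsInaccessible) (hX : ∀ i, Cardinal.mk (X i) < κ) (I : Set Idx)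
    (hI : Cardinal.mk I < κ) : Cardinal.mk {p : Cond X al // p.S ⊆ I} < κ := by
  let T : Type u := W.{u} × Set I × Set (Σ i : I, W.{u} × X i) × Set (W.{u} × W.{u} × Set W.{u})
  let F : {p : Cond X al // p.S ⊆ I} → T := fun p =>
    (p.1.δ, {i | i.1 ∈ p.1.S}, {x | p.1.v x.1.1 x.2.1 = x.2.2}, {x | p.1.Z x.1 x.2.1 x.2.2})
  have hF : Function.Injective F := by
    rintro ⟨p, hp⟩ ⟨q, hq⟩ h
    have h1 : p.δ = q.δ := congrArg (fun t : T => t.1) h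
    have h2 : {i : I | i.1 ∈ p.S} = {i : I | i.1 ∈ q.S} := congrArg (fun t : T => t.2.1) h
    have h3 : {x : Σ i : I, W.{u} × X i | p.v x.1.1 x.2.1 = x.2.2} =
      {x : Σ i : I, W.{u} × X i | q.v x.1.1 x.2.1 = x.2.2} := congrArg (fun t : T => t.2.2.1) h
    have h4 : {x : W.{u} × W.{u} × Set W.{u} | p.Z x.1 x.2.1 x.2.2} =
      {x : W.{u} × W.{u} × Set W.{u} | q.Z x.1 x.2.1 x.2.2} := congrArg (fun t : T => t.2.2.2) h
    apply Subtype.ext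
    have hS : p.S = q.S := by
      ext i
      constructor
      · intro h
        have : (⟨i, hp h⟩ : I) ∈ {i : I | i.1 ∈ q.S} := by rw [← h2]; exact h
        exact this
      · intro h
        have : (⟨i, hq h⟩ : I) ∈ {i : I | i.1 ∈ p.S} := by rw [h2]; exact h
        exact this
    refine Cond.ext' h1 hS ?_ ?_
    · funext i ε
      by_cases hi : i ∈ I
      · have : (⟨⟨i, hi⟩, ε, p.v i ε⟩ : Σ i : I, W.{u} × X i) ∈
          {x : Σ i : I, W.{u} × X i | q.v x.1.1 x.2.1 = x.2.2} := by
          rw [← h3]; rfl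
        exact this.symm
      · rw [p.hv1 i (fun h => hi (hp h)), q.hv1 i (fun h => hi (hq h))]
    · funext α γ s
      have : (α, γ, s) ∈ {x : W.{u} × W.{u} × Set W.{u} | p.Z x.1 x.2.1 x.2.2} ↔
        (α, γ, s) ∈ {x : W.{u} × W.{u} × Set W.{u} | q.Z x.1 x.2.1 x.2.2} := by rw [h4]
      exact propext this
  refine lt_of_le_of_lt (Cardinal.mk_le_of_injective hF) ?_
  have hW := W_lt hκ
  refine prod_lt hκ hW (prod_lt hκ (set_lt hκ hI) (prod_lt hκ (set_lt hκ ?_) (set_lt hκ ?_)))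
  · exact sigma_lt hκ hI fun i => prod_lt hκ hW (hX i)
  · exact prod_lt hκ hW (prod_lt hκ hW (set_lt hκ hW))

/-- closure step -/
def stepI {Y : Type u} (F : Y → Cond X al → Cond X al) (I : Set Idx) : Set Idx :=
  I ∪ ⋃ x : Y × {p : Cond X al // p.S ⊆ I}, (F x.1 x.2.1).S

noncomputable def II {Y : Type u} (F : Y → Cond X al → Cond X al) (ξ : W.{u}) : Set Idx :=
  ⋃ η : Set.Iio ξ, stepI F (II F η.1)
termination_by ξ
decreasing_by exact η.2

theorem II_lt (hκ : κ.IsInaccessible) (hX : ∀ i, Cardinal.mk (X i) < κ) {Y : Type u}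
    (hY : Cardinal.mk Y < κ) (F : Y → Cond X al → Cond X al) (ξ : W.{u}) :
    Cardinal.mk (II F ξ) < κ := by
  induction ξ using WellFoundedLT.induction with
  | ind ξ ih =>
    rw [II, Cardinal.card_iUnion_lt_iff_forall_of_isRegular hκ.isRegular
      (lt_of_le_of_lt (Cardinal.mk_set_le _) (W_lt hκ))]
    rintro ⟨η, hη⟩
    have h := ih η hη
    refine lt_of_le_of_lt (Cardinal.mk_union_le _ _) (Cardinal.add_lt_of_lt hκ.aleph0_lt.le h ?_)
    rw [Cardinal.card_iUnion_lt_iff_forall_of_isRegular hκ.isRegular (prod_lt hκ hY (PI_lt hκ hX _ h))]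
    intro x
    exact lt_of_le_of_lt (Cardinal.le_aleph0_iff_set_countable.2 (F x.1 x.2.1).hS) hκ.aleph0_lt

theorem stepI_sub {Y : Type u} (F : Y → Cond X al → Cond X al) {η ξ : W.{u}} (h : η < ξ) :
    stepI F (II F η) ⊆ II F ξ := by
  conv_rhs => rw [II]
  exact Set.subset_iUnion (fun η : Set.Iio ξ => stepI F (II F η.1)) ⟨η, h⟩

theorem reflect (hκ : κ.IsInaccessible) (hX : ∀ i, Cardinal.mk (X i) < κ) {Y : Type u}
    (hY : Cardinal.mk Y < κ) (D : Y → Cond X al → Prop) (hD : ∀ y p, ∃ q ≤ p, D y q) :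
    ∃ I : Set Idx, Cardinal.mk I < κ ∧ ∀ y p, ∃ d, D y d ∧ d.S ⊆ I ∧ ∃ m, m ≤ p ∧ m ≤ d := by
  choose F hF hFD using hD
  refine ⟨⋃ ξ, II F ξ, ?_, fun y p => ?_⟩
  · rw [Cardinal.card_iUnion_lt_iff_forall_of_isRegular hκ.isRegular (W_lt hκ)]
    exact II_lt hκ hX hY F
  · set I := ⋃ ξ, II F ξ with hI
    have h1 : ∀ i ∈ (res I p).S, ∃ ξ, i ∈ II F ξ := fun i hi => Set.mem_iUnion.1 hi.2
    choose! g hg using h1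
    obtain ⟨ξ, hξ⟩ := W_bdd (g '' (res I p).S) ((res I p).hS.image g)
    have h2 : (res I p).S ⊆ II F ξ := fun i hi =>
      stepI_sub F (hξ _ ⟨i, hi, rfl⟩) (Or.inl (hg i hi))
    obtain ⟨ξ', hξ'⟩ := W_succ ξ
    have h3 : (F y (res I p)).S ⊆ I := by
      intro i hi
      refine Set.mem_iUnion.2 ⟨ξ', stepI_sub F hξ' (Or.inr ?_)⟩
      exact Set.mem_iUnion.2 ⟨(y, ⟨res I p, h2⟩), hi⟩
    exact ⟨F y (res I p), hFD _ _, h3, compat_of_res h3 le_rfl (hF _ _)⟩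

end Card

section Cards
/-- the ordinal of an element -/
noncomputable abbrev tyo {γ : Ordinal.{u}} (x : γ.ToType) : Ordinal.{u} :=
  Ordinal.typein (α := γ.ToType) (· < ·) x

variable {κ : Cardinal.{u}}
variable {Idx : Type u} {X : Idx → Type u} [∀ i, Inhabited (X i)] {al : Idx → Option W.{u}}

/-- Lemma C -/
theorem no_inj (hκ : κ.IsInaccessible) (hX : ∀ i, Cardinal.mk (X i) < κ) {α β : Ordinal.{u}}
    (h1 : κ ≤ α.card) (h2 : β.card < α.card) :
    ∀ U : Ult (RO (Cond X al)), ¬ InjInto (El U) (cl U (ordn α)) (cl U (ordn β)) := by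
  refine all_of_fo _ fun p => ?_
  by_contra hcon
  obtain ⟨p, hp, hinj⟩ : ∃ q ≤ p, Fo q (fun U => InjInto (El U) (cl U (ordn α)) (cl U (ordn β))) := by
    have := fo_em _ p (fun h => hcon ⟨p, le_rfl, h⟩)
    obtain ⟨q, hq, h⟩ := this
    exact ⟨q, hq, fo_imp h fun U hU => not_not.1 hU⟩
  obtain ⟨h, hh⟩ := fo_exi (fun U f => IsFuncInto (El U) f (cl U (ordn α)) (cl U (ordn β)) ∧ InjFun (El U) f)
    hinj
  let V (q : Cond X al) (ξ η : Ordinal.{u}) : Prop :=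
    Fo q (fun U => FunVal (El U) (cl U h) (cl U (ordn ξ)) (cl U (ordn η)))
  have hV : ∀ q ≤ p, ∀ ξ < α, ∃ r ≤ q, ∃ η < β, V r ξ η := by
    intro q hq ξ hξ
    apply fo_bex_ord (fun U v => FunVal (El U) (cl U h) (cl U (ordn ξ)) v)
    intro U hU
    obtain ⟨y, hy1, hy2⟩ := func_val U (fo_mono hq hh U hU).1 (mem_ordn U hξ)
    exact ⟨y, hy1, hy2⟩
  have hfun : ∀ q ≤ p, ∀ ξ ξ' η, V q ξ η → V q ξ' η → ξ = ξ' := by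
    intro q hq ξ ξ' η h1 h2
    by_contra hne
    refine fo_false (p := q) fun U hU => hne ?_
    exact ordn_inj U ((fo_mono hq hh U hU).2 _ _ _ (h1 U hU) (h2 U hU))
  let A : β.ToType → Set α.ToType := fun η => {ξ | ∃ q ≤ p, V q (tyo ξ) (tyo η)}
  have hA : ∀ η, Cardinal.mk (A η) < κ := by
    intro η
    let D : PUnit.{u+1} → Cond X al → Prop := fun _ d =>
      (¬ ∃ (ξ : α.ToType) (q : _), q ≤ d ∧ q ≤ p ∧ V q (tyo ξ) (tyo η)) ∨
      ∃ (ξ : α.ToType), V d (tyo ξ) (tyo η)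
    obtain ⟨I, hI, hI2⟩ := reflect (al := al) hκ hX (Y := PUnit.{u+1})
      (by simpa using hκ.nat_lt 1) D (fun _ q => by
        by_cases hq : ∃ (ξ : α.ToType) (r : _), r ≤ q ∧ r ≤ p ∧
          V r (tyo ξ) (tyo η)
        · obtain ⟨ξ, r, hr, -, h3⟩ := hq
          exact ⟨r, hr, Or.inr ⟨ξ, h3⟩⟩
        · exact ⟨q, le_rfl, Or.inl hq⟩)
    have key : ∀ ξ : A η, ∃ d : {d : Cond X al // d.S ⊆ I}, ∃ e : Cond X al, e ≤ d.1 ∧ e ≤ p ∧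
        V e (tyo ξ.1) (tyo η) ∧
        ∃ (ξ' : α.ToType), V d.1 (tyo ξ') (tyo η) := by
      rintro ⟨ξ, q, hq, hξ⟩
      obtain ⟨d, hd, hdI, e, he1, he2⟩ := hI2 PUnit.unit q
      have hVe := fo_mono he1 hξ
      refine ⟨⟨d, hdI⟩, e, he2, he1.trans hq, hVe, ?_⟩
      rcases hd with hd | hd
      · exact absurd ⟨ξ, e, he2, he1.trans hq, hVe⟩ hd
      · exact hd
    choose d hd using key
    refine lt_of_le_of_lt (Cardinal.mk_le_of_injective (f := d) ?_) (PI_lt hκ hX I hI)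
    intro ξ ξ' hdd
    obtain ⟨e, he1, he2, he3, ζ, hζ⟩ := hd ξ
    obtain ⟨e', he1', he2', he3', -⟩ := hd ξ'
    rw [← hdd] at he1'
    have e1 := hfun e he2 _ _ _ he3 (fo_mono he1 hζ)
    have e2 := hfun e' he2' _ _ _ he3' (fo_mono he1' hζ)
    exact Subtype.ext (Ordinal.typein_injective _ (e1.trans e2.symm))
  have hcov : (⋃ η, A η) = Set.univ := by
    ext ξ
    simp only [Set.mem_iUnion, Set.mem_univ, iff_true]
    obtain ⟨r, hr, η, hη, hv⟩ := hV p le_rfl _ (Ordinal.typein_lt_self ξ)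
    have h1 : η < Ordinal.type (α := β.ToType) (· < ·) := by simpa using hη
    refine ⟨Ordinal.enum (α := β.ToType) (· < ·) ⟨η, h1⟩, r, hr, ?_⟩
    have hx : tyo (Ordinal.enum (α := β.ToType) (· < ·) ⟨η, h1⟩) = η := Ordinal.typein_enum _ h1
    rw [hx]
    exact hv
  have hcard : Cardinal.mk (⋃ η, A η : Set α.ToType) = α.card := by
    rw [hcov, Cardinal.mk_univ, Cardinal.mk_toType]
  rcases h1.lt_or_eq with hlt | heq
  · have : Cardinal.mk (⋃ η, A η : Set α.ToType) < α.card := by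
      refine lt_of_le_of_lt (Cardinal.mk_iUnion_le_sum_mk) ?_
      refine lt_of_le_of_lt (Cardinal.sum_le_sum _ (fun _ => κ) fun η => (hA η).le) ?_
      rw [Cardinal.sum_const', Cardinal.mk_toType]
      exact Cardinal.mul_lt_of_lt (hκ.aleph0_lt.le.trans h1) h2 hlt
    exact absurd hcard this.ne
  · rw [← heq] at hcard h2
    have : Cardinal.mk (⋃ η, A η : Set α.ToType) < κ := by
      rw [Cardinal.card_iUnion_lt_iff_forall_of_isRegular hκ.isRegular (by simpa using h2)]
      exact hA
    exact absurd hcard this.ne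

theorem og_lt (ξ : W.{u}) : tyo ξ < Ordinal.omega 1 :=
  Ordinal.typein_lt_self ξ

theorem not_countable_w1 : ∀ U : Ult (RO (Cond X al)),
    ¬ InjInto (El U) (cl U (ordn (Ordinal.omega 1))) (cl U (ordn Ordinal.omega0)) := by
  refine all_of_fo _ fun p => ?_
  by_contra hcon
  obtain ⟨p, hp, hinj⟩ : ∃ q ≤ p, Fo q (fun U => InjInto (El U) (cl U (ordn (Ordinal.omega 1)))
      (cl U (ordn Ordinal.omega0))) := by
    have := fo_em _ p (fun h => hcon ⟨p, le_rfl, h⟩)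
    obtain ⟨q, hq, h⟩ := this
    exact ⟨q, hq, fo_imp h fun U hU => not_not.1 hU⟩
  obtain ⟨h, hh⟩ := fo_exi (fun U f => IsFuncInto (El U) f (cl U (ordn (Ordinal.omega 1)))
    (cl U (ordn Ordinal.omega0)) ∧ InjFun (El U) f) hinj
  let V (q : Cond X al) (ξ : W.{u}) (n : ℕ) : Prop :=
    Fo q (fun U => FunVal (El U) (cl U h) (cl U (ordn (tyo ξ))) (cl U (ordn n)))
  have hV : ∀ q ≤ p, ∀ ξ, ∃ r ≤ q, ∃ n, V r ξ n := by
    intro q hq ξ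
    obtain ⟨r, hr, η, hη, h3⟩ := fo_bex_ord (α := Ordinal.omega0) (p := q)
      (fun U v => FunVal (El U) (cl U h) (cl U (ordn (tyo ξ))) v) (by
      intro U hU
      obtain ⟨y, hy1, hy2⟩ := func_val U (fo_mono hq hh U hU).1 (mem_ordn U (og_lt ξ))
      exact ⟨y, hy1, hy2⟩)
    obtain ⟨n, rfl⟩ := Ordinal.lt_omega0.1 hη
    exact ⟨r, hr, n, h3⟩
  have hfun : ∀ q ≤ p, ∀ ξ ξ' η, V q ξ η → V q ξ' η → ξ = ξ' := by
    intro q hq ξ ξ' η h1 h2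
    by_contra hne
    refine fo_false (p := q) fun U hU => hne ?_
    exact Ordinal.typein_injective _ (ordn_inj U ((fo_mono hq hh U hU).2 _ _ _ (h1 U hU) (h2 U hU)))
  obtain ⟨q, hq, hq2⟩ := distrib (fun n r => (∃ ξ, V r ξ n) ∨ ¬ ∃ r' ≤ r, ∃ ξ, V r' ξ n)
    (by
      rintro n r r' hr (⟨ξ, h⟩ | h)
      · exact Or.inl ⟨ξ, fo_mono hr h⟩
      · exact Or.inr fun ⟨r2, h2, h3⟩ => h ⟨r2, h2.trans hr, h3⟩) p (by
      intro n r _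
      by_cases hn : ∃ r' ≤ r, ∃ ξ, V r' ξ n
      · obtain ⟨r', hr', h⟩ := hn
        exact ⟨r', hr', Or.inl h⟩
      · exact ⟨r, le_rfl, Or.inr hn⟩)
  have : ∀ ξ : W.{u}, ∃ n, V q ξ n := by
    intro ξ
    obtain ⟨r, hr, n, hn⟩ := hV q hq ξ
    rcases hq2 n with ⟨ξ', h'⟩ | h'
    · exact ⟨n, by rw [hfun r (hr.trans hq) _ _ _ hn (fo_mono hr h')]; exact h'⟩
    · exact absurd ⟨r, hr, ξ, hn⟩ h'
  choose g hg using this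
  have hgi : Function.Injective g := fun ξ ξ' e => hfun q hq _ _ _ (hg ξ) (by rw [e]; exact hg ξ')
  exact W_unc (Set.countable_univ_iff.2 hgi.countable)

theorem omega1_spec (U : Ult (RO (Cond X al))) : IsOmega1V (El U) (cl U (ordn (Ordinal.omega 1))) := by
  refine ⟨ord_ordn U _, ?_, fun a ha => ?_⟩
  · rintro ⟨w, hw, h⟩
    rw [omega_unique U hw] at h
    exact not_countable_w1 U h
  · refine ball_ord' (Ordinal.omega 1) (fun U a => CountableV (El U) a) (fun β hβ U => ?_) U a ha
    refine ⟨_, limit_omega U, inj_ordn_ordn ?_ U⟩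
    rw [Ordinal.card_omega0]
    have := (Cardinal.lt_ord (c := Cardinal.aleph 1)).1 (by rw [Cardinal.ord_aleph]; exact hβ)
    rw [← Cardinal.succ_aleph0] at this
    exact Order.lt_succ_iff.1 this

/-- Lemma D -/
theorem collapse (i : Idx) {β : Ordinal.{u}} (e : β.ToType ≃ X i) (U : Ult (RO (Cond X al))) :
    InjInto (El U) (cl U (ordn β)) (cl U (ordn (Ordinal.omega 1))) := by
  let c : W.{u} → β.ToType → RO (Cond X al) := fun ε ξ => val fun p => ε < p.δ ∧ i ∈ p.S ∧ p.v i ε = e ξ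
  have hd : ∀ ε ξ ξ', ξ ≠ ξ' → c ε ξ ⊓ c ε ξ' = ⊥ := by
    intro ε ξ ξ' hne
    refine le_bot_iff.1 (le_of_ult fun V hV => ?_)
    have hV := (V.inf_iff _ _).1 hV
    exfalso
    refine all_of_fo (fun V => ¬ (c ε ξ ∈ V.s ∧ c ε ξ' ∈ V.s)) (fun p => ?_) V hV
    by_contra hcon
    have h := fo_em _ p (fun h => hcon ⟨p, le_rfl, h⟩)
    obtain ⟨q, hq, h⟩ := h
    have h1 : Fo q (fun V => c ε ξ ∈ V.s) := fo_imp h fun U hU => (not_not.1 hU).1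
    have h2 : Fo q (fun V => c ε ξ' ∈ V.s) := fo_imp h fun U hU => (not_not.1 hU).2
    obtain ⟨r, hr, h3⟩ := (fo_val _ _).1 h1 q le_rfl
    obtain ⟨r', hr', h4⟩ := (fo_val _ _).1 h2 r hr
    exact hne (e.injective ((h3 r' hr').2.2.symm.trans (h4 r' le_rfl).2.2))
  let τ : W.{u} → Nm (RO (Cond X al)) := fun ε => mix (c ε)
    (fun ξ => ordn (tyo ξ))
  refine inj_of_cover (fun ε : W.{u} => tyo ε) (Ordinal.typein_injective _)
    (Ordinal.omega 1) og_lt τ U _ ?_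
  intro v hv
  refine ball_ord' β (fun U v => El U v (cl U ⟨W.{u}, τ, fun _ => ⊤⟩)) (fun ξ hξ => ?_) U v hv
  have h1 : ξ < Ordinal.type (α := β.ToType) (· < ·) := by simpa using hξ
  let x := Ordinal.enum (α := β.ToType) (· < ·) ⟨ξ, h1⟩
  have hx : tyo x = ξ := Ordinal.typein_enum _ h1
  refine all_of_fo _ fun p => ?_
  obtain ⟨δ', hδ'⟩ := W_succ p.δ
  classical
  refine ⟨extend p {i} (Set.countable_singleton i) δ' hδ'.le (fun j _ => if h : j = i then h ▸ e x else default),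
    extend_le _ _ _ _ _ _, ?_⟩
  set q := extend p {i} (Set.countable_singleton i) δ' hδ'.le
    (fun j _ => if h : j = i then h ▸ e x else default) with hq
  have hqv : q.v i p.δ = e x := by
    rw [hq, extend_v _ _ _ _ _ _ i (Set.mem_singleton i) _ le_rfl hδ']
    simp
  have hi : i ∈ q.S := Or.inr rfl
  have h2 : Fo q (fun V => c p.δ x ∈ V.s) := by
    rw [fo_val]
    intro r hr
    exact ⟨r, le_rfl, fun r' hr' => ⟨hδ'.trans_le (hr'.trans hr).1, (hr'.trans hr).2.1 hi,
      ((hr'.trans hr).2.2.1 i hi _ hδ').trans hqv⟩⟩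
  intro V hV
  have h3 := (cl_eq V _ _).2 (V.mono (mix_le (c p.δ) (fun ξ => ordn (tyo ξ))
    (hd p.δ) x) (h2 V hV))
  rw [hx] at h3
  rw [← h3]
  exact El_mk V τ (fun _ => ⊤) p.δ V.top_mem

end Cards
end JK

namespace JK
open FirstOrder FirstOrder.Language
universe u

section Nodes
variable {B : Type u} [CompleteBooleanAlgebra B]

theorem not_mem_zero (U : Ult B) (z : Mo U) : ¬ El U z (cl U (ordn 0)) := by
  intro hz
  exact ball_ord' 0 (fun U z => False) (fun β hβ U => absurd hβ (not_lt.2 (zero_le))) U z hz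

theorem mem_one (U : Ult B) (z : Mo U) : El U z (cl U (ordn 1)) ↔ z = cl U (ordn 0) := by
  have := mem_ordn_succ U 0 z
  rw [show Order.succ (0 : Ordinal.{u}) = 1 by simp] at this
  rw [this]
  exact ⟨fun h => h.resolve_left (not_mem_zero U z), Or.inr⟩

theorem mem_two (U : Ult B) (z : Mo U) :
    El U z (cl U (ordn 2)) ↔ z = cl U (ordn 0) ∨ z = cl U (ordn 1) := by
  have := mem_ordn_succ U 1 z
  rw [show Order.succ (1 : Ordinal.{u}) = 2 by rw [Order.succ_eq_add_one, one_add_one_eq_two] ] at this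
  rw [this, mem_one]

theorem empty_iff (U : Ult B) (z : Mo U) : IsEmptyV (El U) z ↔ z = cl U (ordn 0) := by
  refine ⟨fun h => nm_ext U _ _ fun y => ⟨fun hy => absurd hy (h y), fun hy => absurd hy (not_mem_zero U y)⟩, ?_⟩
  rintro rfl
  exact not_mem_zero U

theorem one_iff (U : Ult B) (z : Mo U) : IsOneV (El U) z ↔ z = cl U (ordn 1) := by
  refine ⟨fun h => nm_ext U _ _ fun y => ?_, ?_⟩
  · rw [h y, mem_one, empty_iff]
  · rintro rfl y
    rw [mem_one, empty_iff]

theorem two_iff (U : Ult B) (z : Mo U) : IsTwoV (El U) z ↔ z = cl U (ordn 2) := by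
  refine ⟨fun h => nm_ext U _ _ fun y => ?_, ?_⟩
  · rw [h y, mem_two, empty_iff, one_iff]
  · rintro rfl y
    rw [mem_two, empty_iff, one_iff]

theorem zero_ne_one (U : Ult B) : cl U (ordn 0) ≠ cl U (ordn 1) := fun h =>
  _root_.zero_ne_one (ordn_inj U h)

open Classical in
noncomputable def bitn (Q : Prop) : Nm B := if Q then ordn 1 else ordn 0

theorem bitn_t {Q : Prop} (h : Q) : (bitn Q : Nm B) = ordn 1 := if_pos h
theorem bitn_f {Q : Prop} (h : ¬ Q) : (bitn Q : Nm B) = ordn 0 := if_neg h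

theorem bitn_inj (U : Ult B) {Q Q' : Prop} (h : cl U (bitn Q) = cl U (bitn Q')) : Q ↔ Q' := by
  by_cases h1 : Q <;> by_cases h2 : Q'
  · exact ⟨fun _ => h2, fun _ => h1⟩
  · rw [bitn_t h1, bitn_f h2] at h
    exact absurd h.symm (zero_ne_one U)
  · rw [bitn_t h2, bitn_f h1] at h
    exact absurd h (zero_ne_one U)
  · exact ⟨fun h => absurd h h1, fun h => absurd h h2⟩

theorem bitn_two (U : Ult B) (Q : Prop) : El U (cl U (bitn Q)) (cl U (ordn 2)) := by
  rw [mem_two]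
  by_cases h : Q
  · rw [bitn_t h]; exact Or.inr rfl
  · rw [bitn_f h]; exact Or.inl rfl

/-- node of height `γ` coded by `s ∩ γ` -/
noncomputable def nd (γ : W.{u}) (s : Set W.{u}) : Nm B :=
  fam (fun ε : Set.Iio γ => tyo ε.1) (fun ε => bitn (ε.1 ∈ s))

theorem tyo_lt {γ δ : W.{u}} : tyo γ < tyo δ ↔ γ < δ := Ordinal.typein_lt_typein _
theorem tyo_inj {γ δ : W.{u}} (h : tyo γ = tyo δ) : γ = δ := Ordinal.typein_injective _ h

theorem tyo_surj {η : Ordinal.{u}} (h : η < Ordinal.omega 1) : ∃ ε : W.{u}, tyo ε = η := by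
  have h1 : η < Ordinal.type (α := W.{u}) (· < ·) := by
    rw [Ordinal.type_toType]; exact h
  exact ⟨_, Ordinal.typein_enum _ h1⟩

theorem tyo_surj' {γ : W.{u}} {η : Ordinal.{u}} (h : η < tyo γ) : ∃ ε, ε < γ ∧ tyo ε = η := by
  obtain ⟨ε, rfl⟩ := tyo_surj (h.trans (og_lt γ))
  exact ⟨ε, tyo_lt.1 h, rfl⟩

theorem ball_W (γ : W.{u}) (p : B) (R : ∀ U : Ult B, Mo U → Prop)
    [∀ x, Clp (fun U => R U (cl U x))]
    (h : ∀ ε < γ, ∀ U, p ∈ U.s → R U (cl U (ordn (tyo ε)))) :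
    ∀ U, p ∈ U.s → ∀ v, El U v (cl U (ordn (tyo γ))) → R U v := by
  refine ball_ord _ p R fun β hβ U hU => ?_
  obtain ⟨ε, hε, rfl⟩ := tyo_surj' hβ
  exact h ε hε U hU

theorem ball_w1 (p : B) (R : ∀ U : Ult B, Mo U → Prop)
    [∀ x, Clp (fun U => R U (cl U x))]
    (h : ∀ ε : W.{u}, ∀ U, p ∈ U.s → R U (cl U (ordn (tyo ε)))) :
    ∀ U, p ∈ U.s → ∀ v, El U v (cl U (ordn (Ordinal.omega 1))) → R U v := by
  refine ball_ord _ p R fun β hβ U hU => ?_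
  obtain ⟨ε, rfl⟩ := tyo_surj hβ
  exact h ε U hU

theorem nd_val {γ ε : W.{u}} (s : Set W.{u}) (h : ε < γ) (U : Ult B) :
    FunVal (El U) (cl U (nd γ s)) (cl U (ordn (tyo ε))) (cl U (bitn (ε ∈ s))) :=
  fam_val (fun ε : Set.Iio γ => tyo ε.1) (fun ε => bitn (ε.1 ∈ s)) ⟨ε, h⟩ U

theorem nd_fun (γ : W.{u}) (s : Set W.{u}) (U : Ult B) (x y y' : Mo U)
    (h : FunVal (El U) (cl U (nd γ s)) x y) (h' : FunVal (El U) (cl U (nd γ s)) x y') : y = y' :=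
  fam_functional (fun ε : Set.Iio γ => tyo ε.1) (fun a b h => Subtype.ext (tyo_inj h)) _ U x y y' h h'

theorem nd_dom (γ : W.{u}) (s : Set W.{u}) (U : Ult B) :
    HasDomV (El U) (cl U (nd γ s)) (cl U (ordn (tyo γ))) := by
  intro v
  constructor
  · rintro ⟨y, hy⟩
    exact fam_ball _ _ ⊤ (fun U v y => El U v (cl U (ordn (tyo γ))))
      (fun j U _ => mem_ordn U (tyo_lt.2 j.2)) U U.top_mem v y hy
  · intro hv
    exact ball_W γ ⊤ (fun U v => ∃ y, FunVal (El U) (cl U (nd γ s)) v y)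
      (fun ε hε U _ => ⟨_, nd_val s hε U⟩) U U.top_mem v hv

theorem nd_func (γ : W.{u}) (s : Set W.{u}) (U : Ult B) :
    IsFuncInto (El U) (cl U (nd γ s)) (cl U (ordn (tyo γ))) (cl U (ordn 2)) := by
  refine ⟨⟨fam_pair _ _ U, nd_fun γ s U, nd_dom γ s U⟩, fun x y h => ?_⟩
  exact fam_ball _ _ ⊤ (fun U v y => El U y (cl U (ordn 2)))
      (fun j U _ => bitn_two U _) U U.top_mem x y h

theorem nd_node (γ : W.{u}) (s : Set W.{u}) (U : Ult B) :
    IsNodeV (El U) (cl U (ordn (Ordinal.omega 1))) (cl U (nd γ s)) :=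
  ⟨_, _, mem_ordn U (og_lt γ), ord_ordn U _, (two_iff U _).2 rfl, nd_func γ s U⟩

theorem dom_unique (U : Ult B) {x a a' : Mo U} (h : HasDomV (El U) x a) (h' : HasDomV (El U) x a') :
    a = a' := nm_ext U _ _ fun z => (h z).symm.trans (h' z)

theorem nd_dom_eq {γ γ' : W.{u}} {s : Set W.{u}} (U : Ult B)
    (h : HasDomV (El U) (cl U (nd γ s)) (cl U (ordn (tyo γ')))) : γ = γ' :=
  tyo_inj (ordn_inj U (dom_unique U (nd_dom γ s U) h))

theorem funval_sub (U : Ult B) {f g x y : Mo U} (h : SubV (El U) f g) (h1 : FunVal (El U) f x y) :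
    FunVal (El U) g x y := by
  obtain ⟨p, hp, h2⟩ := h1
  exact ⟨p, h p hp, h2⟩

theorem nd_sub {γ γ' : W.{u}} {s s' : Set W.{u}} (U : Ult B)
    (h : SubV (El U) (cl U (nd γ s)) (cl U (nd γ' s'))) :
    γ ≤ γ' ∧ ∀ ε < γ, (ε ∈ s ↔ ε ∈ s') := by
  have h1 : ∀ ε < γ, ε < γ' := by
    intro ε hε
    have := funval_sub U h (nd_val s hε U)
    have := (nd_dom γ' s' U _).1 ⟨_, this⟩
    exact tyo_lt.1 ((mem_ordn_iff U).1 this)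
  refine ⟨le_of_not_gt fun hlt => lt_irrefl _ (h1 _ hlt), fun ε hε => ?_⟩
  exact bitn_inj U (nd_fun γ' s' U _ _ _ (funval_sub U h (nd_val s hε U)) (nd_val s' (h1 ε hε) U))

theorem nd_sub' {γ γ' : W.{u}} {s s' : Set W.{u}} (h : γ ≤ γ') (h' : ∀ ε < γ, (ε ∈ s ↔ ε ∈ s')) (U : Ult B) :
    SubV (El U) (cl U (nd γ s)) (cl U (nd γ' s')) := by
  intro z hz
  refine ball' _ _ (fun U z => El U z (cl U (nd γ' s'))) (fun i V _ => ?_) U z hz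
  have e : (bitn (i.1 ∈ s) : Nm B) = bitn (i.1 ∈ s') := by rw [h' i.1 i.2]
  have := El_mk V (fun ε : Set.Iio γ' => (opn (ordn (tyo ε.1)) (bitn (ε.1 ∈ s')) : Nm B)) (fun _ => ⊤)
    ⟨i.1, lt_of_lt_of_le i.2 h⟩ V.top_mem
  dsimp only at this ⊢
  rw [e]
  exact this

theorem nd_eq {γ : W.{u}} {s s' : Set W.{u}} (h' : ∀ ε < γ, (ε ∈ s ↔ ε ∈ s')) (U : Ult B) :
    cl U (nd γ s) = cl U (nd γ s') :=
  nm_ext U _ _ fun z => ⟨nd_sub' le_rfl h' U z, nd_sub' le_rfl (fun ε h => (h' ε h).symm) U z⟩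

theorem nd_inj {γ γ' : W.{u}} {s s' : Set W.{u}} (U : Ult B)
    (h : cl U (nd γ s) = cl U (nd γ' s')) : γ = γ' ∧ ∀ ε < γ, (ε ∈ s ↔ ε ∈ s') := by
  have h1 := nd_sub U (s := s) (s' := s') (by rw [h]; exact fun z hz => hz : SubV (El U) (cl U (nd γ s)) (cl U (nd γ' s')))
  have h2 := nd_sub U (s := s') (s' := s) (by rw [h]; exact fun z hz => hz : SubV (El U) (cl U (nd γ' s')) (cl U (nd γ s)))
  exact ⟨le_antisymm h1.1 h2.1, h1.2⟩

/-- a function on `γ` into 2 whose values are decided is a `nd` -/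
theorem eq_nd (γ : W.{u}) (s : Set W.{u}) (x : Nm B) (p : B)
    (h1 : ∀ U : Ult B, p ∈ U.s → IsFuncInto (El U) (cl U x) (cl U (ordn (tyo γ))) (cl U (ordn 2)))
    (h2 : ∀ U : Ult B, p ∈ U.s → ∀ ε < γ,
      (FunVal (El U) (cl U x) (cl U (ordn (tyo ε))) (cl U (ordn 1)) ↔ ε ∈ s)) :
    ∀ U : Ult B, p ∈ U.s → cl U x = cl U (nd γ s) := by
  have h3 : ∀ U : Ult B, p ∈ U.s → ∀ ε < γ,
      FunVal (El U) (cl U x) (cl U (ordn (tyo ε))) (cl U (bitn (ε ∈ s))) := by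
    intro U hU ε hε
    by_cases h : ε ∈ s
    · rw [bitn_t h]; exact (h2 U hU ε hε).2 h
    · rw [bitn_f h]
      obtain ⟨y, hy1, hy2⟩ := func_val U (h1 U hU) (mem_ordn U (tyo_lt.2 hε))
      rcases (mem_two U y).1 hy1 with rfl | rfl
      · exact hy2
      · exact absurd ((h2 U hU ε hε).1 hy2) h
  intro U hU
  have hsub : SubV (El U) (cl U (nd γ s)) (cl U x) := by
    intro z hz
    refine ball _ _ p (fun U z => El U z (cl U x)) (fun i V hV _ => ?_) U hU z hz
    obtain ⟨w, hw, hw2⟩ := h3 V hV i.1 i.2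
    rw [opair_unique V (opn_spec _ _ V) hw2]
    exact hw
  refine nm_ext U _ _ fun z => ⟨fun hz => ?_, hsub z⟩
  obtain ⟨a, y, hz2⟩ := (h1 U hU).1.1 z hz
  have ha := ((h1 U hU).1.2.2 a).1 ⟨y, z, hz, hz2⟩
  obtain ⟨y', z', hz', hz2'⟩ := (nd_dom γ s U a).2 ha
  have e : y = y' := (h1 U hU).1.2.1 a y y' ⟨z, hz, hz2⟩ ⟨z', hsub z' hz', hz2'⟩
  rw [opair_unique U hz2 (e ▸ hz2')]
  exact hz'

end Nodes

section Decide
variable {Idx : Type u} {X : Idx → Type u} [∀ i, Inhabited (X i)] {al : Idx → Option W.{u}}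

/-- deciding countably many statements -/
theorem decide_c {ι : Type*} [Countable ι] (φ : ι → Ult (RO (Cond X al)) → Prop) [∀ i, Clp (φ i)]
    (p : Cond X al) : ∃ q ≤ p, ∀ i, Fo q (φ i) ∨ Fo q (fun U => ¬ φ i U) := by
  refine distrib_c (fun i q => Fo q (φ i) ∨ Fo q (fun U => ¬ φ i U)) ?_ p ?_
  · rintro i p q hq (h | h)
    · exact Or.inl (fo_mono hq h)
    · exact Or.inr (fo_mono hq h)
  · intro i q _
    exact fo_dec (φ i) q

theorem decide_c' {ι : Type*} [Countable ι] (φ : ι → Ult (RO (Cond X al)) → Prop) [∀ i, Clp (φ i)]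
    (p : Cond X al) : ∃ q ≤ p, ∃ s : Set ι, Fo q (fun U => ∀ i, φ i U ↔ i ∈ s) := by
  obtain ⟨q, hq, h⟩ := decide_c φ p
  refine ⟨q, hq, {i | Fo q (φ i)}, fun U hU i => ⟨fun h1 => (h i).resolve_right fun h2 => h2 U hU h1, fun h1 => h1 U hU⟩⟩

theorem fo_node {p : Cond X al} {x : Nm (RO (Cond X al))}
    (h : Fo p (fun U => IsNodeV (El U) (cl U (ordn (Ordinal.omega 1))) (cl U x))) :
    ∃ q ≤ p, ∃ γ s, Fo q (fun U => cl U x = cl U (nd γ s)) := by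
  obtain ⟨q, hq, η, hη, h1⟩ := fo_bex_ord (α := Ordinal.omega 1) (p := p)
    (fun U a => IsFuncInto (El U) (cl U x) a (cl U (ordn 2))) (by
    intro U hU
    obtain ⟨a, t, h1, h2, h3, h4⟩ := h U hU
    rw [two_iff] at h3
    subst h3
    exact ⟨a, h1, h4⟩)
  obtain ⟨γ, rfl⟩ := tyo_surj hη
  have : Countable (Set.Iio γ) := (W_Iio γ).to_subtype
  obtain ⟨r, hr, s, h2⟩ := decide_c' (fun (ε : Set.Iio γ) U =>
    FunVal (El U) (cl U x) (cl U (ordn (tyo ε.1))) (cl U (ordn 1))) q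
  refine ⟨r, hr.trans hq, γ, Subtype.val '' s, ?_⟩
  refine eq_nd γ _ x (io r) (fo_mono hr h1) ?_
  intro U hU ε hε
  rw [h2 U hU ⟨ε, hε⟩]
  constructor
  · intro h; exact ⟨_, h, rfl⟩
  · rintro ⟨⟨ε', h'⟩, h3, rfl⟩; exact h3

end Decide
end JK

namespace JK
open FirstOrder FirstOrder.Language
universe u

section Gen
variable {B : Type u} [CompleteBooleanAlgebra B]

theorem func_eq_of_sub (U : Ult B) {x y a t : Mo U} (h : SubV (El U) x y) (hy : IsFuncInto (El U) y a t)
    (hx : HasDomV (El U) x a) : x = y := by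
  refine nm_ext U _ _ fun z => ⟨h z, fun hz => ?_⟩
  obtain ⟨v, w, hvw⟩ := hy.1.1 z hz
  obtain ⟨w', z', hz', hz2⟩ := (hx v).2 ((hy.1.2.2 v).1 ⟨w, z, hz, hvw⟩)
  have e : w = w' := hy.1.2.1 v w w' ⟨z, hz, hvw⟩ ⟨z', h z' hz', hz2⟩
  rw [opair_unique U hvw (e ▸ hz2)]
  exact hz'

theorem chain_max (U : Ult B) {t b c : Mo U} (hb : IsBranchV (El U) t b) (hbc : SubV (El U) b c)
    (hc : ∀ x y, El U x c → El U y c → (SubV (El U) x y ∨ SubV (El U) y x))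
    (hd : ∀ x, El U x c → ∃ a s, IsFuncInto (El U) x a s ∧ ∃ y, El U y t ∧ HasDomV (El U) y a) :
    b = c := by
  refine nm_ext U _ _ fun x => ⟨hbc x, fun hx => ?_⟩
  obtain ⟨a, s, h1, h2⟩ := hd x hx
  obtain ⟨y, hy, hy2⟩ := hb.2.2 a h2
  obtain ⟨a', s', h1', y', hy', hy2'⟩ := hd y (hbc y hy)
  have ea : a = a' := dom_unique U hy2 h1'.1.2.2
  subst ea
  rcases hc x y hx (hbc y hy) with h | h
  · rw [func_eq_of_sub U h h1' h1.1.2.2]; exact hy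
  · rw [← func_eq_of_sub U h h1 hy2]; exact hy

end Gen

section GenP
variable {P : Type u} [Preorder P]

theorem fo_pure {p : P} {Q : Prop} (h : Fo p (fun _ => Q)) : Q := by
  by_contra hQ
  exact fo_false (p := p) fun U hU => hQ (h U hU)

theorem val_mono {Q Q' : P → Prop} (h : ∀ p, Q p → Q' p) (U : Ult (RO P)) (hU : val Q ∈ U.s) :
    val Q' ∈ U.s := by
  refine all_of_fo (fun U => val Q ∈ U.s → val Q' ∈ U.s) (fun p => ?_) U hU
  rcases fo_dec (fun U => val Q ∈ U.s) p with ⟨q, hq, h1 | h1⟩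
  · refine ⟨q, hq, fun V hV _ => ?_⟩
    have : Fo q (fun U => val Q' ∈ U.s) := by
      rw [fo_val] at h1 ⊢
      intro r hr
      obtain ⟨r', hr', h2⟩ := h1 r hr
      exact ⟨r', hr', fun r2 h3 => h _ (h2 r2 h3)⟩
    exact this V hV
  · exact ⟨q, hq, fun V hV h2 => absurd h2 (h1 V hV)⟩

theorem val_two {Q Q' : P → Prop} (U : Ult (RO P)) (hU : val Q ∈ U.s) (hU' : val Q' ∈ U.s) :
    ∃ p, Q p ∧ Q' p := by
  by_contra hcon
  refine all_of_fo (fun V => ¬ (val Q ∈ V.s ∧ val Q' ∈ V.s)) (fun p => ?_) U ⟨hU, hU'⟩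
  by_contra hc
  obtain ⟨q, hq, h⟩ := fo_em _ p (fun h => hc ⟨p, le_rfl, h⟩)
  have h1 : Fo q (fun V => val Q ∈ V.s) := fo_imp h fun U hU => (not_not.1 hU).1
  have h2 : Fo q (fun V => val Q' ∈ V.s) := fo_imp h fun U hU => (not_not.1 hU).2
  obtain ⟨r, hr, h3⟩ := (fo_val _ _).1 h1 q le_rfl
  obtain ⟨r', hr', h4⟩ := (fo_val _ _).1 h2 r hr
  exact hcon ⟨r', h3 r' hr', h4 r' le_rfl⟩

theorem fo_val_of {Q : P → Prop} {p : P} (h : ∀ q ≤ p, Q q) : Fo p (fun U => val Q ∈ U.s) := by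
  rw [fo_val]
  exact fun q hq => ⟨q, le_rfl, fun r hr => h r (hr.trans hq)⟩

end GenP

section Tree
variable {Idx : Type u} {X : Idx → Type u} [∀ i, Inhabited (X i)] {al : Idx → Option W.{u}}

/-- the tree of never killed nodes -/
noncomputable def Tn (α : W.{u}) : Nm (RO (Cond X al)) :=
  ⟨W.{u} × Set W.{u}, fun x => nd x.1 x.2,
    fun x => val fun p => x.1 ≤ p.δ ∧ ¬ p.Z α x.1 (x.2 ∩ Set.Iio x.1)⟩

def bQ (i : Idx) (x : W.{u} × Set W.{u}) (p : Cond X al) : Prop :=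
  i ∈ p.S ∧ x.1 ≤ p.δ ∧ ∀ ε < x.1, (ε ∈ x.2 ↔ p.v i ε ≠ default)

noncomputable def bn (i : Idx) : Nm (RO (Cond X al)) :=
  ⟨W.{u} × Set W.{u}, fun x => nd x.1 x.2, fun x => val (bQ i x)⟩

noncomputable def brn (s : Set W.{u}) : Nm (RO (Cond X al)) :=
  ⟨W.{u}, fun γ => nd γ s, fun _ => ⊤⟩

theorem inter_congr {γ : W.{u}} {s s' : Set W.{u}} (h : ∀ ε < γ, (ε ∈ s ↔ ε ∈ s')) :
    s ∩ Set.Iio γ = s' ∩ Set.Iio γ := by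
  ext ε
  constructor
  · rintro ⟨h1, h2⟩; exact ⟨(h ε h2).1 h1, h2⟩
  · rintro ⟨h1, h2⟩; exact ⟨(h ε h2).2 h1, h2⟩

theorem Tn_mem {α γ : W.{u}} {s : Set W.{u}} {p : Cond X al}
    (h : Fo p (fun U => El U (cl U (nd γ s)) (cl U (Tn α)))) (hγ : γ ≤ p.δ) :
    ¬ p.Z α γ (s ∩ Set.Iio γ) := by
  obtain ⟨q, hq, ⟨γ', s'⟩, h1, h2⟩ := fo_mem _ _ h
  have h3 := fo_pure (fo_imp h2 fun U hU => nd_inj U hU)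
  obtain ⟨rfl, h3⟩ := h3
  obtain ⟨r, hr, h4⟩ := (fo_val _ _).1 h1 q le_rfl
  intro hZ
  refine (h4 r le_rfl).2 ?_
  dsimp only
  rw [← inter_congr h3]
  exact ((hr.trans hq).2.2.2 _ _ _ hγ).2 hZ

theorem Tn_mem' {α γ : W.{u}} {s : Set W.{u}} (U : Ult (RO (Cond X al)))
    (h : val (fun p : Cond X al => γ ≤ p.δ ∧ ¬ p.Z α γ (s ∩ Set.Iio γ)) ∈ U.s) :
    El U (cl U (nd γ s)) (cl U (Tn α)) :=
  El_mk U (fun x : W.{u} × Set W.{u} => nd x.1 x.2) _ (γ, s) h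

noncomputable def up (p : Cond X al) (T : Set Idx) (hT : T.Countable) (δ : W.{u}) : Cond X al :=
  extend p T hT (max p.δ δ) (le_max_left _ _) (fun _ _ => default)

theorem up_le (p : Cond X al) (T : Set Idx) (hT : T.Countable) (δ : W.{u}) : up p T hT δ ≤ p :=
  extend_le _ _ _ _ _ _

theorem up_δ (p : Cond X al) (T : Set Idx) (hT : T.Countable) (δ : W.{u}) : δ ≤ (up p T hT δ).δ :=
  le_max_right _ _

theorem up_S (p : Cond X al) (T : Set Idx) (hT : T.Countable) (δ : W.{u}) : T ⊆ (up p T hT δ).S :=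
  fun _ h => Or.inr h

theorem Tn_zero (α γ : W.{u}) (U : Ult (RO (Cond X al))) : El U (cl U (nd γ ∅)) (cl U (Tn α)) := by
  refine all_of_fo (fun U => El U (cl U (nd γ ∅)) (cl U (Tn α))) (fun p => ?_) U
  refine ⟨up p ∅ Set.countable_empty γ, up_le _ _ _ _, fun V hV => ?_⟩
  refine Tn_mem' V (fo_val_of (fun q hq => ?_) V hV)
  refine ⟨(up_δ _ _ _ _).trans hq.1, fun hZ => ?_⟩
  exact not_cof' (by simp) (q.hZ _ _ _ hZ).2.2

theorem Tn_level (α : W.{u}) (U : Ult (RO (Cond X al))) (a : Mo U)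
    (h : ∃ x, El U x (cl U (Tn α)) ∧ HasDomV (El U) x a) (R : ∀ U : Ult (RO (Cond X al)), Mo U → Prop)
    [∀ x, Clp (fun U => R U (cl U x))] (hR : ∀ (γ : W.{u}) U, R U (cl U (ordn (tyo γ)))) : R U a := by
  obtain ⟨x, hx, hxa⟩ := h
  refine ball' (fun x : W.{u} × Set W.{u} => nd x.1 x.2) _ (fun U x => ∀ a, HasDomV (El U) x a → R U a)
    (fun i V _ a ha => ?_) U x hx a hxa
  rw [dom_unique V ha (nd_dom _ _ V)]
  exact hR _ V

theorem Tn_tree (α : W.{u}) (U : Ult (RO (Cond X al))) :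
    IsTreeV (El U) (cl U (ordn (Ordinal.omega 1))) (cl U (Tn α)) := by
  intro x hx
  exact ball' (fun x : W.{u} × Set W.{u} => nd x.1 x.2) _
    (fun U x => IsNodeV (El U) (cl U (ordn (Ordinal.omega 1))) x) (fun i V _ => nd_node _ _ V) U x hx

theorem bn_mem {i : Idx} {p : Cond X al} {γ : W.{u}} {s : Set W.{u}} (hi : i ∈ p.S) (hγ : γ ≤ p.δ)
    (hs : ∀ ε < γ, (ε ∈ s ↔ p.v i ε ≠ default)) :
    Fo p (fun U => El U (cl U (nd γ s)) (cl U (bn i))) := by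
  intro U hU
  refine El_mk U (fun x : W.{u} × Set W.{u} => nd x.1 x.2) _ (γ, s) ?_
  refine fo_val_of (p := p) (fun q hq => ?_) U hU
  refine ⟨hq.2.1 hi, hγ.trans hq.1, fun ε hε => ?_⟩
  rw [hq.2.2.1 i hi ε (hε.trans_le hγ)]
  exact hs ε hε

theorem bn_branch {i : Idx} {α : W.{u}} (hi : al i = some α) (U : Ult (RO (Cond X al))) :
    IsBranchV (El U) (cl U (Tn α)) (cl U (bn i)) := by
  refine ⟨?_, ?_, ?_⟩
  · intro x hx
    refine ball' (fun x : W.{u} × Set W.{u} => nd x.1 x.2) _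
      (fun U x => El U x (cl U (Tn α))) (fun x V hV => ?_) U x hx
    refine Tn_mem' V (val_mono (fun p hp => ?_) V hV)
    refine ⟨hp.2.1, fun hZ => p.hav i hp.1 α hi x.1 ?_⟩
    convert hZ using 1
    exact (inter_congr fun ε hε => hp.2.2 ε hε).symm
  · intro x y hx hy
    have key : ∀ x : W.{u} × Set W.{u}, ∀ V : Ult (RO (Cond X al)), ∀ y, El V y (cl V (bn i)) →
        val (bQ i x) ∈ V.s → (SubV (El V) (cl V (nd x.1 x.2)) y ∨ SubV (El V) y (cl V (nd x.1 x.2))) := by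
      intro x
      refine ball' (fun x : W.{u} × Set W.{u} => nd x.1 x.2) (fun x => val (bQ i x))
        (fun V y => val (bQ i x) ∈ V.s →
          (SubV (El V) (cl V (nd x.1 x.2)) y ∨ SubV (El V) y (cl V (nd x.1 x.2)))) (fun y V hV2 hV => ?_)
      obtain ⟨p, h1, h2⟩ := val_two V hV hV2
      rcases le_total x.1 y.1 with h | h
      · exact Or.inl (nd_sub' h (fun ε hε => (h1.2.2 ε hε).trans (h2.2.2 ε (hε.trans_le h)).symm) V)
      · exact Or.inr (nd_sub' h (fun ε hε => (h2.2.2 ε hε).trans (h1.2.2 ε (hε.trans_le h)).symm) V)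
    exact ball' (fun x : W.{u} × Set W.{u} => nd x.1 x.2) (fun x => val (bQ i x))
      (fun U x => ∀ y, El U y (cl U (bn i)) → (SubV (El U) x y ∨ SubV (El U) y x))
      (fun x V hV y hy => key x V y hy hV) U x hx y hy
  · intro a ha
    refine Tn_level α U a ha (fun U a => ∃ x, El U x (cl U (bn i)) ∧ HasDomV (El U) x a) ?_
    intro γ
    refine all_of_fo _ fun p => ?_
    refine ⟨up p {i} (Set.countable_singleton i) γ, up_le _ _ _ _, fun V hV => ?_⟩
    refine ⟨_, bn_mem (s := bits (up p {i} (Set.countable_singleton i) γ) i)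
      (up_S p {i} (Set.countable_singleton i) γ (Set.mem_singleton i)) (up_δ _ _ _ _)
      (fun ε hε => Iff.rfl) V hV, nd_dom _ _ V⟩

theorem bn_ne {i j : Idx} {α : W.{u}} (hi : al i = some α) (hij : i ≠ j)
    (hne : ∃ x : X i, x ≠ default) :
    ∀ U : Ult (RO (Cond X al)), cl U (bn i) ≠ cl U (bn j) := by
  refine all_of_fo _ fun p => ?_
  obtain ⟨x, hx⟩ := hne
  obtain ⟨δ, hδ⟩ := W_succ p.δ
  classical
  have hT : ({i, j} : Set Idx).Countable := (Set.countable_singleton j).insert i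
  let f : ∀ k, W.{u} → X k := fun k _ => if h : k = i then h ▸ x else default
  refine ⟨extend p {i, j} hT δ hδ.le f, extend_le _ _ _ _ _ _, ?_⟩
  set q := extend p {i, j} hT δ hδ.le f with hq
  have hi2 : i ∈ ({i, j} : Set Idx) := Or.inl rfl
  have hj2 : j ∈ ({i, j} : Set Idx) := Or.inr rfl
  have h1 : q.v i p.δ = x := by
    rw [hq, extend_v _ _ _ _ _ _ i hi2 _ le_rfl hδ]
    simp [f]
  have h2 : q.v j p.δ = default := by
    rw [hq, extend_v _ _ _ _ _ _ j hj2 _ le_rfl hδ]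
    simp [f, Ne.symm hij]
  have hiS : i ∈ q.S := Or.inr hi2
  have hjS : j ∈ q.S := Or.inr hj2
  intro V hV he
  have h3 := bn_mem (s := bits q i) hiS (show δ ≤ q.δ from le_rfl) (fun ε hε => Iff.rfl) V hV
  have h4 := bn_mem (s := bits q j) hjS (show δ ≤ q.δ from le_rfl) (fun ε hε => Iff.rfl) V hV
  dsimp only at h3 h4
  rw [← he] at h4
  have h5 : p.δ ∈ bits q i ↔ p.δ ∈ bits q j := by
    rcases (bn_branch hi V).2.1 _ _ h3 h4 with h | h
    · exact (nd_sub V h).2 _ hδ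
    · exact ((nd_sub V h).2 _ hδ).symm
  have h6 : p.δ ∈ bits q i := by
    change q.v i p.δ ≠ default
    rw [h1]; exact hx
  exact h5.1 h6 h2

/-- The branch analysis: data about a name `b` forced to be a branch of `t`. -/
theorem br_lin {t b : Nm (RO (Cond X al))} {r : Cond X al}
    (hb : Fo r (fun U => IsBranchV (El U) (cl U t) (cl U b)))
    {γ γ' : W.{u}} {s s' : Set W.{u}} (hγ : γ ≤ γ')
    (h1 : Fo r (fun U => El U (cl U (nd γ s)) (cl U b)))
    (h2 : Fo r (fun U => El U (cl U (nd γ' s')) (cl U b))) :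
    ∀ ε < γ, (ε ∈ s ↔ ε ∈ s') := by
  refine fo_pure (p := r) fun U hU => ?_
  rcases (hb U hU).2.1 _ _ (h1 U hU) (h2 U hU) with h | h
  · exact (nd_sub U h).2
  · have h3 := nd_sub U h
    have e : γ = γ' := le_antisymm hγ h3.1
    subst e
    exact fun ε hε => (h3.2 ε hε).symm

theorem br_dec {t b : Nm (RO (Cond X al))} {r : Cond X al}
    (ht : Fo r (fun U => IsTreeV (El U) (cl U (ordn (Ordinal.omega 1))) (cl U t)))
    (hb : Fo r (fun U => IsBranchV (El U) (cl U t) (cl U b))) {γ : W.{u}}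
    (hl : Fo r (fun U => ∃ x, El U x (cl U t) ∧ HasDomV (El U) x (cl U (ordn (tyo γ))))) :
    ∃ q ≤ r, ∃ s, Fo q (fun U => El U (cl U (nd γ s)) (cl U b)) := by
  obtain ⟨τ, hτ⟩ := fo_exi (p := r) (fun U x => El U x (cl U b) ∧ HasDomV (El U) x (cl U (ordn (tyo γ))))
    (fun U hU => (hb U hU).2.2 _ (hl U hU))
  obtain ⟨q, hq, γ', s, h1⟩ := fo_node (p := r) (x := τ)
    (fun U hU => ht U hU _ ((hb U hU).1 _ (hτ U hU).1))
  have e : γ' = γ := fo_pure (p := q) fun U hU => by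
    have := (fo_mono hq hτ U hU).2
    rw [h1 U hU] at this
    exact nd_dom_eq U this
  subst e
  refine ⟨q, hq, s, fun U hU => ?_⟩
  dsimp only
  rw [← h1 U hU]
  exact (fo_mono hq hτ U hU).1

end Tree
end JK

namespace JK
open FirstOrder FirstOrder.Language
universe u

theorem W_sup (d : ℕ → W.{u}) : ∃ δ, (∀ n, d n ≤ δ) ∧ ∀ β < δ, ∃ n, β < d n := by
  obtain ⟨δ0, h0⟩ := W_bdd (Set.range d) (Set.countable_range d)
  have hne : {δ : W.{u} | ∀ n, d n ≤ δ}.Nonempty := ⟨δ0, fun n => (h0 _ ⟨n, rfl⟩).le⟩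
  refine ⟨WellFounded.min wellFounded_lt _ hne, WellFounded.min_mem wellFounded_lt _ hne, fun β hβ => ?_⟩
  by_contra hc
  push Not at hc
  exact WellFounded.not_lt_min wellFounded_lt _ (show β ∈ {δ : W.{u} | ∀ n, d n ≤ δ} from hc) hβ

section Tree
variable {Idx : Type u} {X : Idx → Type u} [∀ i, Inhabited (X i)] {al : Idx → Option W.{u}}

/-- `b ⊆ c` forced if it is densely so -/
theorem fo_sub {α : W.{u}} {b c : Nm (RO (Cond X al))} {q : Cond X al}
    (hb : Fo q (fun U => SubV (El U) (cl U b) (cl U (Tn α))))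
    (h : ∀ r ≤ q, ∀ γ s, Fo r (fun U => El U (cl U (nd γ s)) (cl U b)) →
      ∃ r' ≤ r, Fo r' (fun U => El U (cl U (nd γ s)) (cl U c))) :
    Fo q (fun U => SubV (El U) (cl U b) (cl U c)) := by
  intro U hU v hv
  refine ball (fun x : W.{u} × Set W.{u} => nd x.1 x.2) _ (io q)
    (fun U v => El U v (cl U b) → El U v (cl U c)) (fun x V hV _ => ?_) U hU v (hb U hU v hv) hv
  have : Fo q (fun V => El V (cl V (nd x.1 x.2)) (cl V b) → El V (cl V (nd x.1 x.2)) (cl V c)) := by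
    refine fo_dense fun r hr => ?_
    obtain ⟨r1, hr1, h1 | h1⟩ := fo_dec (fun V => El V (cl V (nd x.1 x.2)) (cl V b)) r
    · obtain ⟨r2, hr2, h2⟩ := h r1 (hr1.trans hr) _ _ h1
      exact ⟨r2, hr2.trans hr1, fo_imp h2 fun V hV _ => hV⟩
    · exact ⟨r1, hr1, fo_imp h1 fun V hV h2 => absurd h2 hV⟩
  exact this V hV

set_option maxHeartbeats 1000000 in
theorem Tn_cover (α : W.{u}) (U : Ult (RO (Cond X al))) (b : Mo U)
    (hb : IsBranchV (El U) (cl U (Tn α)) b) :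
    El U b (cl U ⟨{i // al i = some α} ⊕ Set W.{u}, Sum.elim (fun i => bn i.1) brn, fun _ => ⊤⟩) := by
  obtain ⟨b, rfl⟩ := cl_surj U b
  set C : Nm (RO (Cond X al)) :=
    ⟨{i // al i = some α} ⊕ Set W.{u}, Sum.elim (fun i => bn i.1) brn, fun _ => ⊤⟩ with hC
  by_contra hcon
  refine all_of_fo (fun U => ¬ (IsBranchV (El U) (cl U (Tn α)) (cl U b) ∧ ¬ El U (cl U b) (cl U C)))
    (fun p => ?_) U ⟨hb, hcon⟩
  by_contra hp
  obtain ⟨p, -, h0⟩ := fo_em _ p (fun h => hp ⟨p, le_rfl, h⟩)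
  clear hb hcon hp
  have hbr : ∀ q ≤ p, Fo q (fun U => IsBranchV (El U) (cl U (Tn α)) (cl U b)) :=
    fun q hq => fo_mono hq (fo_imp h0 fun U hU => (not_not.1 hU).1)
  have hnb : ∀ q ≤ p, ∀ i, al i = some α → ¬ Fo q (fun U => cl U b = cl U (bn i)) := by
    intro q hq i hi h
    refine fo_false (p := q) fun V hV => (not_not.1 (fo_mono hq h0 V hV)).2 ?_
    rw [h V hV]
    exact El_mk V (Sum.elim (fun i : {i // al i = some α} => bn i.1) brn) (fun _ => ⊤) (Sum.inl ⟨i, hi⟩) V.top_mem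
  have hnbr : ∀ q ≤ p, ∀ s, ¬ Fo q (fun U => cl U b = cl U (brn s)) := by
    intro q hq s h
    refine fo_false (p := q) fun V hV => (not_not.1 (fo_mono hq h0 V hV)).2 ?_
    rw [h V hV]
    exact El_mk V (Sum.elim (fun i : {i // al i = some α} => bn i.1) brn) (fun _ => ⊤) (Sum.inr s) V.top_mem
  let F (q : Cond X al) (γ : W.{u}) (s : Set W.{u}) : Prop :=
    Fo q (fun U => El U (cl U (nd γ s)) (cl U b))
  have Fmono : ∀ {q r : Cond X al} {γ s}, r ≤ q → F q γ s → F r γ s := fun h h' => fo_mono h h'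
  have c1 : ∀ q ≤ p, ∀ γ, ∃ r ≤ q, ∃ s, F r γ s := by
    intro q hq γ
    exact br_dec (t := Tn α) (b := b) (r := q) (fun U _ => Tn_tree α U) (hbr q hq)
      (fun U _ => ⟨_, Tn_zero α γ U, nd_dom _ _ U⟩)
  have c2 : ∀ q ≤ p, ∀ γ γ' s s', γ ≤ γ' → F q γ s → F q γ' s' → ∀ ε < γ, (ε ∈ s ↔ ε ∈ s') :=
    fun q hq γ γ' s s' h h1 h2 => br_lin (hbr q hq) h h1 h2
  have c3 : ∀ q ≤ p, ∀ i, al i = some α → ∃ r ≤ q, i ∈ r.S ∧ ∃ γ s, F r γ s ∧ γ ≤ r.δ ∧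
      ∃ ε < γ, ¬ (ε ∈ s ↔ r.v i ε ≠ default) := by
    intro q hq i hi
    by_contra hc
    push Not at hc
    refine hnb q hq i hi ?_
    have hs : Fo q (fun U => SubV (El U) (cl U b) (cl U (bn i))) := by
      refine fo_sub (fo_imp (hbr q hq) fun U hU => hU.1) fun r hr γ s hF => ?_
      refine ⟨up r {i} (Set.countable_singleton i) γ, up_le _ _ _ _, ?_⟩
      have hi' := up_S r {i} (Set.countable_singleton i) γ (Set.mem_singleton i)
      exact bn_mem hi' (up_δ _ _ _ _) (hc _ ((up_le _ _ _ _).trans hr) hi' γ s (Fmono (up_le _ _ _ _) hF)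
        (up_δ _ _ _ _))
    intro V hV
    refine chain_max V (hbr q hq V hV) (hs V hV) (bn_branch hi V).2.1 fun x hx => ?_
    have h1 := (bn_branch hi V).1 x hx
    obtain ⟨a, t, -, -, -, h2⟩ := Tn_tree α V x h1
    exact ⟨a, t, h2, x, h1, h2.1.2.2⟩
  have c4 : ∀ q ≤ p, ∀ η, ∃ r ≤ q, ∃ γ s, F r γ s ∧ ∃ ε ∈ s, η ≤ ε ∧ ε < γ := by
    intro q hq η
    by_contra hc
    push Not at hc
    obtain ⟨r, hr, s0, h1⟩ := c1 q hq η
    refine hnbr r (hr.trans hq) (s0 ∩ Set.Iio η) ?_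
    have hs : Fo r (fun U => SubV (El U) (cl U b) (cl U (brn (s0 ∩ Set.Iio η)))) := by
      refine fo_sub (fo_imp (hbr r (hr.trans hq)) fun U hU => hU.1) fun r' hr' γ s hF => ?_
      refine ⟨r', le_rfl, fun V hV => ?_⟩
      have e : cl V (nd γ s) = cl V (nd γ (s0 ∩ Set.Iio η)) := by
        refine nd_eq (fun ε hε => ?_) V
        rcases lt_or_ge ε η with h | h
        · have h3 : ε ∈ s ↔ ε ∈ s0 := by
            rcases le_total γ η with h' | h'
            · exact c2 r' (hr'.trans (hr.trans hq)) _ _ _ _ h' hF (Fmono hr' h1) ε hε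
            · exact (c2 r' (hr'.trans (hr.trans hq)) _ _ _ _ h' (Fmono hr' h1) hF ε h).symm
          rw [h3]
          exact ⟨fun h4 => ⟨h4, h⟩, fun h4 => h4.1⟩
        · exact ⟨fun h3 => absurd hε (not_lt.2 (hc r' (hr'.trans hr) γ s hF ε h3 h)),
            fun h3 => absurd h3.2 (not_lt.2 h)⟩
      dsimp only
      rw [e]
      exact El_mk V (fun γ => nd γ (s0 ∩ Set.Iio η)) (fun _ => ⊤) γ V.top_mem
    intro V hV
    refine chain_max V (hbr r (hr.trans hq) V hV) (hs V hV) ?_ ?_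
    · have key : ∀ γ, ∀ V : Ult (RO (Cond X al)), ∀ y, El V y (cl V (brn (s0 ∩ Set.Iio η))) →
          (SubV (El V) (cl V (nd γ (s0 ∩ Set.Iio η))) y ∨ SubV (El V) y (cl V (nd γ (s0 ∩ Set.Iio η)))) := by
        intro γ
        refine ball' _ _ (fun V y => (SubV (El V) (cl V (nd γ (s0 ∩ Set.Iio η))) y ∨
          SubV (El V) y (cl V (nd γ (s0 ∩ Set.Iio η))))) fun γ' V _ => ?_
        rcases le_total γ γ' with h | h
        · exact Or.inl (nd_sub' h (fun _ _ => Iff.rfl) V)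
        · exact Or.inr (nd_sub' h (fun _ _ => Iff.rfl) V)
      intro x y hx hy
      exact ball' (fun γ => nd γ (s0 ∩ Set.Iio η)) (fun _ => ⊤)
        (fun U x => ∀ y, El U y (cl U (brn (s0 ∩ Set.Iio η))) → (SubV (El U) x y ∨ SubV (El U) y x))
        (fun γ V _ y hy => key γ V y hy) V x hx y hy
    · intro x hx
      refine ball' (fun γ => nd γ (s0 ∩ Set.Iio η)) (fun _ => ⊤)
        (fun U x => ∃ a s, IsFuncInto (El U) x a s ∧ ∃ y, El U y (cl U (Tn α)) ∧ HasDomV (El U) y a)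
        (fun γ V _ => ?_) V x hx
      exact ⟨_, _, nd_func γ _ V, _, Tn_zero α γ V, nd_dom _ _ V⟩
  -- one step
  have step : ∀ q : {q // q ≤ p}, ∃ r : {r // r ≤ p}, ∃ γ s, r.1 ≤ q.1 ∧ F r.1 γ s ∧ γ ≤ r.1.δ ∧ q.1.δ < γ ∧
      (∀ i ∈ q.1.S, al i = some α → ∃ ε < γ, ¬ (ε ∈ s ↔ r.1.v i ε ≠ default)) ∧
      ∃ ε ∈ s, q.1.δ ≤ ε ∧ ε < γ := by
    rintro ⟨q, hq⟩
    let ι := {i // i ∈ q.S ∧ al i = some α}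
    have hι : Countable ι := (q.hS.mono fun i (hi : i ∈ q.S ∧ al i = some α) => hi.1).to_subtype
    obtain ⟨r1, hr1, h1⟩ := distrib_c (ι := ι) (fun i r => i.1 ∈ r.S ∧ ∃ γ s, F r γ s ∧ γ ≤ r.δ ∧
      ∃ ε < γ, ¬ (ε ∈ s ↔ r.v i.1 ε ≠ default)) (by
        rintro i r r' hr ⟨h1, γ, s, h2, h3, ε, h4, h5⟩
        refine ⟨hr.2.1 h1, γ, s, Fmono hr h2, h3.trans hr.1, ε, h4, ?_⟩
        rw [hr.2.2.1 _ h1 ε (h4.trans_le h3)]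
        exact h5) q (fun i r hr => c3 r (hr.trans hq) i.1 i.2.2)
    have hr1p := hr1.trans hq
    choose h1S g gs h2 h3 e h4 h5 using h1
    obtain ⟨r2, hr2, γ0, s0, h6, e0, h7, h8, h9⟩ := c4 r1 hr1p q.δ
    obtain ⟨γ, hγ⟩ := W_bdd (Set.range g ∪ {γ0, q.δ}) ((Set.countable_range g).union
      ((Set.countable_singleton _).insert _))
    have hγ0 : γ0 < γ := hγ _ (Or.inr (Or.inl rfl))
    have hγq : q.δ < γ := hγ _ (Or.inr (Or.inr rfl))
    obtain ⟨r3, hr3, s, h10⟩ := c1 r2 (hr2.trans hr1p) γ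
    have hle : up r3 ∅ Set.countable_empty γ ≤ r1 := ((up_le _ _ _ _).trans hr3).trans hr2
    have hle3 : up r3 ∅ Set.countable_empty γ ≤ r2 := (up_le _ _ _ _).trans hr3
    have hF : F (up r3 ∅ Set.countable_empty γ) γ s := Fmono (up_le _ _ _ _) h10
    refine ⟨⟨up r3 ∅ Set.countable_empty γ, hle.trans hr1p⟩, γ, s, hle.trans hr1, hF, up_δ r3 ∅ Set.countable_empty γ, hγq, ?_, ?_⟩
    · intro i hi hα
      have hg : g ⟨i, hi, hα⟩ < γ := hγ _ (Or.inl ⟨_, rfl⟩)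
      refine ⟨e ⟨i, hi, hα⟩, (h4 ⟨i, hi, hα⟩).trans hg, ?_⟩
      have := c2 _ (hle.trans hr1p) _ _ _ _ hg.le (Fmono hle (h2 ⟨i, hi, hα⟩)) hF _ (h4 ⟨i, hi, hα⟩)
      rw [← this, hle.2.2.1 i (h1S ⟨i, hi, hα⟩) _ ((h4 ⟨i, hi, hα⟩).trans_le (h3 _))]
      exact h5 ⟨i, hi, hα⟩
    · exact ⟨e0, (c2 _ (hle.trans hr1p) _ _ _ _ hγ0.le (Fmono hle3 h6) hF _ h9).1 h7,
        h8, h9.trans hγ0⟩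
  choose N G Sx n1 n2 n3 n4 n5 n6 using step
  obtain ⟨P, hPs⟩ : ∃ P : ℕ → {q // q ≤ p}, ∀ n, P (n + 1) = N (P n) :=
    ⟨fun n => Nat.rec ⟨p, le_rfl⟩ (fun _ q => N q) n, fun _ => rfl⟩
  have n3 : ∀ n, G (P n) ≤ (P (n + 1)).1.δ := fun n => by rw [hPs]; exact n3 (P n)
  have n5 : ∀ n, ∀ i ∈ (P n).1.S, al i = some α → ∃ ε < G (P n), ¬ (ε ∈ Sx (P n) ↔ (P (n + 1)).1.v i ε ≠ default) :=
    fun n => by rw [hPs]; exact n5 (P n)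
  have hP : ∀ n, (P (n + 1)).1 ≤ (P n).1 := fun n => by rw [hPs]; exact n1 (P n)
  have hlt : ∀ n, (P n).1.δ < (P (n + 1)).1.δ := fun n => (n4 (P n)).trans_le (n3 n)
  obtain ⟨δ, hδ1, hδ2⟩ := W_sup (fun n => (P n).1.δ)
  have hδ3 : ∀ n, (P n).1.δ < δ := fun n => (hlt n).trans_le (hδ1 (n + 1))
  have hFn : ∀ n, F (P (n + 1)).1 (G (P n)) (Sx (P n)) := fun n => by rw [hPs]; exact n2 (P n)
  let y : Set W.{u} := {ε | ∃ n, ε < G (P n) ∧ ε ∈ Sx (P n)}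
  have hy : ∀ n, ∀ ε < G (P n), (ε ∈ y ↔ ε ∈ Sx (P n)) := by
    intro n ε hε
    refine ⟨?_, fun h => ⟨n, hε, h⟩⟩
    rintro ⟨m, hm, h⟩
    have e1 : F (P (max n m + 1)).1 (G (P n)) (Sx (P n)) :=
      Fmono (chain_le (p := fun n => (P n).1) hP (show n + 1 ≤ max n m + 1 by omega)) (hFn n)
    have e2 : F (P (max n m + 1)).1 (G (P m)) (Sx (P m)) :=
      Fmono (chain_le (p := fun n => (P n).1) hP (show m + 1 ≤ max n m + 1 by omega)) (hFn m)
    rcases le_total (G (P n)) (G (P m)) with h' | h'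
    · exact (c2 (P (max n m + 1)).1 (P (max n m + 1)).2 _ _ _ _ h' e1 e2 ε hε).2 h
    · exact (c2 (P (max n m + 1)).1 (P (max n m + 1)).2 _ _ _ _ h' e2 e1 ε hm).1 h
  obtain ⟨q, hq1, hq2, -, -, -, hq3⟩ := limit_exists (fun n => (P n).1) hP δ hδ1
    (fun a g s => a = α ∧ g = δ ∧ s = y) (by
      rintro a g s ⟨rfl, rfl, rfl⟩
      refine ⟨hδ3, le_rfl, ?_, ⟨⟨_, hδ3 0⟩, ?_⟩, ?_⟩
      · rintro ε ⟨n, h1, -⟩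
        exact (h1.trans_le (n3 n)).trans (hδ3 (n + 1))
      · intro β hβ
        obtain ⟨n, hn⟩ := hδ2 β hβ
        obtain ⟨ε, h1, h2, h3⟩ := n6 (P n)
        exact ⟨ε, ⟨n, h3, h1⟩, hn.le.trans h2, (h3.trans_le (n3 n)).trans (hδ3 (n + 1))⟩
      · intro n i hi hα
        obtain ⟨ε, h1, h2⟩ := n5 n i hi hα
        refine ⟨n + 1, (hP n).2.1 hi, ε, h1.trans_le (n3 n), ?_⟩
        rw [hy n ε h1]
        exact h2)
  have hqp : q ≤ p := (hq1 0).trans (P 0).2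
  obtain ⟨r, hr, s, hs⟩ := c1 q hqp δ
  have hsy : ∀ ε < δ, (ε ∈ s ↔ ε ∈ y) := by
    intro ε hε
    obtain ⟨n, hn⟩ := hδ2 ε hε
    have h1 : ε < G (P n) := lt_trans hn (n4 (P n))
    rw [hy n ε h1]
    have h2 : G (P n) ≤ δ := ((n3 n).trans_lt (hδ3 (n + 1))).le
    exact (c2 r (hr.trans hqp) _ _ _ _ h2 (Fmono (hr.trans (hq1 (n + 1))) (hFn n)) hs ε h1).symm
  have hT : Fo r (fun U => El U (cl U (nd δ s)) (cl U (Tn α))) :=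
    fun V hV => (hbr r (hr.trans hqp) V hV).1 _ (hs V hV)
  have hδr : δ ≤ q.δ := hq2.ge
  refine Tn_mem hT (hδr.trans hr.1) ?_
  rw [hr.2.2.2 _ _ _ hδr, hq3]
  left
  refine ⟨rfl, rfl, ?_⟩
  rw [inter_congr hsy]
  refine Set.inter_eq_left.2 ?_
  rintro ε ⟨n, h1, -⟩
  exact (h1.trans_le (n3 n)).trans (hδ3 (n + 1))

end Tree
end JK

namespace JK
open FirstOrder FirstOrder.Language
universe u

theorem path_exists : ∃ n : (ℕ → Bool) → ℕ → ℕ, (∀ x, n x 0 = 0) ∧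
    (∀ x k, (n x k = k ∧ (n x (k + 1) = 2 * k + 1 ∨ n x (k + 1) = 2 * k + 2)) ∨
      (n x (k + 1) = n x k ∧ n x k ≠ 2 * k + 1 ∧ n x k ≠ 2 * k + 2 ∧ n x k ≠ k)) ∧
    ∀ x y, x ≠ y → ∃ k, n x k = k ∧ n y k = k ∧ n x (k + 1) ≠ n y (k + 1) := by
  classical
  let stp (x : ℕ → Bool) (k : ℕ) (s : ℕ × ℕ) : ℕ × ℕ :=
    if s.1 = k then (2 * k + 1 + (if x s.2 then 1 else 0), s.2 + 1) else s
  obtain ⟨st, h0, hs⟩ : ∃ st : (ℕ → Bool) → ℕ → ℕ × ℕ, (∀ x, st x 0 = (0, 0)) ∧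
      ∀ x k, st x (k + 1) = stp x k (st x k) :=
    ⟨fun x k => Nat.rec (0, 0) (fun k s => stp x k s) k, fun _ => rfl, fun _ _ => rfl⟩
  have hb : ∀ x k, k ≤ (st x k).1 ∧ (st x k).1 ≤ 2 * k := by
    intro x k
    induction k with
    | zero => simp [h0]
    | succ k ih =>
      rw [hs]
      simp only [stp]
      split_ifs <;> simp <;> omega
  have e1 : ∀ x k, (st x k).1 = k → st x (k + 1) = (2 * k + 1 + (if x (st x k).2 then 1 else 0), (st x k).2 + 1) := by
    intro x k h; rw [hs]; simp only [stp, h, if_true]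
  have e2 : ∀ x k, (st x k).1 ≠ k → st x (k + 1) = st x k := by
    intro x k h; rw [hs]; simp only [stp, h, if_false]
  refine ⟨fun x k => (st x k).1, fun x => by simp [h0], fun x k => ?_, fun x y hxy => ?_⟩
  · by_cases h : (st x k).1 = k
    · left
      refine ⟨h, ?_⟩
      dsimp only
      rw [e1 x k h]
      dsimp only
      split_ifs <;> simp
    · right
      have := hb x k
      refine ⟨by dsimp only; rw [e2 x k h], ?_, ?_, h⟩ <;> dsimp only <;> omega
  · by_contra hc
    push Not at hc
    have hn : ∀ k, (st x k) = (st y k) := by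
      intro k
      induction k with
      | zero => simp [h0]
      | succ k ih =>
        by_cases h : (st x k).1 = k
        · have h' : (st y k).1 = k := by rw [← ih]; exact h
          refine Prod.ext (hc k h h') ?_
          rw [e1 x k h, e1 y k h', ih]
        · have h' : (st y k).1 ≠ k := by rw [← ih]; exact h
          rw [e2 x k h, e2 y k h', ih]
    have hstay : ∀ j k, k + j ≤ (st x k).1 → st x (k + j) = st x k := by
      intro j
      induction j with
      | zero => intros; rfl
      | succ j ih =>
        intro k hk
        have := ih k (by omega)
        rw [← add_assoc, e2 x (k + j) (by rw [this]; omega), this]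
    have hv : ∀ N, ∃ k, (st x k).1 = k ∧ (st x k).2 = N := by
      intro N
      induction N with
      | zero => exact ⟨0, by simp [h0]⟩
      | succ N ih =>
        obtain ⟨k, h1, h2⟩ := ih
        have h3 := e1 x k h1
        have h4 := hb x (k + 1)
        have h5 := hstay ((st x (k + 1)).1 - (k + 1)) (k + 1) (by omega)
        rw [show k + 1 + ((st x (k + 1)).1 - (k + 1)) = (st x (k + 1)).1 by omega] at h5
        exact ⟨(st x (k + 1)).1, by rw [h5], by rw [h5, h3, h2]⟩
    apply hxy
    funext N
    obtain ⟨k, h1, h2⟩ := hv N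
    have h1' : (st y k).1 = k := by rw [← hn]; exact h1
    have h3 := e1 x k h1
    have h4 := e1 y k h1'
    rw [← hn, ← hn, h3, h2] at h4
    have h5 := congrArg Prod.fst h4
    revert h5
    cases x N <;> cases y N <;> simp

section Tree
variable {Idx : Type u} {X : Idx → Type u} [∀ i, Inhabited (X i)] {al : Idx → Option W.{u}}

theorem fuse_step (I : Set Idx) (r : Cond X al) (Bp : Cond X al → W.{u} → Set W.{u} → Prop)
    (hsplit : ∀ q ≤ r, ∃ q0 ≤ q, ∃ q1 ≤ q, res I q0 = res I q1 ∧ ∃ γ s0 s1, Bp q0 γ s0 ∧ Bp q1 γ s1 ∧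
      ∃ ε < γ, ¬ (ε ∈ s0 ↔ ε ∈ s1)) (k : ℕ) (R : ℕ → Cond X al)
    (hR : (∀ m, R m ≤ r) ∧ ∀ m m', res I (R m) = res I (R m')) :
    ∃ R' : ℕ → Cond X al, ((∀ m, R' m ≤ r) ∧ ∀ m m', res I (R' m) = res I (R' m')) ∧
      (∀ m, m ≠ 2 * k + 1 → m ≠ 2 * k + 2 → R' m ≤ R m) ∧ R' (2 * k + 1) ≤ R k ∧ R' (2 * k + 2) ≤ R k ∧
      ∃ γ s0 s1, Bp (R' (2 * k + 1)) γ s0 ∧ Bp (R' (2 * k + 2)) γ s1 ∧ ∃ ε < γ, ¬ (ε ∈ s0 ↔ ε ∈ s1) := by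
  classical
  obtain ⟨q0, h0, q1, h1, he, γ, s0, s1, hB0, hB1, hε⟩ := hsplit (R k) (hR.1 k)
  have hle : ∀ m, res I q0 ≤ res I (R m) := fun m => hR.2 k m ▸ res_mono I h0
  obtain ⟨R', hR'⟩ : ∃ R' : ℕ → Cond X al, ∀ m, R' m = if m = 2 * k + 1 then q0 else
    if m = 2 * k + 2 then q1 else am (R m) q0 I (hle m) := ⟨_, fun _ => rfl⟩
  have r1 : R' (2 * k + 1) = q0 := by rw [hR', if_pos rfl]
  have r2 : R' (2 * k + 2) = q1 := by rw [hR', if_neg (by omega), if_pos rfl]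
  have r3 : ∀ m, m ≠ 2 * k + 1 → m ≠ 2 * k + 2 → R' m = am (R m) q0 I (hle m) := by
    intro m h h'; rw [hR', if_neg h, if_neg h']
  have hres : ∀ m, res I (R' m) = res I q0 := by
    intro m
    by_cases h : m = 2 * k + 1
    · rw [h, r1]
    by_cases h' : m = 2 * k + 2
    · rw [h', r2, he]
    rw [r3 m h h', res_am]
  refine ⟨R', ⟨fun m => ?_, fun m m' => by rw [hres, hres]⟩, fun m h h' => ?_, ?_, ?_,
    γ, s0, s1, ?_, ?_, hε⟩
  · by_cases h : m = 2 * k + 1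
    · rw [h, r1]; exact h0.trans (hR.1 k)
    by_cases h' : m = 2 * k + 2
    · rw [h', r2]; exact h1.trans (hR.1 k)
    rw [r3 m h h']; exact (am_le _ _ _ _).trans (hR.1 m)
  · rw [r3 m h h']; exact am_le _ _ _ _
  · rw [r1]; exact h0
  · rw [r2]; exact h1
  · rw [r1]; exact hB0
  · rw [r2]; exact hB1

theorem fusion (I : Set Idx) (r : Cond X al) (Bp : Cond X al → W.{u} → Set W.{u} → Prop)
    (hmono : ∀ q q' γ s, q' ≤ q → Bp q γ s → Bp q' γ s)
    (hsplit : ∀ q ≤ r, ∃ q0 ≤ q, ∃ q1 ≤ q, res I q0 = res I q1 ∧ ∃ γ s0 s1, Bp q0 γ s0 ∧ Bp q1 γ s1 ∧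
      ∃ ε < γ, ¬ (ε ∈ s0 ↔ ε ∈ s1)) :
    ∃ (L : (ℕ → Bool) → Cond X al) (δ : W.{u}), (∀ x, L x ≤ r) ∧ (∀ x y, res I (L x) = res I (L y)) ∧
      ∀ x y, x ≠ y → ∃ γ ≤ δ, ∃ s0 s1, Bp (L x) γ s0 ∧ Bp (L y) γ s1 ∧ ∃ ε < γ, ¬ (ε ∈ s0 ↔ ε ∈ s1) := by
  classical
  obtain ⟨n, n0, ns, nd'⟩ := path_exists
  have hst := fuse_step I r Bp hsplit
  choose F hF1 hF2 hF3 hF4 G hG using hst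
  obtain ⟨R, hR0, hRs⟩ : ∃ R : ℕ → {R : ℕ → Cond X al // (∀ m, R m ≤ r) ∧ ∀ m m', res I (R m) = res I (R m')},
      R 0 = ⟨fun _ => r, fun _ => le_rfl, fun _ _ => rfl⟩ ∧
      ∀ k, R (k + 1) = ⟨F k (R k).1 (R k).2, hF1 k _ _⟩ :=
    ⟨fun k => Nat.rec ⟨fun _ => r, fun _ => le_rfl, fun _ _ => rfl⟩ (fun k S => ⟨F k S.1 S.2, hF1 k _ _⟩) k,
      rfl, fun _ => rfl⟩
  have hval : ∀ k, (R (k + 1)).1 = F k (R k).1 (R k).2 := fun k => by rw [hRs]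
  let p (x : ℕ → Bool) (k : ℕ) : Cond X al := (R k).1 (n x k)
  have hp : ∀ x k, p x (k + 1) ≤ p x k := by
    intro x k
    simp only [p, hval]
    rcases ns x k with ⟨h, h' | h'⟩ | ⟨h, h1, h2, -⟩
    · rw [h', h]; exact hF3 _ _ _
    · rw [h', h]; exact hF4 _ _ _
    · rw [h]; exact hF2 _ _ _ _ h1 h2
  have hres : ∀ x y k, res I (p x k) = res I (p y k) := fun x y k => (R k).2.2 _ _
  obtain ⟨δ, hδ⟩ := W_bdd (Set.range (fun k => G k (R k).1 (R k).2) ∪ Set.range (fun k => ((R k).1 0).δ))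
    ((Set.countable_range _).union (Set.countable_range _))
  have hδ1 : ∀ k, G k (R k).1 (R k).2 ≤ δ := fun k => (hδ _ (Or.inl ⟨k, rfl⟩)).le
  have hδ2 : ∀ x k, (p x k).δ ≤ δ := by
    intro x k
    have := (res_of_eq ((R k).2.2 0 (n x k))).1
    exact this ▸ (hδ _ (Or.inr ⟨k, rfl⟩)).le
  have hL := fun x => limit_exists (p x) (hp x) δ (hδ2 x) (fun _ _ _ => False) (fun _ _ _ h => h.elim)
  choose L l1 l2 l3 l4 l5 l6 using hL
  refine ⟨L, δ, fun x => (l1 x 0).trans ((R 0).2.1 _), fun x y => ?_, ?_⟩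
  · have hS : ∀ k, ∀ i ∈ I, i ∈ (p x k).S ↔ i ∈ (p y k).S := fun k => (res_of_eq (hres x y k)).2.1
    have hd : ∀ k, (p x k).δ = (p y k).δ := fun k => (res_of_eq (hres x y k)).1
    refine res_eq (by rw [l2, l2]) (fun i hi => ?_) (fun i hi => ?_) ?_
    · rw [l3, l3]; exact exists_congr fun k => hS k i hi
    · funext ε
      by_cases h : ∃ k, i ∈ (p x k).S ∧ ε < (p x k).δ
      · obtain ⟨k, h1, h2⟩ := h
        rw [l4 x i k ε h1 h2, l4 y i k ε ((hS k i hi).1 h1) (hd k ▸ h2)]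
        exact congrFun ((res_of_eq (hres x y k)).2.2.1 i hi) ε
      · rw [l5 x i ε h, l5 y i ε]
        rintro ⟨k, h1, h2⟩
        exact h ⟨k, (hS k i hi).2 h1, (hd k).symm ▸ h2⟩
    · funext α γ s
      refine propext ?_
      rw [l6, l6]
      refine or_congr Iff.rfl (exists_congr fun k => ?_)
      rw [(res_of_eq (hres x y k)).2.2.2]
  · intro x y hxy
    obtain ⟨k, h1, h2, h3⟩ := nd' x y hxy
    refine ⟨_, hδ1 k, ?_⟩
    obtain ⟨s0, s1, hs0, hs1, hε⟩ := hG k (R k).1 (R k).2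
    rw [← hval] at hs0 hs1
    have g1 : n x (k + 1) = 2 * k + 1 ∨ n x (k + 1) = 2 * k + 2 := by
      have := ns x k; omega
    have g2 : n y (k + 1) = 2 * k + 1 ∨ n y (k + 1) = 2 * k + 2 := by
      have := ns y k; omega
    have lx := l1 x (k + 1)
    have ly := l1 y (k + 1)
    simp only [p] at lx ly
    rcases g1 with g1 | g1 <;> rcases g2 with g2 | g2
    · exact absurd (g1.trans g2.symm) h3
    · rw [g1] at lx; rw [g2] at ly
      exact ⟨s0, s1, hmono _ _ _ _ lx hs0, hmono _ _ _ _ ly hs1, hε⟩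
    · rw [g1] at lx; rw [g2] at ly
      obtain ⟨ε, h4, h5⟩ := hε
      exact ⟨s1, s0, hmono _ _ _ _ lx hs1, hmono _ _ _ _ ly hs0, ε, h4, fun h => h5 h.symm⟩
    · exact absurd (g1.trans g2.symm) h3

end Tree
end JK

namespace JK
open FirstOrder FirstOrder.Language
universe u

section Tree
variable {Idx : Type u} {X : Idx → Type u} [∀ i, Inhabited (X i)] {al : Idx → Option W.{u}}
variable {κ : Cardinal.{u}}

theorem inj_small (hκ : κ.IsInaccessible)
    (hcol : ∀ β : Ordinal.{u}, β ≠ 0 → β < κ.ord → ∃ i, Nonempty (β.ToType ≃ X i)) {J : Type u}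
    (hJ : Cardinal.mk J < κ) (τ : J → Nm (RO (Cond X al))) (U : Ult (RO (Cond X al))) (a : Mo U)
    (ha : ∀ v, El U v a → El U v (cl U ⟨J, τ, fun _ => ⊤⟩)) :
    InjInto (El U) a (cl U (ordn (Ordinal.omega 1))) := by
  have h1 := inj_of_cover_card τ U a ha
  have hlt : Cardinal.mk J + 1 < κ :=
    Cardinal.add_lt_of_lt ((Cardinal.aleph0_le_aleph 1).trans (aleph1_lt hκ).le) hJ
      (Cardinal.one_lt_aleph0.trans_le ((Cardinal.aleph0_le_aleph 1).trans (aleph1_lt hκ).le))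
  have h2 : InjInto (El U) (cl U (ordn (Cardinal.mk J).ord)) (cl U (ordn (Cardinal.mk J + 1).ord)) :=
    inj_ordn_ordn (by simp) U
  obtain ⟨i, ⟨e⟩⟩ := hcol (Cardinal.mk J + 1).ord (by simp) (Cardinal.ord_lt_ord.2 hlt)
  exact inj_trans U (inj_trans U h1 h2) (collapse i e U)

theorem fo_sub_node {b c : Nm (RO (Cond X al))} {q : Cond X al}
    (hb : Fo q (fun U => ∀ v, El U v (cl U b) → IsNodeV (El U) (cl U (ordn (Ordinal.omega 1))) v))
    (h : ∀ r ≤ q, ∀ γ s, Fo r (fun U => El U (cl U (nd γ s)) (cl U b)) →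
      ∃ r' ≤ r, Fo r' (fun U => El U (cl U (nd γ s)) (cl U c))) :
    Fo q (fun U => SubV (El U) (cl U b) (cl U c)) := by
  by_contra hc
  obtain ⟨r, hr, h1⟩ := fo_em _ q hc
  obtain ⟨x, hx⟩ := fo_exi (p := r) (fun U v => El U v (cl U b) ∧ ¬ El U v (cl U c)) (fun U hU => by
    have := h1 U hU
    simp only [SubV] at this
    push Not at this
    exact this)
  obtain ⟨r1, hr1, γ, s, h2⟩ := fo_node (p := r) (x := x) (fun U hU => fo_mono hr hb U hU _ (hx U hU).1)
  obtain ⟨r2, hr2, h3⟩ := h r1 (hr1.trans hr) γ s (fun U hU => by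
    dsimp only
    rw [← h2 U hU]; exact (fo_mono hr1 hx U hU).1)
  refine fo_false (p := r2) fun U hU => (fo_mono (hr2.trans hr1) hx U hU).2 ?_
  rw [fo_mono hr2 h2 U hU]
  exact h3 U hU

theorem lvl_count {t : Nm (RO (Cond X al))} {r : Cond X al}
    (hk : Fo r (fun U => IsKurepaV (El U) (cl U (ordn (Ordinal.omega 1))) (cl U t))) (δ : W.{u}) :
    ∃ q ≤ r, ∃ C : Set (Set W.{u}), C.Countable ∧ ∀ m ≤ q, ∀ s,
      Fo m (fun U => El U (cl U (nd δ s)) (cl U t)) → s ∩ Set.Iio δ ∈ C := by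
  obtain ⟨l, hl⟩ := sep t (fun U x => HasDomV (El U) x (cl U (ordn (tyo δ))))
  obtain ⟨f, hf⟩ := fo_exi (p := r) (fun U f => IsFuncInto (El U) f (cl U l) (cl U (ordn Ordinal.omega0)) ∧
    InjFun (El U) f) (fun U hU => by
      obtain ⟨w, hw, hi⟩ := (hk U hU).2.1 (cl U (ordn (tyo δ))) (cl U l) (mem_ordn U (og_lt δ)) (hl U)
      rw [omega_unique U hw] at hi
      exact hi)
  have hd : ∀ n : ℕ, ∀ q ≤ r, ∃ q' ≤ q,
      Fo q' (fun U => ¬ ∃ x, FunVal (El U) (cl U f) x (cl U (ordn (n : Ordinal)))) ∨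
      ∃ γ s, Fo q' (fun U => FunVal (El U) (cl U f) (cl U (nd γ s)) (cl U (ordn (n : Ordinal)))) := by
    intro n q hq
    obtain ⟨q1, hq1, h1 | h1⟩ := fo_dec (fun U => ∃ x, FunVal (El U) (cl U f) x (cl U (ordn (n : Ordinal)))) q
    · obtain ⟨x, hx⟩ := fo_exi (p := q1) (fun U x => FunVal (El U) (cl U f) x (cl U (ordn (n : Ordinal)))) h1
      obtain ⟨q2, hq2, γ, s, h2⟩ := fo_node (p := q1) (x := x) (fun U hU => by
        have hU' := fo_mono (hq1.trans hq) hk U hU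
        have h3 := fo_mono (hq1.trans hq) hf U hU
        exact hU'.1.1 _ ((hl U _).1 ((h3.1.1.2.2 _).1 ⟨_, hx U hU⟩)).1)
      refine ⟨q2, hq2.trans hq1, Or.inr ⟨γ, s, fun U hU => ?_⟩⟩
      dsimp only
      rw [← h2 U hU]
      exact fo_mono hq2 hx U hU
    · exact ⟨q1, hq1, Or.inl h1⟩
  obtain ⟨q, hq, hR⟩ := distrib (fun (n : ℕ) q' => 
      Fo q' (fun U => ¬ ∃ x, FunVal (El U) (cl U f) x (cl U (ordn (n : Ordinal)))) ∨
      ∃ γ s, Fo q' (fun U => FunVal (El U) (cl U f) (cl U (nd γ s)) (cl U (ordn (n : Ordinal)))))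
      (fun n p q hqp h => h.imp (fo_mono hqp) (fun ⟨γ, s, h⟩ => ⟨γ, s, fo_mono hqp h⟩)) r hd
  have hs : ∀ n : ℕ, ∃ s : Set W.{u}, Fo q (fun U => ¬ ∃ x, FunVal (El U) (cl U f) x (cl U (ordn (n : Ordinal)))) ∨
      ∃ γ, Fo q (fun U => FunVal (El U) (cl U f) (cl U (nd γ s)) (cl U (ordn (n : Ordinal)))) := by
    intro n
    rcases hR n with h | ⟨γ, s, h⟩
    · exact ⟨∅, Or.inl h⟩
    · exact ⟨s, Or.inr ⟨γ, h⟩⟩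
  choose sq hsq using hs
  refine ⟨q, hq, Set.range fun n => sq n ∩ Set.Iio δ, Set.countable_range _, fun m hm s h => ?_⟩
  obtain ⟨m1, hm1, β, hβ, h1⟩ := fo_bex_ord (p := m) (α := Ordinal.omega0)
    (fun U y => FunVal (El U) (cl U f) (cl U (nd δ s)) y)
    (fun U hU => func_val U (fo_mono (hm.trans hq) hf U hU).1 ((hl U _).2 ⟨h U hU, nd_dom δ s U⟩))
  obtain ⟨n, rfl⟩ := Ordinal.lt_omega0.1 hβ
  refine ⟨n, ?_⟩
  rcases hsq n with h2 | ⟨γ, h2⟩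
  · exact (fo_false (p := m1) fun U hU => fo_mono (hm1.trans hm) h2 U hU ⟨_, h1 U hU⟩).elim
  · have := fo_pure (p := m1) (Q := γ = δ ∧ ∀ ε < γ, (ε ∈ sq n ↔ ε ∈ s)) (fun U hU => nd_inj U
      ((fo_mono (hm1.trans (hm.trans hq)) hf U hU).2 _ _ _ (fo_mono (hm1.trans hm) h2 U hU) (h1 U hU)))
    obtain ⟨rfl, h3⟩ := this
    exact inter_congr h3

/-- names for subsets of the tree built from conditions with support in `I` -/
noncomputable def cA (I : Set Idx) (A : Set ({p : Cond X al // p.S ⊆ I} × W.{u} × Set W.{u})) :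
    Nm (RO (Cond X al)) :=
  ⟨W.{u} × Set W.{u}, fun x => nd x.1 x.2,
    fun x => val (fun q : Cond X al => ∃ d : {p : Cond X al // p.S ⊆ I}, (d, x.1, x.2) ∈ A ∧ q ≤ d.1)⟩

theorem res_S (I : Set Idx) (p : Cond X al) : (res I p).S ⊆ I := fun _ h => h.2

theorem br_cover {t b : Nm (RO (Cond X al))} {r : Cond X al} (I : Set Idx)
    (hI : ∀ (γ : W.{u}) (s : Set W.{u}) (p : Cond X al), ∃ d : Cond X al,
      (Fo d (fun U => El U (cl U (nd γ s)) (cl U t)) ∨ Fo d (fun U => ¬ El U (cl U (nd γ s)) (cl U t))) ∧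
      d.S ⊆ I ∧ ∃ m, m ≤ p ∧ m ≤ d)
    (hk : Fo r (fun U => IsKurepaV (El U) (cl U (ordn (Ordinal.omega 1))) (cl U t)))
    (hb : Fo r (fun U => IsBranchV (El U) (cl U t) (cl U b))) :
    ∃ q ≤ r, ∃ A, Fo q (fun U => cl U b = cl U (cA I A)) := by
  by_contra hno
  push Not at hno
  let Bp (q : Cond X al) (γ : W.{u}) (s : Set W.{u}) : Prop := Fo q (fun U => El U (cl U (nd γ s)) (cl U b))
  have hmono : ∀ q q' γ s, q' ≤ q → Bp q γ s → Bp q' γ s := fun q q' γ s h h' => fo_mono h h'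
  have hdec : ∀ q ≤ r, ∀ γ, ∃ q' ≤ q, ∃ s, Bp q' γ s := by
    intro q hq γ
    refine br_dec (t := t) (b := b) (r := q) (fun U hU => (fo_mono hq hk U hU).1.1) (fo_mono hq hb) (fun U hU => ?_)
    exact (fo_mono hq hk U hU).1.2.2 _ (mem_ordn U (og_lt γ)) (ord_ordn U _)
  have hlin : ∀ q ≤ r, ∀ γ γ' s s', γ ≤ γ' → Bp q γ s → Bp q γ' s' → ∀ ε < γ, (ε ∈ s ↔ ε ∈ s') :=
    fun q hq γ γ' s s' h h1 h2 => br_lin (fo_mono hq hb) h h1 h2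
  have hsplit : ∀ q ≤ r, ∃ q0 ≤ q, ∃ q1 ≤ q, res I q0 = res I q1 ∧ ∃ γ s0 s1, Bp q0 γ s0 ∧ Bp q1 γ s1 ∧
      ∃ ε < γ, ¬ (ε ∈ s0 ↔ ε ∈ s1) := by
    intro q hq
    by_contra hc
    have hc' : ∀ q0 ≤ q, ∀ q1 ≤ q, res I q0 = res I q1 → ∀ γ s0 s1, Bp q0 γ s0 → Bp q1 γ s1 →
        ∀ ε < γ, (ε ∈ s0 ↔ ε ∈ s1) := by
      intro q0 h0 q1 h1 he γ s0 s1 hs0 hs1 ε hε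
      by_contra hcc
      exact hc ⟨q0, h0, q1, h1, he, γ, s0, s1, hs0, hs1, ε, hε, hcc⟩
    set A : Set ({p : Cond X al // p.S ⊆ I} × W.{u} × Set W.{u}) :=
      {x | ∃ q' ≤ q, res I q' = x.1.1 ∧ Bp q' x.2.1 x.2.2} with hA
    have s1 : Fo q (fun U => SubV (El U) (cl U b) (cl U (cA I A))) := by
      refine fo_sub_node (fun U hU v hv => (fo_mono hq hk U hU).1.1 v ((fo_mono hq hb U hU).1 v hv))
        fun r' hr' γ s hB => ⟨r', le_rfl, fun U hU => ?_⟩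
      have hv : Fo r' (fun U => val (fun q : Cond X al => ∃ d : {p : Cond X al // p.S ⊆ I},
          (d, γ, s) ∈ A ∧ q ≤ d.1) ∈ U.s) :=
        fo_val_of fun q' hq' => ⟨⟨res I r', res_S I r'⟩, ⟨r', hr', rfl, hB⟩, hq'.trans (le_res I r')⟩
      exact El_mk U (fun x : W.{u} × Set W.{u} => nd x.1 x.2) _ (γ, s) (hv U hU)
    have s2 : Fo q (fun U => SubV (El U) (cl U (cA I A)) (cl U b)) := by
      intro U hU v hv
      refine ball (fun x : W.{u} × Set W.{u} => nd x.1 x.2) _ (io q)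
        (fun U v => El U v (cl U b)) (fun x V hV hval => ?_) U hU v hv
      have : Fo q (fun V => val (fun q : Cond X al => ∃ d : {p : Cond X al // p.S ⊆ I},
          (d, x.1, x.2) ∈ A ∧ q ≤ d.1) ∈ V.s → El V (cl V (nd x.1 x.2)) (cl V b)) := by
        refine fo_dense fun r1 hr1 => ?_
        obtain ⟨r2, hr2, h2 | h2⟩ := fo_dec (fun V => val (fun q : Cond X al => ∃ d : {p : Cond X al // p.S ⊆ I},
          (d, x.1, x.2) ∈ A ∧ q ≤ d.1) ∈ V.s) r1
        · obtain ⟨r3, hr3, h3⟩ := (fo_val _ r2).1 h2 r2 le_rfl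
          obtain ⟨d, ⟨q', hq', hd, hB⟩, h4⟩ := h3 r3 le_rfl
          obtain ⟨r4, hr4, s4, hB4⟩ := hdec r3 (hr3.trans (hr2.trans (hr1.trans hq))) x.1
          have hle : res I r4 ≤ res I q' := by
            have := res_mono I (hr4.trans h4)
            rw [← show res I q' = d.1 from hd, res_res] at this
            exact this
          have hag := hc' (am q' r4 I hle) ((am_le _ _ _ _).trans hq') r4
            (hr4.trans (hr3.trans (hr2.trans hr1))) (res_am _ _ _ _) x.1 x.2 s4
            (hmono _ _ _ _ (am_le _ _ _ _) hB) hB4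
          refine ⟨r4, hr4.trans (hr3.trans hr2), fun V hV _ => ?_⟩
          rw [nd_eq hag V]
          exact hB4 V hV
        · exact ⟨r2, hr2, fo_imp h2 fun V hV h => absurd h hV⟩
      exact this V hV hval
    exact hno q hq A fun U hU => nm_ext U _ _ fun z => ⟨s1 U hU z, s2 U hU z⟩
  obtain ⟨L, δ, hL1, hL2, hL3⟩ := fusion I r Bp hmono hsplit
  obtain ⟨q', hq', C, hC, hCm⟩ := lvl_count (fo_mono (hL1 (fun _ => true)) hk) δ
  have hle : ∀ x, res I q' ≤ res I (L x) := fun x => by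
    rw [hL2 x (fun _ => true)]; exact res_mono I hq'
  have key : ∀ x, ∃ m ≤ L x, ∃ y, Bp m δ y ∧ y ∩ Set.Iio δ ∈ C := by
    intro x
    have hmL : am (L x) q' I (hle x) ≤ L x := am_le _ _ _ _
    obtain ⟨m', hm', y, hy⟩ := hdec _ (hmL.trans (hL1 x)) δ
    obtain ⟨d, hd, hdS, m2, hm2, hmd⟩ := hI δ y m'
    refine ⟨m', hm'.trans hmL, y, hy, ?_⟩
    have hd' : Fo d (fun U => El U (cl U (nd δ y)) (cl U t)) := by
      rcases hd with hd | hd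
      · exact hd
      · refine (fo_false (p := m2) fun U hU => fo_mono hmd hd U hU ?_).elim
        exact (fo_mono (hm2.trans (hm'.trans (hmL.trans (hL1 x)))) hb U hU).1 _ (fo_mono hm2 hy U hU)
    have h1 : res I m2 ≤ d := res_le_of_sub hmd hdS
    have h2 : res I m2 ≤ res I q' := by
      have := res_mono I (hm2.trans hm')
      rwa [res_am] at this
    obtain ⟨m3, h3, h4⟩ := compat_of_res hdS h1 h2
    exact hCm m3 h3 y (fo_mono h4 hd')
  choose m hm y hy hyC using key
  have hinj : Function.Injective (fun x => (⟨y x ∩ Set.Iio δ, hyC x⟩ : C)) := by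
    intro x x' hxx
    by_contra hne
    obtain ⟨γ, hγ, s0, s1, h0, h1, ε, hε, hdiff⟩ := hL3 x x' hne
    have e : y x ∩ Set.Iio δ = y x' ∩ Set.Iio δ := congrArg Subtype.val hxx
    have a0 := hlin (m x) ((hm x).trans (hL1 x)) γ δ s0 (y x) hγ (hmono _ _ _ _ (hm x) h0) (hy x) ε hε
    have a1 := hlin (m x') ((hm x').trans (hL1 x')) γ δ s1 (y x') hγ (hmono _ _ _ _ (hm x') h1) (hy x') ε hε
    apply hdiff
    rw [a0, a1]
    have := Set.ext_iff.1 e ε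
    simp only [Set.mem_inter_iff, Set.mem_Iio, hε.trans_le hγ, and_true] at this
    exact this
  have : Countable C := hC.to_subtype
  have h1 : Countable (ℕ → Bool) := hinj.countable
  have h2 : Cardinal.mk (ℕ → Bool) ≤ Cardinal.aleph0 := Cardinal.mk_le_aleph0_iff.2 h1
  rw [← Cardinal.power_def, Cardinal.mk_nat, Cardinal.mk_bool] at h2
  exact absurd h2 (not_le.2 (Cardinal.cantor _))

theorem no_kurepa (hκ : κ.IsInaccessible) (hX : ∀ i, Cardinal.mk (X i) < κ)
    (hcol : ∀ β : Ordinal.{u}, β ≠ 0 → β < κ.ord → ∃ i, Nonempty (β.ToType ≃ X i))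
    (U : Ult (RO (Cond X al))) (t : Mo U) :
    ¬ IsKurepaV (El U) (cl U (ordn (Ordinal.omega 1))) t := by
  obtain ⟨t, rfl⟩ := cl_surj U t
  refine all_of_fo (fun U => ¬ IsKurepaV (El U) (cl U (ordn (Ordinal.omega 1))) (cl U t)) (fun p => ?_) U
  by_contra hp
  obtain ⟨p, -, h0⟩ := fo_em _ p (fun h => hp ⟨p, le_rfl, h⟩)
  replace h0 := fo_imp h0 (fun U h => not_not.1 h)
  have hWS : Cardinal.mk (W.{u} × Set W.{u}) < κ := prod_lt hκ (W_lt hκ) (set_lt hκ (W_lt hκ))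
  obtain ⟨I, hI1, hI2⟩ := reflect (al := al) hκ hX hWS (fun (x : W.{u} × Set W.{u}) d =>
    Fo d (fun U => El U (cl U (nd x.1 x.2)) (cl U t)) ∨ Fo d (fun U => ¬ El U (cl U (nd x.1 x.2)) (cl U t)))
    (fun x p => fo_dec _ p)
  set C : Nm (RO (Cond X al)) := ⟨Set ({p : Cond X al // p.S ⊆ I} × W.{u} × Set W.{u}), cA I, fun _ => ⊤⟩ with hC
  have hcov : Fo p (fun U => ∀ b, IsBranchV (El U) (cl U t) b → El U b (cl U C)) := by
    by_contra hc
    obtain ⟨r, hr, h1⟩ := fo_em _ p hc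
    obtain ⟨b, hb⟩ := fo_exi (p := r) (fun U b => IsBranchV (El U) (cl U t) b ∧ ¬ El U b (cl U C)) (fun U hU => by
      have := h1 U hU
      push Not at this
      exact this)
    obtain ⟨q, hq, A, h2⟩ := br_cover (t := t) (b := b) (r := r) I (fun γ s p => hI2 (γ, s) p) (fo_mono hr h0)
      (fo_imp hb fun U h => h.1)
    refine fo_false (p := q) fun U hU => (fo_mono hq hb U hU).2 ?_
    rw [h2 U hU]
    exact El_mk U (cA I) (fun _ => ⊤) A U.top_mem
  obtain ⟨s, hs⟩ := power_sup t
  obtain ⟨bs, hbs⟩ := sep s (fun U b => IsBranchV (El U) (cl U t) b)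
  refine fo_false (p := p) fun U hU => (h0 U hU).2.2 (cl U bs) (fun z => ?_) ?_
  · rw [hbs]
    exact ⟨fun h => h.2, fun h => ⟨hs U z h.1, h⟩⟩
  · refine inj_small hκ hcol (J := Set ({p : Cond X al // p.S ⊆ I} × W.{u} × Set W.{u}))
      (set_lt hκ (prod_lt hκ (PI_lt hκ hX I hI1) hWS)) (cA I) U _ fun v hv => ?_
    exact hcov U hU v ((hbs U v).1 hv).2

end Tree
end JK

namespace JK
open FirstOrder FirstOrder.Language
universe u

section Tree
variable {Idx : Type u} {X : Idx → Type u} [∀ i, Inhabited (X i)] {al : Idx → Option W.{u}}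
variable {κ : Cardinal.{u}}

/-- check names of sets of natural numbers -/
noncomputable def rn {P : Type u} [Preorder P] (s : Set (ULift.{u} ℕ)) : Nm (RO P) :=
  ⟨s, fun n => ordn ((n.1.down : ℕ) : Ordinal.{u}), fun _ => ⊤⟩

theorem rn_mem {P : Type u} [Preorder P] {s : Set (ULift.{u} ℕ)} {n : ULift.{u} ℕ} (h : n ∈ s)
    (U : Ult (RO P)) : El U (cl U (ordn ((n.down : ℕ) : Ordinal.{u}))) (cl U (rn s)) :=
  El_mk U (fun n : s => ordn ((n.1.down : ℕ) : Ordinal.{u})) (fun _ => ⊤) ⟨n, h⟩ U.top_mem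

theorem mem_rn {P : Type u} [Preorder P] {s : Set (ULift.{u} ℕ)} {n : ULift.{u} ℕ}
    (U : Ult (RO P)) (h : El U (cl U (ordn ((n.down : ℕ) : Ordinal.{u}))) (cl U (rn s))) : n ∈ s := by
  refine ball' (fun n : s => ordn ((n.1.down : ℕ) : Ordinal.{u})) (fun _ => ⊤)
    (fun U v => v = cl U (ordn ((n.down : ℕ) : Ordinal.{u})) → n ∈ s) (fun m V _ hV => ?_) U _ h rfl
  have := Nat.cast_injective (ordn_inj V hV)
  have e : m.1 = n := ULift.ext _ _ this
  exact e ▸ m.2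

theorem rn_cover (U : Ult (RO (Cond X al))) (z : Mo U)
    (hz : SubV (El U) z (cl U (ordn Ordinal.omega0))) :
    El U z (cl U ⟨Set (ULift.{u} ℕ), rn, fun _ => ⊤⟩) := by
  obtain ⟨x, rfl⟩ := cl_surj U z
  set C : Nm (RO (Cond X al)) := ⟨Set (ULift.{u} ℕ), rn, fun _ => ⊤⟩ with hC
  refine all_of_fo (fun U => SubV (El U) (cl U x) (cl U (ordn Ordinal.omega0)) → El U (cl U x) (cl U C))
    (fun p => ?_) U hz
  obtain ⟨q, hq, h | h⟩ := fo_dec (fun U => SubV (El U) (cl U x) (cl U (ordn Ordinal.omega0))) p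
  · obtain ⟨r, hr, s, hs⟩ := decide_c' (fun (n : ULift.{u} ℕ) (U : Ult (RO (Cond X al))) =>
      El U (cl U (ordn ((n.down : ℕ) : Ordinal.{u}))) (cl U x)) q
    refine ⟨r, hr.trans hq, fun V hV _ => ?_⟩
    have e : cl V x = cl V (rn s) := by
      refine nm_ext V _ _ fun z => ⟨fun hz => ?_, fun hz => ?_⟩
      · refine ball_ord Ordinal.omega0 (io r) (fun U v => El U v (cl U x) → El U v (cl U (rn s)))
          (fun β hβ V hV hx => ?_) V hV z (fo_mono hr h V hV z hz) hz
        obtain ⟨n, rfl⟩ := Ordinal.lt_omega0.1 hβ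
        exact rn_mem ((hs V hV ⟨n⟩).1 hx) V
      · exact ball (fun n : s => ordn ((n.1.down : ℕ) : Ordinal.{u})) (fun _ => ⊤) (io r)
          (fun U v => El U v (cl U x)) (fun n V hV _ => (hs V hV n.1).2 n.2) V hV z hz
    rw [e]
    exact El_mk V rn (fun _ => ⊤) s V.top_mem
  · exact ⟨q, hq, fo_imp h fun V hV h' => absurd h' hV⟩

theorem ch_holds (hκ : κ.IsInaccessible)
    (hcol : ∀ β : Ordinal.{u}, β ≠ 0 → β < κ.ord → ∃ i, Nonempty (β.ToType ≃ X i))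
    (U : Ult (RO (Cond X al))) : CHV (El U) := by
  intro w p k₁ hw hp hk
  rw [omega1_unique U hk (omega1_spec U)]
  rw [omega_unique U hw] at hp
  refine cantor_bernstein U ?_ ?_
  · refine inj_small hκ hcol (J := Set (ULift.{u} ℕ)) (set_lt hκ ?_) rn U p
      (fun v hv => rn_cover U v ((hp v).1 hv))
    simpa using (Cardinal.aleph0_le_aleph 1).trans_lt (aleph1_lt hκ)
  · have hle : Cardinal.mk W.{u} ≤ Cardinal.mk (Set (ULift.{u} ℕ)) := by
      rw [W_card]
      simpa using Cardinal.aleph_one_le_continuum.{u}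
    obtain ⟨g⟩ := hle
    refine inj_of_distinct (Ordinal.omega 1) (fun j => rn (g j)) U p (fun v hv => ?_) ?_
    · rw [hp]
      refine ball' (fun j : W.{u} => rn (g j)) (fun _ => ⊤)
        (fun U v => SubV (El U) v (cl U (ordn Ordinal.omega0))) (fun j V _ => ?_) U v hv
      exact ball' (fun n : g j => ordn ((n.1.down : ℕ) : Ordinal.{u})) (fun _ => ⊤)
        (fun U v => El U v (cl U (ordn Ordinal.omega0)))
        (fun n V _ => mem_ordn V (Ordinal.natCast_lt_omega0 _)) V
    · intro i j hij V he
      apply hij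
      apply g.injective
      ext n
      constructor
      · intro h; exact mem_rn V (he ▸ rn_mem h V)
      · intro h; exact mem_rn V (he.symm ▸ rn_mem h V)

theorem Tn_omega1 (hκ : κ.IsInaccessible)
    (hcol : ∀ β : Ordinal.{u}, β ≠ 0 → β < κ.ord → ∃ i, Nonempty (β.ToType ≃ X i))
    (α : W.{u}) (U : Ult (RO (Cond X al))) :
    IsOmega1TreeV (El U) (cl U (ordn (Ordinal.omega 1))) (cl U (Tn α)) := by
  refine ⟨Tn_tree α U, cantor_bernstein U ?_ ?_, ?_⟩
  · refine inj_small hκ hcol (J := W.{u} × Set W.{u}) (prod_lt hκ (W_lt hκ) (set_lt hκ (W_lt hκ)))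
      (fun x => nd x.1 x.2) U _ ?_
    exact ball' (fun x : W.{u} × Set W.{u} => nd x.1 x.2) _
      (fun U v => El U v (cl U ⟨W.{u} × Set W.{u}, fun x => nd x.1 x.2, fun _ => ⊤⟩))
      (fun x V _ => El_mk V (fun x : W.{u} × Set W.{u} => nd x.1 x.2) (fun _ => ⊤) x V.top_mem) U
  · refine inj_of_distinct (Ordinal.omega 1) (fun j : W.{u} => nd j ∅) U _ ?_ ?_
    · exact ball' (fun j : W.{u} => nd j ∅) (fun _ => ⊤) (fun U v => El U v (cl U (Tn α)))
        (fun j V _ => Tn_zero α j V) U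
    · intro i j hij V h
      exact hij (nd_inj V h).1
  · intro a ha _
    exact ball_w1 ⊤ (fun U a => ∃ x, El U x (cl U (Tn α)) ∧ HasDomV (El U) x a)
      (fun ε V _ => ⟨_, Tn_zero α ε V, nd_dom ε ∅ V⟩) U U.top_mem a ha

theorem branch_card (hκ : κ.IsInaccessible) {α : W.{u}} {μ : Cardinal.{u}} (hκμ : κ ≤ μ)
    (hμ : Cardinal.mk {i // al i = some α} = μ) (hne : ∀ i, al i = some α → ∃ x : X i, x ≠ default)
    (U : Ult (RO (Cond X al))) {bs : Mo U} (hbs : IsBranchSetOf (El U) (cl U (Tn α)) bs) :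
    InjInto (El U) (cl U (ordn μ.ord)) bs ∧ InjInto (El U) bs (cl U (ordn μ.ord)) := by
  constructor
  · have hc : Cardinal.mk μ.ord.ToType = Cardinal.mk {i // al i = some α} := by rw [hμ]; simp
    obtain ⟨e⟩ := Cardinal.eq.1 hc
    refine inj_of_distinct μ.ord (fun j => bn (e j).1) U bs (fun v hv => ?_) ?_
    · rw [hbs]
      exact ball' (fun j : μ.ord.ToType => bn (e j).1) (fun _ => ⊤) (fun U v => IsBranchV (El U) (cl U (Tn α)) v)
        (fun j V _ => bn_branch (e j).2 V) U v hv
    · intro i j hij V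
      exact bn_ne (e i).2 (fun h => hij (e.injective (Subtype.ext h))) (hne _ (e i).2) V
  · have h1 := inj_of_cover_card _ U bs (fun v hv => Tn_cover α U v ((hbs v).1 hv))
    refine inj_trans U h1 (inj_ordn_ordn ?_ U)
    simp only [Cardinal.card_ord, Cardinal.mk_sum, Cardinal.lift_id, hμ]
    exact Cardinal.add_le_of_le (((Cardinal.aleph0_le_aleph 1).trans (aleph1_lt hκ).le).trans hκμ) le_rfl
      ((set_lt hκ (W_lt hκ)).le.trans hκμ)

/-- generic subsets of `ω₁` -/
noncomputable def gn (i : Idx) : Nm (RO (Cond X al)) :=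
  ⟨W.{u}, fun ε => ordn (tyo ε), fun ε => val (fun p : Cond X al => i ∈ p.S ∧ ε < p.δ ∧ p.v i ε ≠ default)⟩

theorem gn_ne {i j : Idx} (hij : i ≠ j) (hne : ∃ x : X i, x ≠ default) :
    ∀ U : Ult (RO (Cond X al)), cl U (gn i) ≠ cl U (gn j) := by
  refine all_of_fo _ fun p => ?_
  obtain ⟨x, hx⟩ := hne
  obtain ⟨δ, hδ⟩ := W_succ p.δ
  classical
  have hT : ({i, j} : Set Idx).Countable := (Set.countable_singleton j).insert i
  let f : ∀ k, W.{u} → X k := fun k _ => if h : k = i then h ▸ x else default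
  refine ⟨extend p {i, j} hT δ hδ.le f, extend_le _ _ _ _ _ _, ?_⟩
  set q := extend p {i, j} hT δ hδ.le f with hq
  have hi2 : i ∈ ({i, j} : Set Idx) := Or.inl rfl
  have hj2 : j ∈ ({i, j} : Set Idx) := Or.inr rfl
  have h1 : q.v i p.δ = x := by
    rw [hq, extend_v _ _ _ _ _ _ i hi2 _ le_rfl hδ]
    simp [f]
  have h2 : q.v j p.δ = default := by
    rw [hq, extend_v _ _ _ _ _ _ j hj2 _ le_rfl hδ]
    simp [f, Ne.symm hij]
  have hiS : i ∈ q.S := Or.inr hi2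
  have hjS : j ∈ q.S := Or.inr hj2
  have hqδ : p.δ < q.δ := hδ
  intro V hV he
  have h3 : Fo q (fun U => val (fun p' : Cond X al => i ∈ p'.S ∧ p.δ < p'.δ ∧ p'.v i p.δ ≠ default) ∈ U.s) := by
    refine fo_val_of fun r hr => ⟨hr.2.1 hiS, hqδ.trans_le hr.1, ?_⟩
    rw [hr.2.2.1 i hiS _ hqδ, h1]
    exact hx
  have h4 := El_mk V (fun ε : W.{u} => ordn (tyo ε)) (fun ε => val (fun p : Cond X al => i ∈ p.S ∧ ε < p.δ ∧ p.v i ε ≠ default))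
    p.δ (h3 V hV)
  change El V (cl V (ordn (tyo p.δ))) (cl V (gn i)) at h4
  rw [he] at h4
  refine ball (fun ε : W.{u} => ordn (tyo ε)) (fun ε => val (fun p : Cond X al => j ∈ p.S ∧ ε < p.δ ∧ p.v j ε ≠ default))
    (io q) (fun U v => v ≠ cl U (ordn (tyo p.δ))) (fun ε V hV hval h => ?_) V hV _ h4 rfl
  have h5 := tyo_inj (ordn_inj V h)
  subst h5
  have h6 : Fo q (fun U => val (fun r : Cond X al => r.v j p.δ = default) ∈ U.s) :=
    fo_val_of fun r hr => by rw [hr.2.2.1 j hjS _ hqδ, h2]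
  obtain ⟨r, h7, h8⟩ := val_two V hval (h6 V hV)
  exact h7.2.2 h8

theorem pow_card {α : W.{u}} {μ : Cardinal.{u}}
    (hμ : Cardinal.mk {i // al i = some α} = μ) (hne : ∀ i, al i = some α → ∃ x : X i, x ≠ default)
    (U : Ult (RO (Cond X al))) {p : Mo U} (hp : IsPowOf (El U) p (cl U (ordn (Ordinal.omega 1)))) :
    InjInto (El U) (cl U (ordn μ.ord)) p := by
  have hc : Cardinal.mk μ.ord.ToType = Cardinal.mk {i // al i = some α} := by rw [hμ]; simp
  obtain ⟨e⟩ := Cardinal.eq.1 hc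
  refine inj_of_distinct μ.ord (fun j => gn (e j).1) U p (fun v hv => ?_) ?_
  · rw [hp]
    refine ball' (fun j : μ.ord.ToType => gn (e j).1) (fun _ => ⊤)
      (fun U v => SubV (El U) v (cl U (ordn (Ordinal.omega 1)))) (fun j V _ => ?_) U v hv
    exact ball' (fun ε : W.{u} => ordn (tyo ε)) _ (fun U v => El U v (cl U (ordn (Ordinal.omega 1))))
      (fun ε V _ => mem_ordn V (og_lt ε)) V
  · intro i j hij V
    exact gn_ne (fun h => hij (e.injective (Subtype.ext h))) (hne _ (e i).2) V

theorem concl_of (hκ : κ.IsInaccessible) (hX : ∀ i, Cardinal.mk (X i) < κ)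
    (hcol : ∀ β : Ordinal.{u}, β ≠ 0 → β < κ.ord → ∃ i, Nonempty (β.ToType ≃ X i))
    (μ : W.{u} → Cardinal.{u}) (hmono : StrictMono μ) (hκμ : ∀ α, κ < μ α)
    (hμ : ∀ α, Cardinal.mk {i // al i = some α} = μ α)
    (hne : ∀ α i, al i = some α → ∃ x : X i, x ≠ default)
    (U : Ult (RO (Cond X al))) : Concl (El U) := by
  have no {a b : Cardinal.{u}} (h1 : κ ≤ a) (h2 : b < a) (V : Ult (RO (Cond X al))) :
      ¬ InjInto (El V) (cl V (ordn a.ord)) (cl V (ordn b.ord)) :=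
    no_inj hκ hX (by simpa using h1) (by simpa using h2) V
  have no1 {a : Cardinal.{u}} (h1 : κ ≤ a) (V : Ult (RO (Cond X al))) :
      ¬ InjInto (El V) (cl V (ordn a.ord)) (cl V (ordn (Ordinal.omega 1))) :=
    no_inj hκ hX (by simpa using h1) (by simpa using (aleph1_lt hκ).trans_le h1) V
  refine ⟨ch_holds hκ hcol U, ?_, fun k₁ hk => ?_⟩
  · intro k₁ p k₂ hk1 hp hk2 hinj
    rw [omega1_unique U hk1 (omega1_spec U)] at hp
    have h2 := hk2.2 _ (omega1_spec U)
    have hsub : InjInto (El U) k₂ (cl U (ordn κ.ord)) := by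
      rcases ord_trich U k₂ (cl U (ordn κ.ord)) hk2.1 (ord_ordn U _) with h | h | h
      · exact inj_of_sub U ((ord_ordn U κ.ord).1 _ h)
      · rw [h]; exact inj_of_sub U fun _ h => h
      · exact absurd (h2.2 _ h) (no1 le_rfl U)
    obtain ⟨α⟩ := W_nonempty.{u}
    exact no (hκμ α).le (hκμ α) U (inj_trans U (pow_card (hμ α) (hne α) U hp) (inj_trans U hinj hsub))
  · rw [omega1_unique U hk (omega1_spec U)]
    refine ⟨fun t => no_kurepa hκ hX hcol U t, cl U (fam (fun i : W.{u} => tyo i) Tn),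
      fam_func (Ordinal.omega 1) Tn U, ?_, ?_⟩
    · intro a t _ hat
      refine fam_ball (fun i : W.{u} => tyo i) Tn ⊤
        (fun U _ t => IsJechKunenV (El U) (cl U (ordn (Ordinal.omega 1))) t) (fun α V _ => ?_) U U.top_mem a t hat
      refine ⟨Tn_omega1 hκ hcol α V, fun bs p hbs hp => ?_⟩
      obtain ⟨hb1, hb2⟩ := branch_card hκ (hκμ α).le (hμ α) (hne α) V hbs
      refine ⟨fun h => no1 (hκμ α).le V (inj_trans V hb1 h),
        inj_trans V hb2 (pow_card (hμ α) (hne α) V hp), fun h => ?_⟩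
      obtain ⟨β, hβ⟩ := W_succ α
      exact no (hκμ β).le (hmono hβ) V (inj_trans V (pow_card (hμ β) (hne β) V hp)
        (inj_trans V (inj_of_equinum' V h) hb2))
    · intro a a' t t' bs bs' _ _ haa hat hat' hbs hbs' heq
      refine fam_ball (fun i : W.{u} => tyo i) Tn ⊤
        (fun U a t => ∀ a' t' bs bs', a ≠ a' →
          FunVal (El U) (cl U (fam (fun i : W.{u} => tyo i) Tn)) a' t' →
          IsBranchSetOf (El U) t bs → IsBranchSetOf (El U) t' bs' → ¬ EquinumV (El U) bs bs')
        (fun α V _ => ?_) U U.top_mem a t hat a' t' bs bs' haa hat' hbs hbs' heq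
      clear haa hat hat' hbs hbs' heq
      intro a' t' bs bs' haa hat' hbs hbs' heq
      refine fam_ball (fun i : W.{u} => tyo i) Tn ⊤
        (fun U a' t' => ∀ bs bs', cl U (ordn (tyo α)) ≠ a' →
          IsBranchSetOf (El U) (cl U (Tn α)) bs → IsBranchSetOf (El U) t' bs' → ¬ EquinumV (El U) bs bs')
        (fun α' V _ => ?_) V V.top_mem a' t' hat' bs bs' haa hbs hbs' heq
      clear haa hat' hbs hbs' heq
      intro bs bs' haa hbs hbs' heq
      obtain ⟨hb1, hb2⟩ := branch_card hκ (hκμ α).le (hμ α) (hne α) V hbs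
      obtain ⟨hb1', hb2'⟩ := branch_card hκ (hκμ α').le (hμ α') (hne α') V hbs'
      have hαα : α ≠ α' := fun h => haa (by rw [h])
      rcases lt_or_gt_of_ne hαα with h | h
      · exact no (hκμ α').le (hmono h) V (inj_trans V hb1' (inj_trans V (inj_of_equinum' V heq) hb2))
      · exact no (hκμ α).le (hmono h) V (inj_trans V hb1 (inj_trans V (inj_of_equinum V heq) hb2'))

end Tree

theorem final : ∃ (V : Type) (str : memLang.Structure V), ZFCTheory.Model V ∧ Concl (memE V str) := by
  classical
  let κ : Cardinal.{1} := Cardinal.univ.{0, 1}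
  have hκ : κ.IsInaccessible := Cardinal.IsInaccessible.univ
  obtain ⟨o, ho⟩ : ∃ o, κ = Cardinal.aleph o := by
    obtain ⟨o, h⟩ : κ ∈ Set.range Cardinal.aleph := by
      rw [Cardinal.range_aleph]
      exact (Cardinal.aleph0_le_aleph 1).trans (aleph1_lt hκ).le
    exact ⟨o, h.symm⟩
  let μ : W.{1} → Cardinal.{1} := fun α => Cardinal.aleph (o + 1 + tyo α)
  have hmono : StrictMono μ := by
    intro a b hab
    exact Cardinal.aleph_lt_aleph.2 (by simpa using tyo_lt.2 hab)
  have hκμ : ∀ α, κ < μ α := by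
    intro α
    rw [ho]
    refine Cardinal.aleph_lt_aleph.2 (lt_of_lt_of_le (Order.lt_add_one_iff.2 le_rfl) le_self_add)
  let Idx : Type 1 := {ξ : κ.ord.ToType // tyo ξ ≠ 0} ⊕ Σ α : W.{1}, (μ α).ord.ToType
  let X : Idx → Type 1 := fun i => match i with
    | Sum.inl ξ => (tyo ξ.1).ToType
    | Sum.inr _ => ULift.{1} Bool
  let al : Idx → Option W.{1} := fun i => match i with
    | Sum.inl _ => none
    | Sum.inr x => some x.1
  have hinh : ∀ i, Nonempty (X i) := by
    rintro (ξ | x)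
    · exact Ordinal.nonempty_toType_iff.2 ξ.2
    · exact ⟨⟨true⟩⟩
  have inst : ∀ i, Inhabited (X i) := fun i => Classical.inhabited_of_nonempty (hinh i)
  have hX : ∀ i, Cardinal.mk (X i) < κ := by
    rintro (ξ | x)
    · change Cardinal.mk (tyo ξ.1).ToType < κ
      rw [Cardinal.mk_toType, ← Cardinal.lt_ord]
      simpa using Ordinal.typein_lt_type (α := κ.ord.ToType) (· < ·) ξ.1
    · change Cardinal.mk (ULift.{1} Bool) < κ
      refine lt_of_lt_of_le ?_ ((Cardinal.aleph0_le_aleph 1).trans (aleph1_lt hκ).le)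
      simp
  have hcol : ∀ β : Ordinal.{1}, β ≠ 0 → β < κ.ord → ∃ i, Nonempty (β.ToType ≃ X i) := by
    intro β h0 hβ
    have h1 : β < Ordinal.type (α := κ.ord.ToType) (· < ·) := by simpa using hβ
    let x := Ordinal.enum (α := κ.ord.ToType) (· < ·) ⟨β, h1⟩
    have hx : tyo x = β := Ordinal.typein_enum _ h1
    refine ⟨Sum.inl ⟨x, by rw [hx]; exact h0⟩, ?_⟩
    change Nonempty (β.ToType ≃ (tyo x).ToType)
    rw [hx]
    exact ⟨Equiv.refl _⟩
  have hμ : ∀ α, Cardinal.mk {i // al i = some α} = μ α := by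
    intro α
    have e : {i // al i = some α} ≃ (μ α).ord.ToType :=
      { toFun := fun i => match i with
          | ⟨Sum.inl _, h⟩ => absurd h (by simp [al])
          | ⟨Sum.inr ⟨β, x⟩, h⟩ => (Option.some.inj h : β = α) ▸ x
        invFun := fun x => ⟨Sum.inr ⟨α, x⟩, rfl⟩
        left_inv := by
          rintro ⟨ξ | ⟨β, x⟩, h⟩
          · simp [al] at h
          · have : β = α := Option.some.inj h
            subst this
            rfl
        right_inv := fun x => rfl }
    rw [Cardinal.mk_congr e]
    simp
  have hne : ∀ α i, al i = some α → ∃ x : X i, x ≠ default := by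
    rintro α (ξ | x) h
    · simp [al] at h
    · change ∃ y : ULift.{1} Bool, y ≠ (inst (Sum.inr x)).default
      generalize (inst (Sum.inr x)).default = d
      obtain ⟨d⟩ : ULift.{1} Bool := d
      exact ⟨⟨!d⟩, by simp⟩
  have hU : ∃ U : Ult (RO (Cond X al)), True := by
    by_contra hc
    obtain ⟨w⟩ := W_nonempty.{1}
    refine fo_false (p := (⟨w, ∅, fun _ _ => default, fun _ _ _ => False, Set.countable_empty,
      fun _ _ _ => rfl, fun _ _ _ => rfl, fun _ _ _ h => h.elim, fun _ h => h.elim⟩ : Cond X al)) fun U _ => hc ⟨U, trivial⟩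
  obtain ⟨U, -⟩ := hU
  exact transfer_mo U (concl_of hκ hX hcol μ hmono hκμ hμ hne U)

end JK

/-- **Theorem 9.** Assume the existence of a strongly inaccessible cardinal is
consistent with ZFC. Then it is consistent with ZFC + CH + `2^{ω₁} > ω₂` that there are
no Kurepa trees, yet there are ω₁-many Jech–Kunen trees `T^α` (α < ω₁), given by a
function in the model with domain ω₁, whose branch sets have pairwise different
cardinalities. -/
theorem consistency_many_jech_kunen_no_kurepa
    (hCon : ∃ (V : Type) (str : memLang.Structure V),
      ZFCTheory.Model V ∧ ∃ κ : V, IsInaccessibleV (memE V str) κ) :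
    ∃ (V : Type) (str : memLang.Structure V),
      ZFCTheory.Model V ∧
      CHV (memE V str) ∧
      PowOmega1AboveOmega2V (memE V str) ∧
      ∀ k₁ : V, IsOmega1V (memE V str) k₁ →
        (∀ t : V, ¬ IsKurepaV (memE V str) k₁ t) ∧
        ∃ F : V, IsFuncOn (memE V str) F k₁ ∧
          (∀ α t : V, memE V str α k₁ → FunVal (memE V str) F α t →
            IsJechKunenV (memE V str) k₁ t) ∧
          (∀ α α' t t' bs bs' : V, memE V str α k₁ → memE V str α' k₁ → α ≠ α' →
            FunVal (memE V str) F α t → FunVal (memE V str) F α' t' →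
            IsBranchSetOf (memE V str) t bs → IsBranchSetOf (memE V str) t' bs' →
            ¬ EquinumV (memE V str) bs bs') := by
  exact JK.final
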